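/- Let Ω ⊂ ℝ² be a smooth bounded strictly star-shaped domain, g : ∂Ω → Γ smooth of degree d, and let u_ε solve Δu_ε = ε⁻²∇W(u_ε) in Ω with u_ε = g on ∂Ω. Fix δ₂ ∈ (0, δ₁]. If (x_ε) ⊂ Ω is a family of points with dist(u_ε(x_ε), Γ) > δ₂ for every ε, then dist(x_ε, ∂Ω)/ε → ∞ as ε → 0. -/

import Mathlib

open Complex Metric MeasureTheory Filter Set Topology Bornology

noncomputable section

/-- The Laplacian of a map `u : ℂ → ℂ`, viewing `ℂ ≅ ℝ²`. -/
def lapC (u : ℂ → ℂ) (x : ℂ) : ℂ :=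
  fderiv ℝ (fun y => fderiv ℝ u y 1) x 1 +
    fderiv ℝ (fun y => fderiv ℝ u y Complex.I) x Complex.I

/-- The Laplacian of a function `h : ℂ → ℝ`. -/
def lapR (h : ℂ → ℝ) (x : ℂ) : ℝ :=
  fderiv ℝ (fun y => fderiv ℝ h y 1) x 1 +
    fderiv ℝ (fun y => fderiv ℝ h y Complex.I) x Complex.I

/-- `|∇u|²` for `u : ℂ → ℂ`. -/
def gradSq (u : ℂ → ℂ) (x : ℂ) : ℝ :=
  ‖fderiv ℝ u x 1‖ ^ 2 + ‖fderiv ℝ u x Complex.I‖ ^ 2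

/-- The gradient `∇W` of a potential `W : ℂ → ℝ`, as a point of `ℂ ≅ ℝ²`. -/
def gradW (W : ℂ → ℝ) (x : ℂ) : ℂ :=
  (fderiv ℝ W x 1 : ℂ) + (fderiv ℝ W x Complex.I : ℂ) * Complex.I

/-- The Ginzburg–Landau type energy `E_ε(u) = ∫_Ω [½|∇u|² + W(u)/ε²]`. -/
def energy (W : ℂ → ℝ) (Ω : Set ℂ) (ε : ℝ) (u : ℂ → ℂ) : ℝ :=
  ∫ x in Ω, ((1 / 2) * gradSq u x + W (u x) / ε ^ 2)

/-- `Γ` is a smooth simple closed curve of length `2π`, with (`2π`-periodic) arclength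
parametrization `τ` (so that the point `τ(e^{is})` of the paper is `τ s` here). -/
structure ArcParam (Γ : Set ℂ) (τ : ℝ → ℂ) : Prop where
  smooth : ContDiff ℝ (⊤ : ℕ∞) τ
  periodic : Function.Periodic τ (2 * Real.pi)
  arclength : ∀ s, ‖deriv τ s‖ = 1
  inj : ∀ s t : ℝ, τ s = τ t → ∃ k : ℤ, s - t = 2 * Real.pi * k
  srange : Set.range τ = Γ

/-- The hypotheses (h1)–(h5) on the potential `W`: smooth, nonnegative, vanishing exactly
on `Γ`, non-degenerate near `Γ`, and radially coercive outside `B_{R₀} ⊇ Γ`. -/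
structure PotentialHyp (Γ : Set ℂ) (W : ℂ → ℝ) (R₀ : ℝ) : Prop where
  smooth : ContDiff ℝ (⊤ : ℕ∞) W
  nonneg : ∀ z, 0 ≤ W z
  zeros : W ⁻¹' {0} = Γ
  nondeg : ∃ μ > 0, ∃ δ > 0, ∀ z : ℂ,
    Metric.infDist z Γ < δ → μ * Metric.infDist z Γ ^ 2 ≤ W z
  R0_large : ∀ z ∈ Γ, ‖z‖ < R₀
  coercive : ∀ z : ℂ, R₀ < ‖z‖ →
    0 ≤ (gradW W z).re * z.re + (gradW W z).im * z.im

/-- `u` is a (globally smooth) solution of `Δu = ε⁻² ∇W(u)` in `Ω`. -/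
def SolvesGL (W : ℂ → ℝ) (Ω : Set ℂ) (ε : ℝ) (u : ℂ → ℂ) : Prop :=
  ContDiff ℝ (⊤ : ℕ∞) u ∧ ∀ x ∈ Ω, lapC u x = (ε ^ 2)⁻¹ • gradW W (u x)

/-- The decomposition `u = τ(e^{iφ}) + t·n⃗(τ(e^{iφ}))` on the set `s`, where `t` is the
signed distance of `u` to `Γ` and `φ` is a (global) phase; the unit normal to `Γ` at `τ s`
is `i·τ'(s)`. -/
def PhaseDecomp (Γ : Set ℂ) (τ : ℝ → ℂ) (s : Set ℂ) (u : ℂ → ℂ) (t φ : ℂ → ℝ) : Prop :=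
  ContinuousOn t s ∧ ContinuousOn φ s ∧
    ∀ x ∈ s, u x = τ (φ x) + (t x : ℂ) * (Complex.I * deriv τ (φ x)) ∧
      |t x| = Metric.infDist (u x) Γ

/-- `γ` is an `L`-periodic arclength parametrization of the (smooth) boundary of `Ω`. -/
structure BoundaryParam (Ω : Set ℂ) (γ : ℝ → ℂ) (L : ℝ) : Prop where
  Lpos : 0 < L
  smooth : ContDiff ℝ (⊤ : ℕ∞) γ
  periodic : Function.Periodic γ L
  arclength : ∀ s, ‖deriv γ s‖ = 1
  inj : ∀ s t : ℝ, γ s = γ t → ∃ k : ℤ, s - t = L * k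
  srange : Set.range γ = frontier Ω

/-- `n` is the outward unit normal field along the boundary parametrization `γ` of `Ω`. -/
structure OutwardNormal (Ω : Set ℂ) (γ : ℝ → ℂ) (n : ℝ → ℂ) : Prop where
  unit : ∀ s, ‖n s‖ = 1
  orth : ∀ s, (n s).re * (deriv γ s).re + (n s).im * (deriv γ s).im = 0
  outward : ∀ s, ∀ᶠ r in nhdsWithin (0 : ℝ) (Set.Ioi (0 : ℝ)), γ s + Complex.ofReal r * n s ∉ closure Ω

/-- The maximum principle for the phase (Proposition 2.2) holds with constants `δ₁`, `m`:
for every critical point `u` of `E_ε` on a bounded simply connected domain `ω`, continuous on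
`closure ω` and with `dist(u,Γ) ≤ δ₁` there, the functions `φ ∓ m t²/2` attain their
min/max on `∂ω`. -/
def MaxPrinciple (Γ : Set ℂ) (τ : ℝ → ℂ) (W : ℂ → ℝ) (δ₁ m : ℝ) : Prop :=
  ∀ (ω : Set ℂ) (ε : ℝ) (u : ℂ → ℂ) (t φ : ℂ → ℝ),
    IsOpen ω → Bornology.IsBounded ω → ω.Nonempty → SimplyConnectedSpace ↥ω →
    0 < ε → ContDiffOn ℝ (⊤ : ℕ∞) u ω → ContinuousOn u (closure ω) →
    (∀ x ∈ ω, lapC u x = (ε ^ 2)⁻¹ • gradW W (u x)) →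
    (∀ x ∈ closure ω, Metric.infDist (u x) Γ ≤ δ₁) →
    PhaseDecomp Γ τ (closure ω) u t φ →
    sInf ((fun x => φ x - m * t x ^ 2 / 2) '' closure ω) =
        sInf ((fun x => φ x - m * t x ^ 2 / 2) '' frontier ω) ∧
      sSup ((fun x => φ x + m * t x ^ 2 / 2) '' closure ω) =
        sSup ((fun x => φ x + m * t x ^ 2 / 2) '' frontier ω)

/-- The directional derivative of `f : ℂ → ℝ` in the direction `e`. -/
def pd (e : ℂ) (f : ℂ → ℝ) : ℂ → ℝ := fun z => fderiv ℝ f z e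

/-- Smoothness of real-valued functions on the plane. -/
abbrev Smooth (f : ℂ → ℝ) : Prop := ContDiff ℝ (⊤ : ℕ∞) f

theorem Smooth.diff {f : ℂ → ℝ} (hf : Smooth f) (z : ℂ) : DifferentiableAt ℝ f z :=
  (hf.differentiable (by simp)) z

theorem Smooth.pd {f : ℂ → ℝ} (hf : Smooth f) (e : ℂ) : Smooth (pd e f) :=
  (hf.fderiv_right (m := ((⊤ : ℕ∞) : WithTop ℕ∞)) (by simp)).clm_apply contDiff_const

theorem pd_add {f g : ℂ → ℝ} (hf : Smooth f) (hg : Smooth g) (e : ℂ) :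
    pd e (fun z => f z + g z) = fun z => pd e f z + pd e g z := by
  funext z
  have := ((hf.diff z).hasFDerivAt.add (hg.diff z).hasFDerivAt).fderiv
  simp only [pd]
  change (fderiv ℝ (f + g) z) e = _
  rw [this]; rfl

theorem pd_sub {f g : ℂ → ℝ} (hf : Smooth f) (hg : Smooth g) (e : ℂ) :
    pd e (fun z => f z - g z) = fun z => pd e f z - pd e g z := by
  funext z
  have := ((hf.diff z).hasFDerivAt.sub (hg.diff z).hasFDerivAt).fderiv
  simp only [pd]
  change (fderiv ℝ (f - g) z) e = _
  rw [this]; rfl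

theorem pd_mul {f g : ℂ → ℝ} (hf : Smooth f) (hg : Smooth g) (e : ℂ) :
    pd e (fun z => f z * g z) = fun z => pd e f z * g z + f z * pd e g z := by
  funext z
  simp only [pd]
  rw [fderiv_fun_mul (hf.diff z) (hg.diff z)]
  simp [mul_comm, add_comm]

theorem pd_const (c : ℝ) (e : ℂ) : pd e (fun _ => c) = fun _ => 0 := by
  funext z
  simp [pd]

theorem pd_const_mul {f : ℂ → ℝ} (hf : Smooth f) (c : ℝ) (e : ℂ) :
    pd e (fun z => c * f z) = fun z => c * pd e f z := by
  rw [pd_mul contDiff_const hf, pd_const]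
  simp

theorem pd_comp {f : ℂ → ℝ} (hf : Smooth f) {F : ℝ → ℝ} (hF : ContDiff ℝ (⊤ : ℕ∞) F) (e : ℂ) :
    pd e (fun z => F (f z)) = fun z => deriv F (f z) * pd e f z := by
  funext z
  have h := ((hF.differentiable (by simp) (f z)).hasDerivAt.comp_hasFDerivAt z
    (hf.diff z).hasFDerivAt).fderiv
  simp only [pd]
  change (fderiv ℝ (F ∘ f) z) e = _
  rw [h]; simp

theorem pd_exp {f : ℂ → ℝ} (hf : Smooth f) (e : ℂ) :
    pd e (fun z => Real.exp (f z)) = fun z => Real.exp (f z) * pd e f z := by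
  rw [pd_comp hf Real.contDiff_exp]
  simp

theorem pd_comm {f : ℂ → ℝ} (hf : Smooth f) (a b : ℂ) : pd a (pd b f) = pd b (pd a f) := by
  funext z
  have hd : DifferentiableAt ℝ (fderiv ℝ f) z :=
    ((hf.fderiv_right (m := 1) (by norm_cast)).differentiable (by simp)) z
  have key : ∀ a b : ℂ, pd a (pd b f) z = fderiv ℝ (fderiv ℝ f) z a b := by
    intro a b
    simp only [pd]
    change (fderiv ℝ (fun y => (fderiv ℝ f y) b) z) a = _
    rw [fderiv_clm_apply hd (differentiableAt_const b)]
    simp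
  rw [key, key]
  have hs : IsSymmSndFDerivAt ℝ f z := hf.contDiffAt.isSymmSndFDerivAt (by
    rw [minSmoothness_of_isRCLikeNormedField]; exact WithTop.coe_le_coe.2 (le_top : (2 : ℕ∞) ≤ ⊤))
  exact hs a b

theorem pd_re (e : ℂ) : pd e Complex.re = fun _ => e.re := by
  funext z
  exact congrArg (fun l => l e) (Complex.reCLM.hasFDerivAt (x := z)).fderiv

theorem pd_im (e : ℂ) : pd e Complex.im = fun _ => e.im := by
  funext z
  exact congrArg (fun l => l e) (Complex.imCLM.hasFDerivAt (x := z)).fderiv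

theorem smooth_re : Smooth Complex.re := Complex.reCLM.contDiff
theorem smooth_im : Smooth Complex.im := Complex.imCLM.contDiff

theorem pd_decomp (f : ℂ → ℝ) (e z : ℂ) :
    pd e f z = e.re * pd 1 f z + e.im * pd Complex.I f z := by
  simp only [pd]
  conv_lhs => rw [← Complex.re_add_im e]
  rw [map_add, show ((e.re : ℂ)) = e.re • (1 : ℂ) by simp,
    show ((e.im : ℂ)) * Complex.I = e.im • Complex.I by simp, map_smul, map_smul]
  simp

theorem hasDerivAt_comp_curve {f : ℂ → ℝ} (hf : Smooth f) {γ : ℝ → ℂ} {v : ℂ} {s : ℝ}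
    (hγ : HasDerivAt γ v s) :
    HasDerivAt (fun s => f (γ s)) (v.re * pd 1 f (γ s) + v.im * pd Complex.I f (γ s)) s := by
  rw [← pd_decomp]
  exact (hf.diff (γ s)).hasFDerivAt.comp_hasDerivAt s hγ

theorem lapR_eq_pd (f : ℂ → ℝ) (z : ℂ) :
    lapR f z = pd 1 (pd 1 f) z + pd Complex.I (pd Complex.I f) z := rfl

theorem pd_re_comp {u : ℂ → ℂ} (hu : ContDiff ℝ (⊤ : ℕ∞) u) (e z : ℂ) :
    pd e (fun z => (u z).re) z = (fderiv ℝ u z e).re := by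
  have h := (Complex.reCLM.hasFDerivAt.comp z
    ((hu.differentiable (by simp)) z).hasFDerivAt).fderiv
  exact congrArg (fun l => l e) h

theorem pd_im_comp {u : ℂ → ℂ} (hu : ContDiff ℝ (⊤ : ℕ∞) u) (e z : ℂ) :
    pd e (fun z => (u z).im) z = (fderiv ℝ u z e).im := by
  have h := (Complex.imCLM.hasFDerivAt.comp z
    ((hu.differentiable (by simp)) z).hasFDerivAt).fderiv
  exact congrArg (fun l => l e) h

theorem contDiff_fderiv_apply {u : ℂ → ℂ} (hu : ContDiff ℝ (⊤ : ℕ∞) u) (e : ℂ) :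
    ContDiff ℝ (⊤ : ℕ∞) (fun z => fderiv ℝ u z e) :=
  (hu.fderiv_right (m := ((⊤ : ℕ∞) : WithTop ℕ∞)) (by simp)).clm_apply contDiff_const

theorem smooth_re_comp {u : ℂ → ℂ} (hu : ContDiff ℝ (⊤ : ℕ∞) u) : Smooth fun z => (u z).re :=
  Complex.reCLM.contDiff.comp hu

theorem smooth_im_comp {u : ℂ → ℂ} (hu : ContDiff ℝ (⊤ : ℕ∞) u) : Smooth fun z => (u z).im :=
  Complex.imCLM.contDiff.comp hu

theorem lapC_re {u : ℂ → ℂ} (hu : ContDiff ℝ (⊤ : ℕ∞) u) (z : ℂ) :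
    (lapC u z).re = lapR (fun z => (u z).re) z := by
  rw [lapR_eq_pd, lapC, Complex.add_re, ← pd_re_comp (contDiff_fderiv_apply hu 1),
    ← pd_re_comp (contDiff_fderiv_apply hu Complex.I)]
  simp_rw [← pd_re_comp hu]

theorem lapC_im {u : ℂ → ℂ} (hu : ContDiff ℝ (⊤ : ℕ∞) u) (z : ℂ) :
    (lapC u z).im = lapR (fun z => (u z).im) z := by
  rw [lapR_eq_pd, lapC, Complex.add_im, ← pd_im_comp (contDiff_fderiv_apply hu 1),
    ← pd_im_comp (contDiff_fderiv_apply hu Complex.I)]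
  simp_rw [← pd_im_comp hu]

theorem inter_frontier_nonempty_of_isPreconnected {Ω t : Set ℂ} (ht : IsPreconnected t)
    (h1 : (t ∩ Ω).Nonempty) (h2 : (t ∩ Ωᶜ).Nonempty) : (t ∩ frontier Ω).Nonempty := by
  by_contra h
  rw [Set.not_nonempty_iff_eq_empty] at h
  have hmem : ∀ x ∈ t, x ∉ frontier Ω := fun x hx hf => by
    have : x ∈ t ∩ frontier Ω := ⟨hx, hf⟩
    rw [h] at this
    exact this
  have hcov : t ⊆ interior Ω ∪ (closure Ω)ᶜ := by
    intro x hx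
    by_cases hi : x ∈ interior Ω
    · exact Or.inl hi
    · exact Or.inr fun hc => hmem x hx ⟨hc, hi⟩
  obtain ⟨a, ha, haΩ⟩ := h1
  obtain ⟨b, hb, hbΩ⟩ := h2
  obtain ⟨y, -, hy1, hy2⟩ := ht _ _ isOpen_interior isClosed_closure.isOpen_compl hcov
    ⟨a, ha, (hcov ha).resolve_right fun h => h (subset_closure haΩ)⟩
    ⟨b, hb, (hcov hb).resolve_left fun h => hbΩ (interior_subset h)⟩
  exact hy2 (subset_closure (interior_subset hy1))

/-- The Euclidean inner product of two points of the plane. -/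
def dot (a b : ℂ) : ℝ := a.re * b.re + a.im * b.im

theorem abs_dot_le (a b : ℂ) : |dot a b| ≤ ‖a‖ * ‖b‖ := by
  have h : dot a b = (a * (starRingEnd ℂ) b).re := by simp [dot]
  rw [h]
  calc _ ≤ ‖a * (starRingEnd ℂ) b‖ := Complex.abs_re_le_norm _
    _ = _ := by simp

theorem dot_le (a b : ℂ) : dot a b ≤ ‖a‖ * ‖b‖ := (le_abs_self _).trans (abs_dot_le a b)

theorem dot_add_left (a b v : ℂ) : dot (a + b) v = dot a v + dot b v := by
  simp [dot]; ring
theorem dot_sub_left (a b v : ℂ) : dot (a - b) v = dot a v - dot b v := by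
  simp [dot]; ring
theorem dot_smul_left (r : ℝ) (b v : ℂ) : dot ((r : ℂ) * b) v = r * dot b v := by
  simp [dot]; ring
theorem dot_self (a : ℂ) : dot a a = ‖a‖ ^ 2 := by
  rw [← Complex.normSq_eq_norm_sq, Complex.normSq_apply, dot]

theorem BoundaryParam.exists_near {Ω : Set ℂ} {γ : ℝ → ℂ} {L : ℝ} (hγ : BoundaryParam Ω γ L)
    {p : ℂ} (hp : p ∈ frontier Ω) (s : ℝ) : ∃ t ∈ Set.Icc (s - L / 2) (s + L / 2), γ t = p := by
  rw [← hγ.srange] at hp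
  obtain ⟨t, rfl⟩ := hp
  refine ⟨toIcoMod hγ.Lpos (s - L / 2) t, ?_, ?_⟩
  swap
  · rw [← self_sub_toIcoDiv_zsmul hγ.Lpos]
    exact hγ.periodic.sub_zsmul_eq _
  have := toIcoMod_mem_Ico hγ.Lpos (s - L / 2) t
  constructor
  · exact this.1
  · linarith [this.2]

/-- A direction with positive normal component does not enter the domain. -/
theorem outward_transversal {Ω : Set ℂ} {γ nv : ℝ → ℂ} {L : ℝ} (hγ : BoundaryParam Ω γ L)
    (hn : OutwardNormal Ω γ nv) (s : ℝ) (v : ℂ) (hv : 0 < dot v (nv s)) :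
    ¬ ∀ᶠ r : ℝ in 𝓝[>] (0 : ℝ), γ s + (r : ℂ) * v ∈ Ω := by
  intro hin
  set n := nv s with hn_def
  have hn1 : ‖n‖ = 1 := hn.unit s
  have hnn : dot n n = 1 := by rw [dot_self, hn1]; norm_num
  set c₁ := min (dot v n) 1 with hc₁
  have hc₁0 : 0 < c₁ := lt_min hv one_pos
  set C := ‖v‖ + 1 with hC
  have hC0 : 0 < C := by positivity
  have key : ∀ᶠ r : ℝ in 𝓝[>] (0 : ℝ), ∃ t ∈ Set.Icc (s - L / 2) (s + L / 2),
      ‖γ t - γ s‖ ≤ r * C ∧ r * c₁ ≤ dot (γ t - γ s) n := by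
    filter_upwards [hin, hn.outward s, self_mem_nhdsWithin] with r h1 h2 h3
    have h3 : 0 < r := h3
    have hpre : IsPreconnected (segment ℝ (γ s + (r : ℂ) * v) (γ s + (r : ℂ) * n)) :=
      (convex_segment _ _).isPreconnected
    obtain ⟨w, hw, hwf⟩ := inter_frontier_nonempty_of_isPreconnected (Ω := Ω) hpre
      ⟨_, left_mem_segment ℝ _ _, h1⟩
      ⟨_, right_mem_segment ℝ _ _, fun h => h2 (subset_closure h)⟩
    obtain ⟨t, ht, rfl⟩ := hγ.exists_near hwf s
    refine ⟨t, ht, ?_⟩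
    obtain ⟨a, b, ha, hb, hab, hw⟩ := hw
    have hb' : b = 1 - a := by linarith
    have e : γ t - γ s = (r : ℂ) * ((a : ℂ) * v + (b : ℂ) * n) := by
      rw [← hw, hb']
      simp only [Complex.real_smul]
      push_cast
      ring
    rw [e]
    constructor
    · rw [norm_mul, Complex.norm_real, Real.norm_of_nonneg h3.le]
      apply mul_le_mul_of_nonneg_left _ h3.le
      refine (norm_add_le _ _).trans ?_
      rw [norm_mul, norm_mul, Complex.norm_real, Complex.norm_real, Real.norm_of_nonneg ha,
        Real.norm_of_nonneg hb, hn1]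
      nlinarith [norm_nonneg v]
    · rw [dot_smul_left, dot_add_left, dot_smul_left, dot_smul_left, hnn]
      apply mul_le_mul_of_nonneg_left _ h3.le
      have : c₁ ≤ dot v n := min_le_left _ _
      have : c₁ ≤ 1 := min_le_right _ _
      nlinarith
  have hfr : ∀ k : ℕ, ∃ r : ℝ, 0 < r ∧ r < 1 / ((k : ℝ) + 1) ∧
      ∃ t ∈ Set.Icc (s - L / 2) (s + L / 2),
      ‖γ t - γ s‖ ≤ r * C ∧ r * c₁ ≤ dot (γ t - γ s) n := by
    intro k
    have h1 : ∀ᶠ r : ℝ in 𝓝[>] (0 : ℝ), r < 1 / ((k : ℝ) + 1) :=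
      eventually_nhdsWithin_of_eventually_nhds (gt_mem_nhds (by positivity))
    obtain ⟨r, h⟩ := ((key.and h1).and self_mem_nhdsWithin).exists
    exact ⟨r, h.2, h.1.2, h.1.1⟩
  choose r hr0 hrk t htI htn htd using hfr
  have hr : Tendsto r atTop (𝓝 0) :=
    squeeze_zero (fun k => (hr0 k).le) (fun k => (hrk k).le) tendsto_one_div_add_atTop_nhds_zero_nat
  obtain ⟨t₀, ht₀, φ, hφ, hlim⟩ := isCompact_Icc.tendsto_subseq htI
  have hγc : Continuous γ := hγ.smooth.continuous
  have hlim2 : Tendsto (fun k => γ (t (φ k)) - γ s) atTop (𝓝 0) := by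
    apply squeeze_zero_norm (fun k => htn (φ k))
    simpa using (hr.comp hφ.tendsto_atTop).mul_const C
  have hlim3 : Tendsto (fun k => γ (t (φ k)) - γ s) atTop (𝓝 (γ t₀ - γ s)) :=
    ((hγc.tendsto t₀).comp hlim).sub_const _
  have heq : γ t₀ = γ s := sub_eq_zero.1 (tendsto_nhds_unique hlim3 hlim2)
  have ht₀s : t₀ = s := by
    obtain ⟨k, hk⟩ := hγ.inj _ _ heq
    have hL := hγ.Lpos
    have h1 : (k : ℝ) < 1 := by
      by_contra h
      push Not at h
      nlinarith [ht₀.2]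
    have h2 : (-1 : ℝ) < k := by
      by_contra h
      push Not at h
      nlinarith [ht₀.1]
    have : k = 0 := by
      have h1 : k < 1 := by exact_mod_cast h1
      have h2 : -1 < k := by exact_mod_cast h2
      omega
    rw [this] at hk
    simp at hk
    linarith
  rw [ht₀s] at hlim
  have hne : ∀ k, t k ≠ s := by
    intro k h
    have := htd k
    rw [h, sub_self] at this
    simp [dot] at this
    nlinarith [hr0 k]
  have hder : HasDerivAt γ (deriv γ s) s :=
    ((hγ.smooth.differentiable (by simp)) s).hasDerivAt
  have hslope := (hasDerivAt_iff_tendsto_slope.1 hder).comp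
    (tendsto_nhdsWithin_iff.2 ⟨hlim, Eventually.of_forall fun k => hne _⟩)
  have hsl : ∀ k, slope γ s (t k) = (((t k - s)⁻¹ : ℝ) : ℂ) * (γ (t k) - γ s) := by
    intro k
    rw [slope_def_module, Complex.real_smul]
  have hineq : ∀ k, c₁ / C * ‖slope γ s (t (φ k))‖ ≤ |dot (slope γ s (t (φ k))) n| := by
    intro k
    rw [hsl, norm_mul, Complex.norm_real, dot_smul_left, abs_mul, Real.norm_eq_abs]
    have h1 := htn (φ k)
    have h2 := htd (φ k)
    have h3 : c₁ / C * ‖γ (t (φ k)) - γ s‖ ≤ |dot (γ (t (φ k)) - γ s) n| := by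
      refine le_trans ?_ (h2.trans (le_abs_self _))
      rw [div_mul_eq_mul_div, div_le_iff₀ hC0]
      nlinarith
    nlinarith [abs_nonneg ((t (φ k) - s)⁻¹)]
  have hlimd : Tendsto (fun k => |dot (slope γ s (t (φ k))) n|) atTop
      (𝓝 |dot (deriv γ s) n|) := by
    have hc : Continuous fun z => |dot z n| := by
      unfold dot
      fun_prop
    exact (hc.tendsto _).comp hslope
  have hfin := le_of_tendsto_of_tendsto' (hslope.norm.const_mul (c₁ / C)) hlimd hineq
  have h0 : dot (deriv γ s) n = 0 := by
    have := hn.orth s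
    simp only [dot]
    linarith
  rw [h0, hγ.arclength s] at hfin
  simp at hfin
  have : 0 < c₁ / C := by positivity
  linarith

section StarShaped

variable {Ω : Set ℂ} {γ nv : ℝ → ℂ} {L c : ℝ}

theorem le_norm_of_mem_frontier (hγ : BoundaryParam Ω γ L) (hn : OutwardNormal Ω γ nv)
    (hstar : ∀ s, c ≤ dot (γ s) (nv s)) {p : ℂ} (hp : p ∈ frontier Ω) : c ≤ ‖p‖ := by
  rw [← hγ.srange] at hp
  obtain ⟨s, rfl⟩ := hp
  have := dot_le (γ s) (nv s)
  rw [hn.unit s, mul_one] at this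
  exact (hstar s).trans this

theorem ball_subset_of_star (hc : 0 < c) (h0 : (0 : ℂ) ∈ Ω) (hγ : BoundaryParam Ω γ L)
    (hn : OutwardNormal Ω γ nv) (hstar : ∀ s, c ≤ dot (γ s) (nv s)) :
    Metric.ball (0 : ℂ) c ⊆ Ω := by
  intro z hz
  by_contra hzΩ
  obtain ⟨w, hw, hwf⟩ := inter_frontier_nonempty_of_isPreconnected (Ω := Ω)
    (convex_ball (0 : ℂ) c).isPreconnected ⟨0, by simpa using hc, h0⟩ ⟨z, hz, hzΩ⟩
  have := le_norm_of_mem_frontier hγ hn hstar hwf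
  simp at hw
  linarith

theorem segment_mem_of_star (hΩo : IsOpen Ω) (hc : 0 < c) (h0 : (0 : ℂ) ∈ Ω)
    (hγ : BoundaryParam Ω γ L) (hn : OutwardNormal Ω γ nv)
    (hstar : ∀ s, c ≤ dot (γ s) (nv s)) {b z : ℂ} (hb : ‖b‖ < c) (hz : z ∈ Ω) {l : ℝ}
    (hl0 : 0 ≤ l) (hl1 : l ≤ 1) : b + (l : ℂ) * (z - b) ∈ Ω := by
  by_contra hl
  set f : ℝ → ℂ := fun l => b + (l : ℂ) * (z - b) with hf
  have hfc : Continuous f := by fun_prop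
  have hS : IsCompact (Set.Icc (0 : ℝ) 1 ∩ f ⁻¹' Ωᶜ) :=
    isCompact_Icc.inter_right (hΩo.isClosed_compl.preimage hfc)
  obtain ⟨m, hm, hmax⟩ := hS.exists_isMaxOn ⟨l, ⟨hl0, hl1⟩, hl⟩ continuousOn_id
  have hmΩ : f m ∉ Ω := hm.2
  have hm1 : m < 1 := by
    refine lt_of_le_of_ne hm.1.2 ?_
    rintro rfl
    exact hmΩ (by simpa [hf] using hz)
  have hm0 : 0 < m := by
    refine lt_of_le_of_ne hm.1.1 ?_
    rintro rfl
    apply hmΩ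
    have : f 0 = b := by simp [hf]
    rw [this]
    exact ball_subset_of_star hc h0 hγ hn hstar (by simpa using hb)
  have hin : ∀ x, m < x → x ≤ 1 → f x ∈ Ω := by
    intro x hx hx1
    by_contra h
    have : x ≤ m := hmax (show x ∈ Set.Icc (0 : ℝ) 1 ∩ f ⁻¹' Ωᶜ from ⟨⟨by linarith, hx1⟩, h⟩)
    linarith
  have hev : ∀ᶠ r : ℝ in 𝓝[>] (0 : ℝ), f m + (r : ℂ) * (f m - b) ∈ Ω := by
    have h1 : ∀ᶠ r : ℝ in 𝓝[>] (0 : ℝ), r < (1 - m) / m :=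
      eventually_nhdsWithin_of_eventually_nhds
        (gt_mem_nhds (div_pos (by linarith) hm0))
    filter_upwards [h1, self_mem_nhdsWithin] with r hr hr0
    have hr0 : 0 < r := hr0
    rw [lt_div_iff₀ hm0] at hr
    have := hin (m * (1 + r)) (by nlinarith) (by nlinarith)
    convert this using 1
    simp only [hf]
    push_cast
    ring
  have hcl : f m ∈ closure Ω := by
    have ht : Tendsto (fun r : ℝ => f m + (r : ℂ) * (f m - b)) (𝓝[>] (0 : ℝ)) (𝓝 (f m)) := by
      have : Continuous fun r : ℝ => f m + (r : ℂ) * (f m - b) := by fun_prop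
      have h := (this.tendsto 0).mono_left (nhdsWithin_le_nhds (s := Set.Ioi 0))
      simpa using h
    exact mem_closure_of_tendsto ht hev
  have hfr : f m ∈ frontier Ω := by
    rw [hΩo.frontier_eq]
    exact ⟨hcl, hmΩ⟩
  rw [← hγ.srange] at hfr
  obtain ⟨s, hs⟩ := hfr
  rw [← hs] at hev
  refine outward_transversal hγ hn s _ ?_ hev
  rw [dot_sub_left]
  have := dot_le b (nv s)
  rw [hn.unit s] at this
  linarith [hstar s]

theorem smul_mem_of_star (hΩo : IsOpen Ω) (hc : 0 < c) (h0 : (0 : ℂ) ∈ Ω)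
    (hγ : BoundaryParam Ω γ L) (hn : OutwardNormal Ω γ nv)
    (hstar : ∀ s, c ≤ dot (γ s) (nv s)) {p : ℂ} (hp : p ∈ closure Ω) {r : ℝ}
    (hr0 : 0 ≤ r) (hr1 : r < 1) : (r : ℂ) * p ∈ Ω := by
  have h1r : 0 < 1 - r := by linarith
  obtain ⟨z, hz, hpz⟩ := Metric.mem_closure_iff.1 hp (c * (1 - r)) (by positivity)
  set b : ℂ := ((r / (1 - r) : ℝ) : ℂ) * (p - z) with hb
  have hbn : ‖b‖ < c := by
    rw [hb, norm_mul, Complex.norm_real, Real.norm_of_nonneg (by positivity), ← dist_eq_norm,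
      div_mul_eq_mul_div, div_lt_iff₀ h1r]
    nlinarith [dist_nonneg (x := p) (y := z)]
  convert segment_mem_of_star hΩo hc h0 hγ hn hstar hbn hz hr0 hr1.le using 1
  have : (1 - (r : ℂ)) ≠ 0 := by exact_mod_cast h1r.ne'
  rw [hb]
  push_cast
  field_simp
  ring

theorem exterior_dist_of_star (hΩo : IsOpen Ω) (hc : 0 < c) (h0 : (0 : ℂ) ∈ Ω)
    (hγ : BoundaryParam Ω γ L) (hn : OutwardNormal Ω γ nv)
    (hstar : ∀ s, c ≤ dot (γ s) (nv s)) {p : ℂ} (hp : p ∈ frontier Ω) {t : ℝ} (ht : 0 < t)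
    {z : ℂ} (hz : z ∈ closure Ω) : c * t ≤ ‖z - (1 + (t : ℂ)) * p‖ := by
  have hcl : IsClosed {z : ℂ | c * t ≤ ‖z - (1 + (t : ℂ)) * p‖} :=
    isClosed_le continuous_const (by fun_prop)
  refine closure_minimal (fun z hz => ?_) hcl hz
  by_contra h
  simp only [Set.mem_ofPred_eq, not_le] at h
  set b : ℂ := ((t⁻¹ : ℝ) : ℂ) * ((1 + (t : ℂ)) * p - z) with hb
  have hbn : ‖b‖ < c := by
    rw [hb, norm_mul, Complex.norm_real, Real.norm_of_nonneg (by positivity), norm_sub_rev,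
      inv_mul_lt_iff₀ ht]
    linarith
  have := segment_mem_of_star hΩo hc h0 hγ hn hstar hbn hz (l := (1 + t)⁻¹) (by positivity)
    (inv_le_one_of_one_le₀ (by linarith))
  rw [hΩo.frontier_eq] at hp
  apply hp.2
  convert this using 1
  have h1 : (t : ℂ) ≠ 0 := by exact_mod_cast ht.ne'
  have h2 : (1 + (t : ℂ)) ≠ 0 := by
    have : (1 + t) ≠ 0 := by positivity
    exact_mod_cast this
  rw [hb]
  push_cast
  field_simp
  ring

end StarShaped

/-- The planar cross product. -/
def cross (a b : ℂ) : ℝ := a.re * b.im - a.im * b.re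

/-- A bounded planar domain, strictly star-shaped about the origin, whose boundary is parametrized
by arclength, positively (`σ = 1`) or negatively (`σ = -1`) oriented. -/
structure StarDomain (Ω : Set ℂ) (γ : ℝ → ℂ) (L c σ : ℝ) : Prop where
  isOpen : IsOpen Ω
  bounded : IsBounded Ω
  cpos : 0 < c
  zero_mem : (0 : ℂ) ∈ Ω
  param : BoundaryParam Ω γ L
  sq : σ ^ 2 = 1
  cross_ge : ∀ s, c ≤ σ * cross (γ s) (deriv γ s)
  smul_mem : ∀ {p : ℂ}, p ∈ closure Ω → ∀ {r : ℝ}, 0 ≤ r → r < 1 → (r : ℂ) * p ∈ Ω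
  exterior_dist : ∀ {p : ℂ}, p ∈ frontier Ω → ∀ {t : ℝ}, 0 < t → ∀ {z : ℂ}, z ∈ closure Ω →
    c * t ≤ ‖z - (1 + (t : ℂ)) * p‖

theorem normSq_of_norm_eq_one {z : ℂ} (h : ‖z‖ = 1) : z.re ^ 2 + z.im ^ 2 = 1 := by
  have := dot_self z
  rw [h, dot] at this
  linarith

theorem exists_starDomain {Ω : Set ℂ} {γ nv : ℝ → ℂ} {L c : ℝ} (hΩo : IsOpen Ω)
    (hΩb : IsBounded Ω) (hc : 0 < c) (h0 : (0 : ℂ) ∈ Ω)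
    (hγ : BoundaryParam Ω γ L) (hn : OutwardNormal Ω γ nv)
    (hstar : ∀ s, c ≤ dot (γ s) (nv s)) : ∃ σ, StarDomain Ω γ L c σ := by
  have habs : ∀ s, c ≤ |cross (γ s) (deriv γ s)| := by
    intro s
    have h1 := normSq_of_norm_eq_one (hn.unit s)
    have h2 := normSq_of_norm_eq_one (hγ.arclength s)
    have h3 := hn.orth s
    have h4 := hstar s
    rw [dot] at h4
    set a := (nv s).re
    set b := (nv s).im
    set p := (deriv γ s).re
    set q := (deriv γ s).im
    set k := a * q - b * p with hk
    have ha : a = k * q := by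
      have : a * p * p = - b * q * p := by linear_combination p * h3
      calc a = a * (p ^ 2 + q ^ 2) := by rw [h2, mul_one]
        _ = k * q := by rw [hk]; linear_combination this
    have hb : b = -k * p := by
      calc b = b * (p ^ 2 + q ^ 2) := by rw [h2, mul_one]
        _ = -k * p := by rw [hk]; linear_combination q * h3
    have hk1 : k ^ 2 = 1 := by
      rw [← h1, ha, hb]; linear_combination (-k ^ 2) * h2
    have hkk : |k| = 1 := by
      rw [← sq_abs] at hk1
      nlinarith [abs_nonneg k]
    have : (γ s).re * a + (γ s).im * b = k * cross (γ s) (deriv γ s) := by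
      rw [cross, ha, hb]; ring
    rw [this] at h4
    calc c ≤ _ := h4
      _ ≤ |k * cross (γ s) (deriv γ s)| := le_abs_self _
      _ = _ := by rw [abs_mul, hkk, one_mul]
  have hcont : Continuous fun s => cross (γ s) (deriv γ s) := by
    have h1 : Continuous γ := hγ.smooth.continuous
    have h2 : Continuous (deriv γ) := hγ.smooth.continuous_deriv (by simp)
    unfold cross
    fun_prop
  have hsign : (∀ s, c ≤ cross (γ s) (deriv γ s)) ∨ (∀ s, c ≤ -cross (γ s) (deriv γ s)) := by
    by_contra h
    push Not at h
    obtain ⟨⟨s, hs⟩, ⟨t, ht⟩⟩ := h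
    have hs' : cross (γ s) (deriv γ s) ≤ 0 := by
      rcases le_abs.1 (habs s) with h | h <;> linarith
    have ht' : 0 ≤ cross (γ t) (deriv γ t) := by
      rcases le_abs.1 (habs t) with h | h <;> linarith
    obtain ⟨r, hr⟩ := mem_range_of_exists_le_of_exists_ge hcont ⟨s, hs'⟩ ⟨t, ht'⟩
    have := habs r
    simp only at hr
    rw [hr] at this
    simp at this
    linarith
  have main : ∀ σ : ℝ, σ ^ 2 = 1 → (∀ s, c ≤ σ * cross (γ s) (deriv γ s)) →
      StarDomain Ω γ L c σ := fun σ h1 h2 =>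
    { isOpen := hΩo
      bounded := hΩb
      cpos := hc
      zero_mem := h0
      param := hγ
      sq := h1
      cross_ge := h2
      smul_mem := fun hp _ h0r hr1 => smul_mem_of_star hΩo hc h0 hγ hn hstar hp h0r hr1
      exterior_dist := fun hp _ ht _ hz => exterior_dist_of_star hΩo hc h0 hγ hn hstar hp ht hz }
  rcases hsign with h | h
  · exact ⟨1, main 1 (by norm_num) (by simpa using h)⟩
  · exact ⟨-1, main (-1) (by norm_num) (by simpa using h)⟩

namespace StarDomain

variable {Ω : Set ℂ} {γ : ℝ → ℂ} {L c σ : ℝ}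

theorem abs_cross (S : StarDomain Ω γ L c σ) (s : ℝ) :
    |cross (γ s) (deriv γ s)| = σ * cross (γ s) (deriv γ s) := by
  have h := S.cross_ge s
  have hc := S.cpos
  rcases (sq_eq_sq_iff_eq_or_eq_neg.1 (S.sq.trans (one_pow 2).symm)) with h1 | h1 <;> rw [h1] at h ⊢
  · rw [abs_of_nonneg] <;> linarith
  · rw [abs_of_nonpos] <;> linarith

theorem mem_closure (S : StarDomain Ω γ L c σ) (s : ℝ) : γ s ∈ closure Ω :=
  frontier_subset_closure (S.param.srange ▸ mem_range_self s)

theorem notMem (S : StarDomain Ω γ L c σ) (s : ℝ) : γ s ∉ Ω := by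
  have h : γ s ∈ frontier Ω := S.param.srange ▸ mem_range_self s
  rw [S.isOpen.frontier_eq] at h
  exact h.2

/-- Polar coordinates adapted to the boundary of a star-shaped domain. -/
def polar (γ : ℝ → ℂ) (x : ℝ × ℝ) : ℝ × ℝ := (x.1 * (γ x.2).re, x.1 * (γ x.2).im)

theorem hasFDerivAt_polar (S : StarDomain Ω γ L c σ) (x : ℝ × ℝ) :
    HasFDerivAt (polar γ)
      (LinearMap.toContinuousLinearMap (Matrix.toLin (.finTwoProd ℝ) (.finTwoProd ℝ)
        !![(γ x.2).re, x.1 * (deriv γ x.2).re; (γ x.2).im, x.1 * (deriv γ x.2).im])) x := by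
  rw [Matrix.toLin_finTwoProd_toContinuousLinearMap]
  have hd : HasDerivAt γ (deriv γ x.2) x.2 :=
    (S.param.smooth.differentiable (by simp) x.2).hasDerivAt
  have hre : HasDerivAt (fun s => (γ s).re) (deriv γ x.2).re x.2 :=
    (Complex.reCLM.hasFDerivAt (x := γ x.2)).comp_hasDerivAt x.2 hd
  have him : HasDerivAt (fun s => (γ s).im) (deriv γ x.2).im x.2 :=
    (Complex.imCLM.hasFDerivAt (x := γ x.2)).comp_hasDerivAt x.2 hd
  have hsnd : HasFDerivAt (Prod.snd : ℝ × ℝ → ℝ) (ContinuousLinearMap.snd ℝ ℝ ℝ) x := hasFDerivAt_snd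
  have h1 := hasFDerivAt_fst.mul (hre.comp_hasFDerivAt x hsnd)
  have h2 := hasFDerivAt_fst.mul (him.comp_hasFDerivAt x hsnd)
  convert h1.prodMk h2 using 2 <;>
  · ext <;> simp [polar, smul_smul, add_comm]

theorem det_polar (x : ℝ × ℝ) :
    (LinearMap.toContinuousLinearMap (Matrix.toLin (.finTwoProd ℝ) (.finTwoProd ℝ)
        !![(γ x.2).re, x.1 * (deriv γ x.2).re; (γ x.2).im, x.1 * (deriv γ x.2).im])).det
      = x.1 * cross (γ x.2) (deriv γ x.2) := by
  conv_lhs =>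
    rw [LinearMap.det_toContinuousLinearMap, LinearMap.det_toLin, Matrix.det_fin_two_of]
  rw [cross]; ring

theorem injOn_polar (S : StarDomain Ω γ L c σ) :
    InjOn (polar γ) (Ioo (0 : ℝ) 1 ×ˢ Ioo (0 : ℝ) L) := by
  have key : ∀ r s r' s' : ℝ, 0 < r → 0 < r' → (r : ℂ) * γ s = r' * γ s' → ¬ r < r' := by
    intro r s r' s' hr hr' h hlt
    apply S.notMem s'
    have : γ s' = ((r / r' : ℝ) : ℂ) * γ s := by
      have hne : (r' : ℂ) ≠ 0 := by exact_mod_cast hr'.ne'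
      push_cast
      field_simp
      linear_combination -h
    rw [this]
    exact S.smul_mem (S.mem_closure s) (by positivity) (by rwa [div_lt_one hr'])
  rintro ⟨r, s⟩ ⟨⟨hr0, hr1⟩, hs0, hs1⟩ ⟨r', s'⟩ ⟨⟨hr0', hr1'⟩, hs0', hs1'⟩ h
  simp only [polar, Prod.mk.injEq] at h hr0 hr1 hs0 hs1 hr0' hr1' hs0' hs1'
  have heq : (r : ℂ) * γ s = r' * γ s' := by
    apply Complex.ext <;> simp [h.1, h.2]
  have hrr : r = r' := le_antisymm (not_lt.1 (key _ _ _ _ hr0' hr0 heq.symm))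
    (not_lt.1 (key _ _ _ _ hr0 hr0' heq))
  subst hrr
  have hne : (r : ℂ) ≠ 0 := by exact_mod_cast hr0.ne'
  obtain ⟨k, hk⟩ := S.param.inj s s' (mul_left_cancel₀ hne heq)
  have hL := S.param.Lpos
  have hk1 : (k : ℝ) < 1 := by
    by_contra hcon
    push Not at hcon
    nlinarith
  have hk2 : (-1 : ℝ) < k := by
    by_contra hcon
    push Not at hcon
    nlinarith
  have hk0 : k = 0 := by
    have : k < 1 := by exact_mod_cast hk1
    have : -1 < k := by exact_mod_cast hk2
    omega
  subst hk0
  simp at hk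
  rw [Prod.mk.injEq]
  exact ⟨rfl, by linarith⟩

theorem exists_ray (S : StarDomain Ω γ L c σ) {z : ℂ} (hz : z ∈ Ω) (hz0 : z ≠ 0) :
    ∃ r ∈ Ioo (0 : ℝ) 1, ∃ s ∈ Ico (0 : ℝ) L, z = r * γ s := by
  obtain ⟨M, hM⟩ := S.bounded.exists_norm_le
  have hzn : 0 < ‖z‖ := norm_pos_iff.2 hz0
  set R : ℝ := (|M| + 1) / ‖z‖ + 1 with hR
  have hRz : ((R : ℝ) : ℂ) * z ∉ Ω := by
    intro h
    have h1 := hM _ h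
    have : R * ‖z‖ = |M| + 1 + ‖z‖ := by rw [hR]; field_simp
    rw [norm_mul, Complex.norm_real, Real.norm_of_nonneg (by positivity), this] at h1
    linarith [le_abs_self M]
  have hpre : IsPreconnected ((fun r : ℝ => (r : ℂ) * z) '' Icc 1 R) :=
    isPreconnected_Icc.image _ (by fun_prop)
  have h1R : 1 ≤ R := by rw [hR]; linarith [show 0 ≤ (|M| + 1) / ‖z‖ by positivity]
  obtain ⟨_, ⟨r, hr, rfl⟩, hrf⟩ := inter_frontier_nonempty_of_isPreconnected (Ω := Ω) hpre
    ⟨z, ⟨1, ⟨le_rfl, h1R⟩, by simp⟩, hz⟩ ⟨_, ⟨R, ⟨h1R, le_rfl⟩, rfl⟩, hRz⟩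
  have hr1 : 1 < r := by
    refine lt_of_le_of_ne hr.1 ?_
    rintro rfl
    rw [S.isOpen.frontier_eq] at hrf
    apply hrf.2
    simpa using hz
  simp only at hrf
  rw [← S.param.srange] at hrf
  obtain ⟨t, ht⟩ := hrf
  have ht' : γ (toIcoMod S.param.Lpos 0 t) = γ t := by
    rw [← self_sub_toIcoDiv_zsmul S.param.Lpos]
    exact S.param.periodic.sub_zsmul_eq _
  refine ⟨r⁻¹, ⟨by positivity, inv_lt_one_of_one_lt₀ hr1⟩, toIcoMod S.param.Lpos 0 t, ?_, ?_⟩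
  · simpa using toIcoMod_mem_Ico S.param.Lpos 0 t
  · rw [ht', ht]
    have : (r : ℂ) ≠ 0 := by exact_mod_cast (by linarith : r ≠ 0)
    push_cast
    field_simp

theorem integral_eq (S : StarDomain Ω γ L c σ) (h : ℂ → ℝ) :
    ∫ z in Ω, h z = ∫ x in Icc ((0 : ℝ), (0 : ℝ)) (1, L),
      x.1 * (σ * cross (γ x.2) (deriv γ x.2)) * h (x.1 * γ x.2) := by
  set e := Complex.measurableEquivRealProd with he
  have hes : ∀ y : ℝ × ℝ, e.symm y = ⟨y.1, y.2⟩ := fun y => rfl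
  have h1 : ∫ z in Ω, h z = ∫ y in e.symm ⁻¹' Ω, h (e.symm y) :=
    (Complex.volume_preserving_equiv_real_prod.symm.setIntegral_preimage_emb
      e.symm.measurableEmbedding h Ω).symm
  have hpol : ∀ x : ℝ × ℝ, e.symm (polar γ x) = x.1 * γ x.2 := by
    intro x
    rw [hes]
    apply Complex.ext <;> simp [polar]
  set V : Submodule ℝ (ℝ × ℝ) := Submodule.span ℝ {e (γ 0)} with hV
  have hVnull : volume (V : Set (ℝ × ℝ)) = 0 := by
    apply Measure.addHaar_submodule
    intro htop
    have hd : Module.finrank ℝ V ≤ 1 := (finrank_span_le_card _).trans (by simp)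
    rw [htop, finrank_top] at hd
    simp at hd
  have h2 : (e.symm ⁻¹' Ω : Set (ℝ × ℝ)) =ᵐ[volume] polar γ '' (Ioo (0 : ℝ) 1 ×ˢ Ioo (0 : ℝ) L) := by
    have hsub : polar γ '' (Ioo (0 : ℝ) 1 ×ˢ Ioo (0 : ℝ) L) ⊆ e.symm ⁻¹' Ω := by
      rintro _ ⟨x, hx, rfl⟩
      rw [mem_preimage, hpol]
      exact S.smul_mem (S.mem_closure _) hx.1.1.le hx.1.2
    refine Filter.EventuallyLE.antisymm ?_ hsub.eventuallyLE
    rw [ae_le_set]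
    refine measure_mono_null ?_ hVnull
    rintro y ⟨hy, hyn⟩
    by_contra hyV
    have hy0 : e.symm y ≠ 0 := by
      intro h0
      apply hyV
      have : y = 0 := by
        have := congrArg e h0
        rw [e.apply_symm_apply] at this
        rw [this]; rfl
      rw [this]; exact V.zero_mem
    obtain ⟨r, hr, s, hs, hrs⟩ := S.exists_ray hy hy0
    have hyp : y = polar γ (r, s) := by
      apply e.symm.injective
      rw [hpol, hrs]
    rcases hs.1.eq_or_lt with h0 | h0
    · apply hyV
      rw [hyp, ← h0]
      exact Submodule.mem_span_singleton.2 ⟨r, rfl⟩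
    · exact hyn ⟨(r, s), ⟨hr, h0, hs.2⟩, hyp.symm⟩
  have hms : MeasurableSet (Ioo (0 : ℝ) 1 ×ˢ Ioo (0 : ℝ) L) := measurableSet_Ioo.prod measurableSet_Ioo
  have h4 : (Icc ((0 : ℝ), (0 : ℝ)) (1, L) : Set (ℝ × ℝ)) =ᵐ[volume]
      (Ioo (0 : ℝ) 1 ×ˢ Ioo (0 : ℝ) L : Set (ℝ × ℝ)) := by
    rw [← Icc_prod_Icc]
    exact (Measure.set_prod_ae_eq Ioo_ae_eq_Icc Ioo_ae_eq_Icc).symm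
  rw [h1, setIntegral_congr_set h2, setIntegral_congr_set h4,
    integral_image_eq_integral_abs_det_fderiv_smul volume hms
      (fun x _ => (S.hasFDerivAt_polar x).hasFDerivWithinAt) S.injOn_polar]
  refine setIntegral_congr_fun hms fun x hx => ?_
  simp only [det_polar, hpol, smul_eq_mul]
  rw [abs_mul, S.abs_cross, abs_of_pos hx.1.1]

end StarDomain

/-- The outward unit normal of a star-shaped domain, in terms of the boundary parametrization. -/
def normalC (σ : ℝ) (γ : ℝ → ℂ) (s : ℝ) : ℂ := ⟨σ * (deriv γ s).im, -(σ * (deriv γ s).re)⟩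

theorem fderiv_apply_fst {f : ℝ × ℝ → ℝ} {x : ℝ × ℝ} (hf : DifferentiableAt ℝ f x) {d : ℝ}
    (h : HasDerivAt (fun r => f (r, x.2)) d x.1) : fderiv ℝ f x (1, 0) = d := by
  have h1 : HasDerivAt (fun r : ℝ => (r, x.2)) ((1 : ℝ), (0 : ℝ)) x.1 :=
    (hasDerivAt_id x.1).prodMk (hasDerivAt_const x.1 x.2)
  exact (hf.hasFDerivAt.comp_hasDerivAt x.1 h1).unique h

theorem fderiv_apply_snd {f : ℝ × ℝ → ℝ} {x : ℝ × ℝ} (hf : DifferentiableAt ℝ f x) {d : ℝ}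
    (h : HasDerivAt (fun s => f (x.1, s)) d x.2) : fderiv ℝ f x (0, 1) = d := by
  have h1 : HasDerivAt (fun s : ℝ => (x.1, s)) ((0 : ℝ), (1 : ℝ)) x.2 :=
    (hasDerivAt_const x.2 x.1).prodMk (hasDerivAt_id x.2)
  exact (hf.hasFDerivAt.comp_hasDerivAt x.2 h1).unique h

namespace StarDomain

variable {Ω : Set ℂ} {γ : ℝ → ℂ} {L c σ : ℝ}

theorem contDiff_deriv (S : StarDomain Ω γ L c σ) : ContDiff ℝ (⊤ : ℕ∞) (deriv γ) :=
  (contDiff_infty_iff_deriv.1 S.param.smooth).2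

theorem hasDerivAt (S : StarDomain Ω γ L c σ) (s : ℝ) : HasDerivAt γ (deriv γ s) s :=
  (S.param.smooth.differentiable (by simp) s).hasDerivAt

theorem hasDerivAt_deriv (S : StarDomain Ω γ L c σ) (s : ℝ) :
    HasDerivAt (deriv γ) (deriv (deriv γ) s) s :=
  (S.contDiff_deriv.differentiable (by simp) s).hasDerivAt

theorem periodic_deriv (S : StarDomain Ω γ L c σ) : Function.Periodic (deriv γ) L := by
  intro s
  have h : deriv (fun x => γ (x + L)) s = deriv γ (s + L) := deriv_comp_add_const ..
  rw [← h]
  congr 1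
  funext x
  exact S.param.periodic x

theorem integral_div (S : StarDomain Ω γ L c σ) {P Q : ℂ → ℝ} (hP : Smooth P) (hQ : Smooth Q) :
    ∫ z in Ω, (pd 1 P z + pd Complex.I Q z) =
      ∫ s in (0 : ℝ)..L, (P (γ s) * (normalC σ γ s).re + Q (γ s) * (normalC σ γ s).im) := by
  have hz : ContDiff ℝ (⊤ : ℕ∞) (fun x : ℝ × ℝ => (x.1 : ℂ) * γ x.2) :=
    (Complex.ofRealCLM.contDiff.comp contDiff_fst).mul (S.param.smooth.comp contDiff_snd)
  have hPz := hP.comp hz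
  have hQz := hQ.comp hz
  have hg : ContDiff ℝ (⊤ : ℕ∞) (fun x : ℝ × ℝ => γ x.2) := S.param.smooth.comp contDiff_snd
  have hd : ContDiff ℝ (⊤ : ℕ∞) (fun x : ℝ × ℝ => deriv γ x.2) :=
    S.contDiff_deriv.comp contDiff_snd
  have hg1 : ContDiff ℝ (⊤ : ℕ∞) (fun x : ℝ × ℝ => (γ x.2).re) := Complex.reCLM.contDiff.comp hg
  have hg2 : ContDiff ℝ (⊤ : ℕ∞) (fun x : ℝ × ℝ => (γ x.2).im) := Complex.imCLM.contDiff.comp hg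
  have hd1 : ContDiff ℝ (⊤ : ℕ∞) (fun x : ℝ × ℝ => (deriv γ x.2).re) :=
    Complex.reCLM.contDiff.comp hd
  have hd2 : ContDiff ℝ (⊤ : ℕ∞) (fun x : ℝ × ℝ => (deriv γ x.2).im) :=
    Complex.imCLM.contDiff.comp hd
  set f : ℝ × ℝ → ℝ := fun x => x.1 * (σ * (P ((x.1 : ℂ) * γ x.2) * (deriv γ x.2).im
    - Q ((x.1 : ℂ) * γ x.2) * (deriv γ x.2).re)) with hf
  set g : ℝ × ℝ → ℝ := fun x => σ * (Q ((x.1 : ℂ) * γ x.2) * (γ x.2).re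
    - P ((x.1 : ℂ) * γ x.2) * (γ x.2).im) with hgdef
  have hfs : ContDiff ℝ (⊤ : ℕ∞) f :=
    contDiff_fst.mul (contDiff_const.mul ((hPz.mul hd2).sub (hQz.mul hd1)))
  have hgs : ContDiff ℝ (⊤ : ℕ∞) g :=
    contDiff_const.mul ((hQz.mul hg1).sub (hPz.mul hg2))
  have hfd := hfs.differentiable (by simp)
  have hgd := hgs.differentiable (by simp)
  have hdiv : ∀ x : ℝ × ℝ, fderiv ℝ f x (1, 0) + fderiv ℝ g x (0, 1) =
      x.1 * (σ * cross (γ x.2) (deriv γ x.2)) *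
        (pd 1 P (x.1 * γ x.2) + pd Complex.I Q (x.1 * γ x.2)) := by
    rintro ⟨r, s⟩
    have hr : HasDerivAt (fun r : ℝ => (r : ℂ) * γ s) (γ s) r := by
      simpa using (Complex.ofRealCLM.hasDerivAt (x := r)).mul_const (γ s)
    have hs : HasDerivAt (fun s : ℝ => (r : ℂ) * γ s) (r * deriv γ s) s :=
      (S.hasDerivAt s).const_mul _
    have hre : HasDerivAt (fun s => (γ s).re) (deriv γ s).re s :=
      (Complex.reCLM.hasFDerivAt (x := γ s)).comp_hasDerivAt s (S.hasDerivAt s)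
    have him : HasDerivAt (fun s => (γ s).im) (deriv γ s).im s :=
      (Complex.imCLM.hasFDerivAt (x := γ s)).comp_hasDerivAt s (S.hasDerivAt s)
    have e1 := fderiv_apply_fst (x := (r, s)) (hfd (r, s)) ((hasDerivAt_id r).mul
      ((((hasDerivAt_comp_curve hP hr).mul_const (deriv γ s).im).sub
        ((hasDerivAt_comp_curve hQ hr).mul_const (deriv γ s).re)).const_mul σ))
    have e2 := fderiv_apply_snd (x := (r, s)) (hgd (r, s))
      ((((hasDerivAt_comp_curve hQ hs).mul hre).sub
        ((hasDerivAt_comp_curve hP hs).mul him)).const_mul σ)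
    rw [e1, e2, cross]
    simp
    ring
  rw [S.integral_eq]
  simp_rw [← hdiv]
  have hcd : Continuous fun x : ℝ × ℝ => fderiv ℝ f x (1, 0) + fderiv ℝ g x (0, 1) :=
    ((hfs.continuous_fderiv (by simp)).clm_apply continuous_const).add
      ((hgs.continuous_fderiv (by simp)).clm_apply continuous_const)
  rw [integral_divergence_prod_Icc_of_hasFDerivAt_of_le f g (fderiv ℝ f) (fderiv ℝ g) (0, 0) (1, L)
    ⟨zero_le_one, S.param.Lpos.le⟩ hfs.continuous.continuousOn hgs.continuous.continuousOn
    (fun x _ => (hfd x).hasFDerivAt) (fun x _ => (hgd x).hasFDerivAt)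
    (hcd.continuousOn.integrableOn_compact isCompact_Icc)]
  have hγL : γ L = γ 0 := by simpa using S.param.periodic 0
  simp only [hgdef, hf, hγL, sub_self, zero_mul, intervalIntegral.integral_zero, sub_zero, zero_add]
  refine intervalIntegral.integral_congr fun s _ => ?_
  simp [normalC]
  ring

theorem dot_normalC (S : StarDomain Ω γ L c σ) (s : ℝ) : c ≤ dot (γ s) (normalC σ γ s) := by
  refine (S.cross_ge s).trans (le_of_eq ?_)
  simp [dot, cross, normalC]
  ring

theorem deriv_sq (S : StarDomain Ω γ L c σ) (s : ℝ) :
    (deriv γ s).re ^ 2 + (deriv γ s).im ^ 2 = 1 := normSq_of_norm_eq_one (S.param.arclength s)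

theorem normalC_sq (S : StarDomain Ω γ L c σ) (s : ℝ) :
    (normalC σ γ s).re ^ 2 + (normalC σ γ s).im ^ 2 = 1 := by
  have h := S.sq
  have h2 := S.deriv_sq s
  simp only [normalC]
  linear_combination h + σ ^ 2 * h2

theorem continuous_normalC (S : StarDomain Ω γ L c σ) : Continuous (normalC σ γ) := by
  have h := S.contDiff_deriv.continuous
  have : normalC σ γ = fun s => ((σ * (deriv γ s).im : ℝ) : ℂ) + ((-(σ * (deriv γ s).re) : ℝ) : ℂ) * Complex.I := by
    funext s
    apply Complex.ext <;> simp [normalC]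
  rw [this]
  fun_prop

theorem isCompact_closure (S : StarDomain Ω γ L c σ) : IsCompact (closure Ω) :=
  S.bounded.isCompact_closure

theorem integrableOn (S : StarDomain Ω γ L c σ) {f : ℂ → ℝ} (hf : Continuous f) :
    IntegrableOn f Ω :=
  (hf.continuousOn.integrableOn_compact S.isCompact_closure).mono_set subset_closure

end StarDomain

theorem pd_pd_nonpos_of_isLocalMax {h : ℂ → ℝ} (hh : Smooth h) {z : ℂ} (hz : IsLocalMax h z)
    (e : ℂ) : pd e (pd e h) z ≤ 0 := by
  set ℓ : ℝ → ℂ := fun t => z + (t : ℂ) * e with hℓ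
  have hℓd : ∀ t, HasDerivAt ℓ e t := by
    intro t
    have h1 : HasDerivAt (fun t : ℝ => (t : ℂ) * e) e t := by
      simpa using (Complex.ofRealCLM.hasDerivAt (x := t)).mul_const e
    exact h1.const_add z
  have hℓ0 : ℓ 0 = z := by simp [hℓ]
  have hline : ∀ k : ℂ → ℝ, Smooth k → ∀ t, HasDerivAt (fun t => k (ℓ t)) (pd e k (ℓ t)) t := by
    intro k hk t
    rw [pd_decomp]
    exact hasDerivAt_comp_curve hk (hℓd t)
  have hd1 : deriv (fun t => h (ℓ t)) = fun t => pd e h (ℓ t) := funext fun t => (hline h hh t).deriv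
  have hd2 : deriv (deriv (fun t => h (ℓ t))) 0 = pd e (pd e h) z := by
    rw [hd1, (hline _ (hh.pd e) 0).deriv, hℓ0]
  by_contra hcon
  push Not at hcon
  have hmax : IsLocalMax (fun t => h (ℓ t)) 0 :=
    IsLocalMax.comp_continuous (g := ℓ) (b := 0) (f := h) (by rwa [hℓ0]) (hℓd 0).continuousAt
  have hmin : IsLocalMin (fun t => h (ℓ t)) 0 :=
    isLocalMin_of_deriv_deriv_pos (by rwa [hd2]) hmax.deriv_eq_zero
      (hline h hh 0).continuousAt
  have hev : (fun t => h (ℓ t)) =ᶠ[𝓝 0] fun _ => h (ℓ 0) := by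
    filter_upwards [hmax, hmin] with t h1 h2 using le_antisymm h1 h2
  have : deriv (deriv (fun t => h (ℓ t))) 0 = 0 := by
    rw [hev.deriv.deriv_eq]
    simp
  rw [hd2] at this
  linarith

theorem lapR_nonpos_of_isLocalMax {h : ℂ → ℝ} (hh : Smooth h) {z : ℂ} (hz : IsLocalMax h z) :
    lapR h z ≤ 0 := by
  rw [lapR_eq_pd]
  linarith [pd_pd_nonpos_of_isLocalMax hh hz 1, pd_pd_nonpos_of_isLocalMax hh hz Complex.I]

theorem lapR_add {a b : ℂ → ℝ} (ha : Smooth a) (hb : Smooth b) (z : ℂ) :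
    lapR (fun z => a z + b z) z = lapR a z + lapR b z := by
  simp only [lapR_eq_pd]
  rw [pd_add ha hb, pd_add ha hb, pd_add (ha.pd _) (hb.pd _), pd_add (ha.pd _) (hb.pd _)]
  ring

theorem lapR_sub {a b : ℂ → ℝ} (ha : Smooth a) (hb : Smooth b) (z : ℂ) :
    lapR (fun z => a z - b z) z = lapR a z - lapR b z := by
  simp only [lapR_eq_pd]
  rw [pd_sub ha hb, pd_sub ha hb, pd_sub (ha.pd _) (hb.pd _), pd_sub (ha.pd _) (hb.pd _)]
  ring

theorem lapR_const_mul {a : ℂ → ℝ} (ha : Smooth a) (k : ℝ) (z : ℂ) :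
    lapR (fun z => k * a z) z = k * lapR a z := by
  simp only [lapR_eq_pd]
  rw [pd_const_mul ha, pd_const_mul ha, pd_const_mul (ha.pd _), pd_const_mul (ha.pd _)]
  ring

theorem lapR_mul {a b : ℂ → ℝ} (ha : Smooth a) (hb : Smooth b) (z : ℂ) :
    lapR (fun z => a z * b z) z = lapR a z * b z + a z * lapR b z +
      2 * (pd 1 a z * pd 1 b z + pd Complex.I a z * pd Complex.I b z) := by
  have key : ∀ e, pd e (pd e fun z => a z * b z) z =
      pd e (pd e a) z * b z + 2 * (pd e a z * pd e b z) + a z * pd e (pd e b) z := by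
    intro e
    rw [pd_mul ha hb, pd_add ((ha.pd e).mul hb) (ha.mul (hb.pd e)), pd_mul (ha.pd e) hb,
      pd_mul ha (hb.pd e)]
    ring
  simp only [lapR_eq_pd, key]
  ring

theorem smooth_lapR {a : ℂ → ℝ} (ha : Smooth a) : Smooth (lapR a) :=
  ((ha.pd 1).pd 1).add ((ha.pd Complex.I).pd Complex.I)

/-- The squared distance to a point of the plane. -/
def sqDist (q : ℂ) (z : ℂ) : ℝ := (z.re - q.re) * (z.re - q.re) + (z.im - q.im) * (z.im - q.im)

theorem smooth_sqDist (q : ℂ) : Smooth (sqDist q) :=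
  ((smooth_re.sub contDiff_const).mul (smooth_re.sub contDiff_const)).add
    ((smooth_im.sub contDiff_const).mul (smooth_im.sub contDiff_const))

theorem sqDist_eq (q z : ℂ) : sqDist q z = ‖z - q‖ ^ 2 := by
  rw [← dot_self]; simp [sqDist, dot]

theorem pd_sqDist (q e : ℂ) :
    pd e (sqDist q) = fun z => 2 * ((z.re - q.re) * e.re + (z.im - q.im) * e.im) := by
  have h1 : Smooth fun z : ℂ => z.re - q.re := smooth_re.sub contDiff_const
  have h2 : Smooth fun z : ℂ => z.im - q.im := smooth_im.sub contDiff_const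
  have d1 : pd e (fun z : ℂ => z.re - q.re) = fun _ => e.re := by
    rw [pd_sub smooth_re contDiff_const, pd_re, pd_const]; simp
  have d2 : pd e (fun z : ℂ => z.im - q.im) = fun _ => e.im := by
    rw [pd_sub smooth_im contDiff_const, pd_im, pd_const]; simp
  unfold sqDist
  rw [pd_add (h1.mul h1) (h2.mul h2), pd_mul h1 h1, pd_mul h2 h2, d1, d2]
  funext z
  ring

theorem lapR_sqDist (q z : ℂ) : lapR (sqDist q) z = 4 := by
  have h1 : Smooth fun z : ℂ => z.re - q.re := smooth_re.sub contDiff_const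
  have h2 : Smooth fun z : ℂ => z.im - q.im := smooth_im.sub contDiff_const
  have d1 : pd 1 (sqDist q) = fun z => 2 * (z.re - q.re) := by rw [pd_sqDist]; simp
  have d2 : pd Complex.I (sqDist q) = fun z => 2 * (z.im - q.im) := by rw [pd_sqDist]; simp
  rw [lapR_eq_pd, d1, d2, pd_const_mul h1, pd_const_mul h2, pd_sub smooth_re contDiff_const,
    pd_sub smooth_im contDiff_const, pd_re, pd_im, pd_const, pd_const]
  norm_num

theorem SolvesGL.lapR_re {W : ℂ → ℝ} {Ω : Set ℂ} {ε : ℝ} {u : ℂ → ℂ} (h : SolvesGL W Ω ε u)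
    {z : ℂ} (hz : z ∈ Ω) : lapR (fun z => (u z).re) z = (ε ^ 2)⁻¹ * pd 1 W (u z) := by
  rw [← lapC_re h.1, h.2 z hz, Complex.smul_re, smul_eq_mul]
  simp [gradW, pd]

theorem SolvesGL.lapR_im {W : ℂ → ℝ} {Ω : Set ℂ} {ε : ℝ} {u : ℂ → ℂ} (h : SolvesGL W Ω ε u)
    {z : ℂ} (hz : z ∈ Ω) : lapR (fun z => (u z).im) z = (ε ^ 2)⁻¹ * pd Complex.I W (u z) := by
  rw [← lapC_im h.1, h.2 z hz, Complex.smul_im, smul_eq_mul]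
  simp [gradW, pd]

theorem norm_le_of_solvesGL {Γ Ω : Set ℂ} {W : ℂ → ℝ} {R₀ ε : ℝ} {u : ℂ → ℂ}
    (hW : PotentialHyp Γ W R₀) (hR : 0 ≤ R₀) (hΩo : IsOpen Ω) (hΩb : IsBounded Ω)
    (hu : SolvesGL W Ω ε u) (hb : ∀ z ∈ frontier Ω, u z ∈ Γ) {z : ℂ} (hz : z ∈ closure Ω) :
    ‖u z‖ ≤ R₀ := by
  have ha := smooth_re_comp hu.1
  have hb' := smooth_im_comp hu.1
  set h : ℂ → ℝ := fun z => (u z).re * (u z).re + (u z).im * (u z).im with hh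
  have hs : Smooth h := (ha.mul ha).add (hb'.mul hb')
  have hn : ∀ z, h z = ‖u z‖ ^ 2 := fun z => by rw [← dot_self]; rfl
  have hlap : ∀ z ∈ Ω, R₀ < ‖u z‖ → 0 ≤ lapR h z := by
    intro z hz hlt
    have hc := hW.coercive _ hlt
    have e1 : (gradW W (u z)).re = pd 1 W (u z) := by simp [gradW, pd]
    have e2 : (gradW W (u z)).im = pd Complex.I W (u z) := by simp [gradW, pd]
    rw [e1, e2] at hc
    rw [hh, lapR_add (ha.mul ha) (hb'.mul hb'), lapR_mul ha ha, lapR_mul hb' hb', hu.lapR_re hz,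
      hu.lapR_im hz]
    have : 0 ≤ (ε ^ 2)⁻¹ * (pd 1 W (u z) * (u z).re + pd Complex.I W (u z) * (u z).im) :=
      mul_nonneg (by positivity) hc
    nlinarith [sq_nonneg (pd 1 (fun z => (u z).re) z), sq_nonneg (pd Complex.I (fun z => (u z).re) z),
      sq_nonneg (pd 1 (fun z => (u z).im) z), sq_nonneg (pd Complex.I (fun z => (u z).im) z)]
  obtain ⟨M, hM⟩ := hΩb.closure.exists_norm_le
  have key : ∀ η > 0, h z ≤ R₀ ^ 2 + η * M ^ 2 := by
    intro η hη
    have hks : Smooth fun z => h z + η * sqDist 0 z :=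
      hs.add (contDiff_const.mul (smooth_sqDist 0))
    obtain ⟨y, hy, hmax⟩ := hΩb.isCompact_closure.exists_isMaxOn ⟨z, hz⟩
      hks.continuous.continuousOn
    have h1 : h z + η * sqDist 0 z ≤ h y + η * sqDist 0 y := hmax hz
    have h2 : 0 ≤ η * sqDist 0 z := mul_nonneg hη.le (by rw [sqDist_eq]; positivity)
    have h3 : η * sqDist 0 y ≤ η * M ^ 2 := by
      apply mul_le_mul_of_nonneg_left _ hη.le
      rw [sqDist_eq, sub_zero]
      exact pow_le_pow_left₀ (norm_nonneg _) (hM y hy) 2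
    have h4 : ‖u y‖ ≤ R₀ := by
      by_cases hyΩ : y ∈ Ω
      · by_contra hlt
        push Not at hlt
        have hloc : IsLocalMax (fun z => h z + η * sqDist 0 z) y :=
          hmax.isLocalMax (Filter.mem_of_superset (hΩo.mem_nhds hyΩ) subset_closure)
        have h5 := lapR_nonpos_of_isLocalMax hks hloc
        rw [lapR_add hs (contDiff_const.mul (smooth_sqDist 0)), lapR_const_mul (smooth_sqDist 0),
          lapR_sqDist] at h5
        linarith [hlap y hyΩ hlt]
      · have : y ∈ frontier Ω := by rw [hΩo.frontier_eq]; exact ⟨hy, hyΩ⟩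
        exact (hW.R0_large _ (hb y this)).le
    have h5 : h y ≤ R₀ ^ 2 := by
      rw [hn]; exact pow_le_pow_left₀ (norm_nonneg _) h4 2
    linarith
  have h6 : h z ≤ R₀ ^ 2 := by
    have ht : Tendsto (fun η : ℝ => R₀ ^ 2 + η * M ^ 2) (𝓝[>] 0) (𝓝 (R₀ ^ 2)) := by
      have : Continuous fun η : ℝ => R₀ ^ 2 + η * M ^ 2 := by fun_prop
      have h := this.tendsto 0
      simp only [zero_mul, add_zero] at h
      exact h.mono_left nhdsWithin_le_nhds
    exact ge_of_tendsto ht (by filter_upwards [self_mem_nhdsWithin] with η hη using key η hη)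
  rw [hn] at h6
  exact (pow_le_pow_iff_left₀ (norm_nonneg _) hR two_ne_zero).1 h6

/-- The squared length of the gradient of a real-valued function. -/
def gsq (a : ℂ → ℝ) (z : ℂ) : ℝ := pd 1 a z * pd 1 a z + pd Complex.I a z * pd Complex.I a z

theorem Smooth.gsq {a : ℂ → ℝ} (ha : Smooth a) : Smooth (gsq a) :=
  ((ha.pd 1).mul (ha.pd 1)).add ((ha.pd Complex.I).mul (ha.pd Complex.I))

theorem pd_gsq {a : ℂ → ℝ} (ha : Smooth a) (e z : ℂ) :
    pd e (gsq a) z = 2 * (pd 1 a z * pd e (pd 1 a) z + pd Complex.I a z * pd e (pd Complex.I a) z) := by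
  unfold gsq
  rw [pd_add ((ha.pd 1).mul (ha.pd 1)) ((ha.pd Complex.I).mul (ha.pd Complex.I)),
    pd_mul (ha.pd 1) (ha.pd 1), pd_mul (ha.pd Complex.I) (ha.pd Complex.I)]
  ring

theorem gsq_nonneg (a : ℂ → ℝ) (z : ℂ) : 0 ≤ gsq a z :=
  add_nonneg (mul_self_nonneg _) (mul_self_nonneg _)

/-- The radial derivative `x · ∇a`. -/
def radial (a : ℂ → ℝ) (z : ℂ) : ℝ := z.re * pd 1 a z + z.im * pd Complex.I a z

theorem Smooth.radial {a : ℂ → ℝ} (ha : Smooth a) : Smooth (radial a) :=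
  (smooth_re.mul (ha.pd 1)).add (smooth_im.mul (ha.pd Complex.I))

theorem pd_radial {a : ℂ → ℝ} (ha : Smooth a) (e z : ℂ) :
    pd e (radial a) z = e.re * pd 1 a z + z.re * pd e (pd 1 a) z +
      (e.im * pd Complex.I a z + z.im * pd e (pd Complex.I a) z) := by
  unfold radial
  rw [pd_add (smooth_re.mul (ha.pd 1)) (smooth_im.mul (ha.pd Complex.I)),
    pd_mul smooth_re (ha.pd 1), pd_mul smooth_im (ha.pd Complex.I), pd_re, pd_im]

theorem div_pohozaev {a : ℂ → ℝ} (ha : Smooth a) (z : ℂ) :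
    pd 1 (fun z => 2 * (radial a z * pd 1 a z) - gsq a z * z.re) z +
      pd Complex.I (fun z => 2 * (radial a z * pd Complex.I a z) - gsq a z * z.im) z =
    2 * (radial a z * lapR a z) := by
  have key : ∀ e (x : ℂ → ℝ), Smooth x → pd e (fun z => 2 * (radial a z * pd e a z) - gsq a z * x z) z
      = 2 * (pd e (radial a) z * pd e a z + radial a z * pd e (pd e a) z) -
        (pd e (gsq a) z * x z + gsq a z * pd e x z) := by
    intro e x hx
    rw [pd_sub (contDiff_const.mul (ha.radial.mul (ha.pd e))) (ha.gsq.mul hx),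
      pd_const_mul (ha.radial.mul (ha.pd e)), pd_mul ha.radial (ha.pd e), pd_mul ha.gsq hx]
  rw [key 1 _ smooth_re, key Complex.I _ smooth_im, pd_radial ha, pd_radial ha, pd_gsq ha,
    pd_gsq ha, pd_comm ha Complex.I 1, pd_re, pd_im, lapR_eq_pd, gsq]
  simp only [radial, Complex.one_re, Complex.one_im, Complex.I_re, Complex.I_im]
  ring

namespace StarDomain

variable {Ω : Set ℂ} {γ : ℝ → ℂ} {L c σ : ℝ}

theorem mem_frontier (S : StarDomain Ω γ L c σ) (s : ℝ) : γ s ∈ frontier Ω :=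
  S.param.srange ▸ mem_range_self s

theorem pohozaev_boundary (S : StarDomain Ω γ L c σ) {M : ℝ} (hM : ∀ s, ‖γ s‖ ≤ M)
    {a g : ℂ → ℝ} (ha : Smooth a) (hg : Smooth g) (hag : ∀ z ∈ frontier Ω, a z = g z) (s : ℝ) :
    c / 2 * gsq a (γ s) ≤ ((2 * (radial a (γ s) * pd 1 a (γ s)) - gsq a (γ s) * (γ s).re) *
        (normalC σ γ s).re +
      (2 * (radial a (γ s) * pd Complex.I a (γ s)) - gsq a (γ s) * (γ s).im) * (normalC σ γ s).im)
      + (M + 2 * M ^ 2 / c + c / 2) * gsq g (γ s) := by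
  have hc := S.cpos
  have htan : (deriv γ s).re * pd 1 a (γ s) + (deriv γ s).im * pd Complex.I a (γ s) =
      (deriv γ s).re * pd 1 g (γ s) + (deriv γ s).im * pd Complex.I g (γ s) := by
    refine (hasDerivAt_comp_curve ha (S.hasDerivAt s)).unique ?_
    have : (fun s => a (γ s)) = fun s => g (γ s) := funext fun s => hag _ (S.mem_frontier s)
    rw [this]
    exact hasDerivAt_comp_curve hg (S.hasDerivAt s)
  have hT := S.deriv_sq s
  have hσ := S.sq
  have hN := S.dot_normalC s
  have hMs := hM s
  have hM0 : 0 ≤ M := (norm_nonneg _).trans hMs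
  have hNM : dot (γ s) (normalC σ γ s) ≤ M := by
    refine (dot_le _ _).trans ?_
    have : ‖normalC σ γ s‖ ^ 2 = 1 := by
      rw [← dot_self, dot, ← S.normalC_sq s]; ring
    have : ‖normalC σ γ s‖ = 1 := by nlinarith [norm_nonneg (normalC σ γ s)]
    rwa [this, mul_one]
  have hTM : |dot (γ s) (deriv γ s)| ≤ M := by
    refine (abs_dot_le _ _).trans ?_
    rwa [S.param.arclength, mul_one]
  simp only [dot, normalC] at hN hNM hTM ⊢
  simp only [radial, gsq]
  set p := (deriv γ s).re
  set q := (deriv γ s).im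
  set x := (γ s).re
  set y := (γ s).im
  set ax := pd 1 a (γ s)
  set ay := pd Complex.I a (γ s)
  set gx := pd 1 g (γ s)
  set gy := pd Complex.I g (γ s)
  set aT := p * ax + q * ay with haT
  set aN := σ * (q * ax - p * ay) with haN
  set xN := x * (σ * q) + y * -(σ * p) with hxN
  set xT := x * p + y * q with hxT
  have e1 : ax * ax + ay * ay = aT ^ 2 + aN ^ 2 := by
    rw [haT, haN]
    linear_combination (-(ax * ax + ay * ay)) * hT - (q * ax - p * ay) ^ 2 * hσ
  have e2 : x * ax + y * ay = xT * aT + xN * aN := by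
    rw [haT, haN, hxN, hxT]
    linear_combination (-(x * ax + y * ay)) * hT - (x * q - y * p) * (q * ax - p * ay) * hσ
  have e3 : aT ^ 2 ≤ gx * gx + gy * gy := by
    rw [htan]
    nlinarith [sq_nonneg (p * gy - q * gx)]
  have e4 : (2 * ((x * ax + y * ay) * ax) - (ax * ax + ay * ay) * x) * (σ * q) +
      (2 * ((x * ax + y * ay) * ay) - (ax * ax + ay * ay) * y) * -(σ * p) =
      2 * (x * ax + y * ay) * aN - (ax * ax + ay * ay) * xN := by
    rw [haN, hxN]; ring
  rw [e4, e1, e2]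
  have e5 : -(2 * M * |aT| * |aN|) ≤ 2 * xT * aT * aN := by
    have : |2 * xT * aT * aN| ≤ 2 * M * |aT| * |aN| := by
      rw [abs_mul, abs_mul, abs_mul, abs_two]
      gcongr
    exact (abs_le.1 this).1
  have e6 : 2 * M * |aT| * |aN| ≤ c / 2 * aN ^ 2 + 2 * M ^ 2 / c * aT ^ 2 := by
    rw [← sq_abs aN, ← sq_abs aT]
    have : 0 ≤ (c * |aN| - 2 * M * |aT|) ^ 2 / (2 * c) := by positivity
    have h2 : (c * |aN| - 2 * M * |aT|) ^ 2 / (2 * c) =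
      c / 2 * |aN| ^ 2 + 2 * M ^ 2 / c * |aT| ^ 2 - 2 * M * |aT| * |aN| := by
      field_simp
      ring
    linarith
  have e7 : (M + 2 * M ^ 2 / c + c / 2) * aT ^ 2 ≤ (M + 2 * M ^ 2 / c + c / 2) * (gx * gx + gy * gy) :=
    mul_le_mul_of_nonneg_left e3 (by positivity)
  have e8 : c * aN ^ 2 ≤ xN * aN ^ 2 := mul_le_mul_of_nonneg_right hN (sq_nonneg _)
  have e9 : xN * aT ^ 2 ≤ M * aT ^ 2 := mul_le_mul_of_nonneg_right hNM (sq_nonneg _)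
  nlinarith

theorem curve_intervalIntegrable (S : StarDomain Ω γ L c σ) {f : ℂ → ℝ} (hf : Continuous f) :
    IntervalIntegrable (fun s => f (γ s)) volume 0 L :=
  (hf.comp S.param.smooth.continuous).intervalIntegrable _ _

theorem integral_gsq_boundary_le (S : StarDomain Ω γ L c σ) {Γ : Set ℂ} {W : ℂ → ℝ} {R₀ ε M : ℝ}
    {u g : ℂ → ℂ} (hW : PotentialHyp Γ W R₀) (hu : SolvesGL W Ω ε u)
    (hug : ∀ z ∈ frontier Ω, u z = g z) (hg : ContDiff ℝ (⊤ : ℕ∞) g)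
    (hgΓ : ∀ z ∈ frontier Ω, g z ∈ Γ) (hM : ∀ s, ‖γ s‖ ≤ M) :
    c / 2 * ∫ s in (0 : ℝ)..L, (gsq (fun z => (u z).re) (γ s) + gsq (fun z => (u z).im) (γ s)) ≤
    (M + 2 * M ^ 2 / c + c / 2) *
      ∫ s in (0 : ℝ)..L, (gsq (fun z => (g z).re) (γ s) + gsq (fun z => (g z).im) (γ s)) := by
  have ha := smooth_re_comp hu.1
  have hb := smooth_im_comp hu.1
  have hg1 := smooth_re_comp hg
  have hg2 := smooth_im_comp hg
  set a : ℂ → ℝ := fun z => (u z).re with ha_def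
  set b : ℂ → ℝ := fun z => (u z).im with hb_def
  set g₁ : ℂ → ℝ := fun z => (g z).re with hg₁_def
  set g₂ : ℂ → ℝ := fun z => (g z).im with hg₂_def
  have hWu : Smooth fun z => W (u z) := hW.smooth.comp hu.1
  set k : ℝ := 2 * (ε ^ 2)⁻¹ with hk
  have hk0 : 0 ≤ k := by positivity
  set P : (ℂ → ℝ) → ℂ → ℝ := fun a z => 2 * (radial a z * pd 1 a z) - gsq a z * z.re with hP
  set Q : (ℂ → ℝ) → ℂ → ℝ := fun a z => 2 * (radial a z * pd Complex.I a z) - gsq a z * z.im with hQ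
  have hPs : ∀ a, Smooth a → Smooth (P a) := fun a ha =>
    (contDiff_const.mul (ha.radial.mul (ha.pd 1))).sub (ha.gsq.mul smooth_re)
  have hQs : ∀ a, Smooth a → Smooth (Q a) := fun a ha =>
    (contDiff_const.mul (ha.radial.mul (ha.pd Complex.I))).sub (ha.gsq.mul smooth_im)
  have hX : Smooth fun z => W (u z) * z.re := hWu.mul smooth_re
  have hY : Smooth fun z => W (u z) * z.im := hWu.mul smooth_im
  have hPab := (hPs a ha).add (hPs b hb)
  have hQab := (hQs a ha).add (hQs b hb)
  have hdiv := S.integral_div (P := fun z => P a z + P b z - k * (W (u z) * z.re))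
    (Q := fun z => Q a z + Q b z - k * (W (u z) * z.im))
    (hPab.sub (contDiff_const.mul hX)) (hQab.sub (contDiff_const.mul hY))
  have hle : ∫ z in Ω, (pd 1 (fun z => P a z + P b z - k * (W (u z) * z.re)) z +
      pd Complex.I (fun z => Q a z + Q b z - k * (W (u z) * z.im)) z) ≤ 0 := by
    refine setIntegral_nonpos S.isOpen.measurableSet fun z hz => ?_
    have hWd : ∀ e, pd e (fun z => W (u z)) z =
        pd 1 W (u z) * pd e a z + pd Complex.I W (u z) * pd e b z := by
      intro e
      have h1 : pd e (fun z => W (u z)) z = pd (fderiv ℝ u z e) W (u z) := by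
        have := ((hW.smooth.differentiable (by simp) (u z)).hasFDerivAt.comp z
          (hu.1.differentiable (by simp) z).hasFDerivAt).fderiv
        exact congrArg (fun l => l e) this
      rw [h1, pd_decomp, ← pd_re_comp hu.1, ← pd_im_comp hu.1]
      ring
    rw [pd_sub hPab (contDiff_const.mul hX), pd_sub hQab (contDiff_const.mul hY),
      pd_add (hPs a ha) (hPs b hb), pd_add (hQs a ha) (hQs b hb), pd_const_mul hX,
      pd_const_mul hY, pd_mul hWu smooth_re, pd_mul hWu smooth_im, pd_re, pd_im]
    have d1 := div_pohozaev ha z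
    have d2 := div_pohozaev hb z
    rw [hu.lapR_re hz] at d1
    rw [hu.lapR_im hz] at d2
    have d3 : pd 1 (P a) z + pd Complex.I (Q a) z = k * (radial a z * pd 1 W (u z)) := by
      rw [hk]; linarith
    have d4 : pd 1 (P b) z + pd Complex.I (Q b) z = k * (radial b z * pd Complex.I W (u z)) := by
      rw [hk]; linarith
    have hfin : pd 1 (P a) z + pd 1 (P b) z - k * (pd 1 (fun z => W (u z)) z * z.re + W (u z) * (1 : ℂ).re) +
        (pd Complex.I (Q a) z + pd Complex.I (Q b) z -
          k * (pd Complex.I (fun z => W (u z)) z * z.im + W (u z) * Complex.I.im)) =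
        -(2 * k * W (u z)) := by
      rw [hWd, hWd]
      simp only [radial] at d3 d4
      simp only [Complex.one_re, Complex.I_im]
      linear_combination d3 + d4
    rw [hfin]
    have := hW.nonneg (u z)
    have : 0 ≤ 2 * k * W (u z) := by positivity
    linarith
  rw [hdiv] at hle
  have hW0 : ∀ s, W (u (γ s)) = 0 := by
    intro s
    have : u (γ s) ∈ W ⁻¹' {0} := by
      rw [hW.zeros, hug _ (S.mem_frontier s)]
      exact hgΓ _ (S.mem_frontier s)
    exact this
  have hcN := S.continuous_normalC
  have hcγ := S.param.smooth.continuous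
  have hcF : Continuous fun s => (P a (γ s) + P b (γ s) - k * (W (u (γ s)) * (γ s).re)) *
      (normalC σ γ s).re + (Q a (γ s) + Q b (γ s) - k * (W (u (γ s)) * (γ s).im)) *
      (normalC σ γ s).im :=
    (((hPab.sub (contDiff_const.mul hX)).continuous.comp hcγ).mul
      (Complex.continuous_re.comp hcN)).add
    (((hQab.sub (contDiff_const.mul hY)).continuous.comp hcγ).mul
      (Complex.continuous_im.comp hcN))
  have hcg : Continuous fun z => gsq g₁ z + gsq g₂ z := hg1.gsq.continuous.add hg2.gsq.continuous
  have hca : Continuous fun z => gsq a z + gsq b z := ha.gsq.continuous.add hb.gsq.continuous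
  have hcg' := S.curve_intervalIntegrable hcg
  rw [← intervalIntegral.integral_const_mul, ← intervalIntegral.integral_const_mul]
  calc ∫ s in (0 : ℝ)..L, c / 2 * (gsq a (γ s) + gsq b (γ s))
      ≤ ∫ s in (0 : ℝ)..L, (((P a (γ s) + P b (γ s) - k * (W (u (γ s)) * (γ s).re)) *
      (normalC σ γ s).re + (Q a (γ s) + Q b (γ s) - k * (W (u (γ s)) * (γ s).im)) *
      (normalC σ γ s).im) + (M + 2 * M ^ 2 / c + c / 2) * (gsq g₁ (γ s) + gsq g₂ (γ s))) := by
        refine intervalIntegral.integral_mono_on S.param.Lpos.le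
          ((S.curve_intervalIntegrable hca).const_mul _)
          ((hcF.intervalIntegrable _ _).add (hcg'.const_mul _)) fun s _ => ?_
        have h1 := S.pohozaev_boundary hM ha hg1 (fun z hz => by rw [ha_def, hg₁_def]; simp only [hug z hz]) s
        have h2 := S.pohozaev_boundary hM hb hg2 (fun z hz => by rw [hb_def, hg₂_def]; simp only [hug z hz]) s
        rw [hW0]
        simp only [hP, hQ]
        linarith
    _ ≤ _ := by
        rw [intervalIntegral.integral_add (hcF.intervalIntegrable _ _) (hcg'.const_mul _)]
        linarith

theorem exists_norm_curve_le (S : StarDomain Ω γ L c σ) : ∃ M, ∀ s, ‖γ s‖ ≤ M := by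
  obtain ⟨M, hM⟩ := S.bounded.closure.exists_norm_le
  exact ⟨M, fun s => hM _ (S.mem_closure s)⟩

end StarDomain

theorem gsq_sub_le {a b : ℂ → ℝ} (ha : Smooth a) (hb : Smooth b) (z : ℂ) :
    gsq (fun z => a z - b z) z ≤ 2 * gsq a z + 2 * gsq b z := by
  simp only [gsq]
  rw [pd_sub ha hb, pd_sub ha hb]
  nlinarith [sq_nonneg (pd 1 a z + pd 1 b z), sq_nonneg (pd Complex.I a z + pd Complex.I b z)]

/-- Uniform bound on the boundary gradient of `u - g`, for all solutions `u` with data `g`. -/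
theorem StarDomain.exists_boundary_bound {Ω : Set ℂ} {γ : ℝ → ℂ} {L c σ : ℝ}
    (S : StarDomain Ω γ L c σ) {Γ : Set ℂ} {W : ℂ → ℝ} {R₀ : ℝ} {g : ℂ → ℂ}
    (hW : PotentialHyp Γ W R₀) (hg : ContDiff ℝ (⊤ : ℕ∞) g)
    (hgΓ : ∀ z ∈ frontier Ω, g z ∈ Γ) :
    ∃ C, 0 ≤ C ∧ ∀ (ε : ℝ) (u : ℂ → ℂ), SolvesGL W Ω ε u → (∀ z ∈ frontier Ω, u z = g z) →
      ∫ s in (0 : ℝ)..L, gsq (fun z => (u z).re - (g z).re) (γ s) ≤ C ∧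
      ∫ s in (0 : ℝ)..L, gsq (fun z => (u z).im - (g z).im) (γ s) ≤ C := by
  obtain ⟨M, hM⟩ := S.exists_norm_curve_le
  have hM0 : 0 ≤ M := (norm_nonneg _).trans (hM 0)
  have hc := S.cpos
  have hL := S.param.Lpos.le
  have hg1 := smooth_re_comp hg
  have hg2 := smooth_im_comp hg
  set G := ∫ s in (0 : ℝ)..L, (gsq (fun z => (g z).re) (γ s) + gsq (fun z => (g z).im) (γ s)) with hG
  have hG0 : 0 ≤ G := intervalIntegral.integral_nonneg hL
    fun s _ => add_nonneg (gsq_nonneg _ _) (gsq_nonneg _ _)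
  refine ⟨2 * ((M + 2 * M ^ 2 / c + c / 2) * G / (c / 2)) + 2 * G, by positivity, ?_⟩
  intro ε u hu hug
  have ha := smooth_re_comp hu.1
  have hb := smooth_im_comp hu.1
  have key := S.integral_gsq_boundary_le hW hu hug hg hgΓ hM
  rw [← hG, ← le_div_iff₀' (by positivity)] at key
  have hi : ∀ {f : ℂ → ℝ}, Smooth f → IntervalIntegrable (fun s => gsq f (γ s)) volume 0 L :=
    fun hf => S.curve_intervalIntegrable hf.gsq.continuous
  have main : ∀ a b : ℂ → ℝ, Smooth a → Smooth b →
      (∀ z, gsq a z ≤ gsq (fun z => (u z).re) z + gsq (fun z => (u z).im) z) →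
      (∀ z, gsq b z ≤ gsq (fun z => (g z).re) z + gsq (fun z => (g z).im) z) →
      ∫ s in (0 : ℝ)..L, gsq (fun z => a z - b z) (γ s) ≤
        2 * ((M + 2 * M ^ 2 / c + c / 2) * G / (c / 2)) + 2 * G := by
    intro a b ha' hb' h1 h2
    calc _ ≤ ∫ s in (0 : ℝ)..L,
        (2 * (gsq (fun z => (u z).re) (γ s) + gsq (fun z => (u z).im) (γ s)) +
          2 * (gsq (fun z => (g z).re) (γ s) + gsq (fun z => (g z).im) (γ s))) := by
          refine intervalIntegral.integral_mono_on hL (hi (ha'.sub hb'))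
            ((((hi ha).add (hi hb)).const_mul 2).add (((hi hg1).add (hi hg2)).const_mul 2))
            fun s _ => ?_
          have := gsq_sub_le ha' hb' (γ s)
          linarith [h1 (γ s), h2 (γ s)]
      _ ≤ _ := by
          rw [intervalIntegral.integral_add (((hi ha).add (hi hb)).const_mul 2)
            (((hi hg1).add (hi hg2)).const_mul 2), intervalIntegral.integral_const_mul,
            intervalIntegral.integral_const_mul]
          linarith
  exact ⟨main _ _ ha hg1 (fun z => by linarith [gsq_nonneg (fun z => (u z).im) z])
      (fun z => by linarith [gsq_nonneg (fun z => (g z).im) z]),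
    main _ _ hb hg2 (fun z => by linarith [gsq_nonneg (fun z => (u z).re) z])
      (fun z => by linarith [gsq_nonneg (fun z => (g z).re) z])⟩

theorem smooth_exp {φ : ℂ → ℝ} (hφ : Smooth φ) : Smooth fun z => Real.exp (φ z) :=
  Real.contDiff_exp.comp hφ

theorem div_carleman {w φ : ℂ → ℝ} (hw : Smooth w) (hφ : Smooth φ) (z : ℂ) :
    pd 1 (fun z => Real.exp (φ z) * (2 * (pd Complex.I (pd Complex.I w) z * pd 1 w z -
        pd 1 (pd Complex.I w) z * pd Complex.I w z) - gsq w z * pd 1 φ z)) z +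
      pd Complex.I (fun z => Real.exp (φ z) * (2 * (pd 1 (pd 1 w) z * pd Complex.I w z -
        pd 1 (pd Complex.I w) z * pd 1 w z) - gsq w z * pd Complex.I φ z)) z ≤
    Real.exp (φ z) * lapR w z ^ 2 - Real.exp (φ z) * lapR φ z * gsq w z := by
  have h1 := hw.pd 1
  have hI := hw.pd Complex.I
  have h11 := h1.pd 1
  have h1I := hI.pd 1
  have hII := hI.pd Complex.I
  have hE := smooth_exp hφ
  have hX : ∀ a b d : ℂ → ℝ, Smooth a → Smooth b → Smooth d → ∀ (e : ℂ) (k : ℂ → ℝ), Smooth k →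
      pd e (fun z => Real.exp (φ z) * (2 * (a z * b z - d z * k z) - gsq w z * pd e φ z)) z =
      Real.exp (φ z) * pd e φ z * (2 * (a z * b z - d z * k z) - gsq w z * pd e φ z) +
      Real.exp (φ z) * (2 * (pd e a z * b z + a z * pd e b z - (pd e d z * k z + d z * pd e k z)) -
        (pd e (gsq w) z * pd e φ z + gsq w z * pd e (pd e φ) z)) := by
    intro a b d ha hb hd e k hk
    have hs1 : Smooth fun z => a z * b z - d z * k z := (ha.mul hb).sub (hd.mul hk)
    have hs2 : Smooth fun z => gsq w z * pd e φ z := hw.gsq.mul (hφ.pd e)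
    rw [pd_mul hE ((contDiff_const.mul hs1).sub hs2), pd_sub (contDiff_const.mul hs1) hs2,
      pd_const_mul hs1, pd_sub (ha.mul hb) (hd.mul hk), pd_mul ha hb, pd_mul hd hk,
      pd_mul hw.gsq (hφ.pd e), pd_exp hφ]
  rw [hX _ _ _ hII h1 h1I _ _ hI, hX _ _ _ h11 hI h1I _ _ h1, pd_gsq hw, pd_gsq hw,
    pd_comm hw Complex.I 1, pd_comm hI Complex.I 1, pd_comm h1 Complex.I 1,
    pd_comm hw Complex.I 1, lapR_eq_pd, lapR_eq_pd, gsq]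
  have hpos : 0 ≤ Real.exp (φ z) * ((pd 1 (pd 1 w) z - pd Complex.I (pd Complex.I w) z +
      pd 1 φ z * pd 1 w z - pd Complex.I φ z * pd Complex.I w z) ^ 2 +
      (2 * pd 1 (pd Complex.I w) z + pd 1 φ z * pd Complex.I w z +
        pd Complex.I φ z * pd 1 w z) ^ 2) := by positivity
  linarith

theorem div_hardy {w φ : ℂ → ℝ} (hw : Smooth w) (hφ : Smooth φ) (z : ℂ) :
    Real.exp (φ z) * lapR φ z * w z ^ 2 - Real.exp (φ z) * gsq w z ≤
    pd 1 (fun z => Real.exp (φ z) * (w z * w z * pd 1 φ z)) z +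
      pd Complex.I (fun z => Real.exp (φ z) * (w z * w z * pd Complex.I φ z)) z := by
  have hE := smooth_exp hφ
  rw [pd_mul hE ((hw.mul hw).mul (hφ.pd 1)), pd_mul hE ((hw.mul hw).mul (hφ.pd Complex.I)),
    pd_mul (hw.mul hw) (hφ.pd 1), pd_mul (hw.mul hw) (hφ.pd Complex.I), pd_mul hw hw,
    pd_mul hw hw, pd_exp hφ, pd_exp hφ, lapR_eq_pd, gsq]
  have hpos : 0 ≤ Real.exp (φ z) * ((pd 1 w z + w z * pd 1 φ z) ^ 2 +
      (pd Complex.I w z + w z * pd Complex.I φ z) ^ 2) := by positivity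
  linarith

namespace StarDomain

variable {Ω : Set ℂ} {γ : ℝ → ℂ} {L c σ : ℝ}

theorem tangential_zero (S : StarDomain Ω γ L c σ) {w : ℂ → ℝ} (hw : Smooth w)
    (hw0 : ∀ z ∈ frontier Ω, w z = 0) (s : ℝ) :
    (deriv γ s).re * pd 1 w (γ s) + (deriv γ s).im * pd Complex.I w (γ s) = 0 := by
  refine (hasDerivAt_comp_curve hw (S.hasDerivAt s)).unique ?_
  have : (fun s => w (γ s)) = fun _ => 0 := funext fun s => hw0 _ (S.mem_frontier s)
  rw [this]
  exact hasDerivAt_const _ _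

theorem carleman_boundary (S : StarDomain Ω γ L c σ) {κ Φ : ℝ}
    (hκ : ∀ s, ‖deriv (deriv γ) s‖ ≤ κ) {w φ : ℂ → ℝ} (hw : Smooth w)
    (hw0 : ∀ z ∈ frontier Ω, w z = 0) (s : ℝ) (hΦ0 : 0 ≤ Φ) (hΦ : gsq φ (γ s) ≤ Φ ^ 2) :
    -((2 * κ + Φ) * (Real.exp (φ (γ s)) * gsq w (γ s))) ≤
    (Real.exp (φ (γ s)) * (2 * (pd Complex.I (pd Complex.I w) (γ s) * pd 1 w (γ s) -
        pd 1 (pd Complex.I w) (γ s) * pd Complex.I w (γ s)) - gsq w (γ s) * pd 1 φ (γ s))) *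
        (normalC σ γ s).re +
      (Real.exp (φ (γ s)) * (2 * (pd 1 (pd 1 w) (γ s) * pd Complex.I w (γ s) -
        pd 1 (pd Complex.I w) (γ s) * pd 1 w (γ s)) - gsq w (γ s) * pd Complex.I φ (γ s))) *
        (normalC σ γ s).im := by
  have ht := S.tangential_zero hw hw0 s
  have ht2 : (deriv (deriv γ) s).re * pd 1 w (γ s) + (deriv γ s).re *
        ((deriv γ s).re * pd 1 (pd 1 w) (γ s) + (deriv γ s).im * pd Complex.I (pd 1 w) (γ s)) +
      ((deriv (deriv γ) s).im * pd Complex.I w (γ s) + (deriv γ s).im *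
        ((deriv γ s).re * pd 1 (pd Complex.I w) (γ s) +
          (deriv γ s).im * pd Complex.I (pd Complex.I w) (γ s))) = 0 := by
    have hre : HasDerivAt (fun s => (deriv γ s).re) (deriv (deriv γ) s).re s :=
      (Complex.reCLM.hasFDerivAt (x := deriv γ s)).comp_hasDerivAt s (S.hasDerivAt_deriv s)
    have him : HasDerivAt (fun s => (deriv γ s).im) (deriv (deriv γ) s).im s :=
      (Complex.imCLM.hasFDerivAt (x := deriv γ s)).comp_hasDerivAt s (S.hasDerivAt_deriv s)
    refine ((hre.mul (hasDerivAt_comp_curve (hw.pd 1) (S.hasDerivAt s))).add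
      (him.mul (hasDerivAt_comp_curve (hw.pd Complex.I) (S.hasDerivAt s)))).unique ?_
    have : (fun s => (deriv γ s).re) * (fun s => pd 1 w (γ s)) +
        (fun s => (deriv γ s).im) * (fun s => pd Complex.I w (γ s)) = fun _ => 0 :=
      funext fun s => S.tangential_zero hw hw0 s
    rw [this]
    exact hasDerivAt_const _ _
  rw [pd_comm hw Complex.I 1] at ht2
  have hT := S.deriv_sq s
  have hσ := S.sq
  have hκs := hκ s
  have hκ0 : 0 ≤ κ := (norm_nonneg _).trans hκs
  have hdotκ : |dot (deriv (deriv γ) s) ⟨(deriv γ s).im, -(deriv γ s).re⟩| ≤ κ := by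
    refine (abs_dot_le _ _).trans ?_
    have h1 : ‖(⟨(deriv γ s).im, -(deriv γ s).re⟩ : ℂ)‖ ^ 2 = 1 := by
      rw [← dot_self, dot]; simp only; linarith
    have : ‖(⟨(deriv γ s).im, -(deriv γ s).re⟩ : ℂ)‖ = 1 := by
      nlinarith [norm_nonneg (⟨(deriv γ s).im, -(deriv γ s).re⟩ : ℂ)]
    rwa [this, mul_one]
  have hE := Real.exp_pos (φ (γ s))
  simp only [gsq] at hΦ ⊢
  simp only [dot, normalC] at hdotκ ⊢
  set p := (deriv γ s).re
  set q := (deriv γ s).im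
  set E := Real.exp (φ (γ s))
  set wx := pd 1 w (γ s)
  set wy := pd Complex.I w (γ s)
  set fx := pd 1 φ (γ s)
  set fy := pd Complex.I φ (γ s)
  set A := pd 1 (pd 1 w) (γ s)
  set B := pd 1 (pd Complex.I w) (γ s)
  set D := pd Complex.I (pd Complex.I w) (γ s)
  set k1 := (deriv (deriv γ) s).re
  set k2 := (deriv (deriv γ) s).im
  set m := q * wx - p * wy with hm
  have hwx : wx = m * q := by
    rw [hm]; linear_combination (-wx) * hT + p * ht
  have hwy : wy = -(m * p) := by
    rw [hm]; linear_combination (-wy) * hT + q * ht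
  have hG : wx * wx + wy * wy = m ^ 2 := by
    rw [hwx, hwy]; linear_combination m ^ 2 * hT
  have hfN : |σ * (q * fx - p * fy)| ≤ Φ := by
    apply abs_le_of_sq_le_sq _ hΦ0
    have : (σ * (q * fx - p * fy)) ^ 2 = (q * fx - p * fy) ^ 2 := by
      rw [mul_pow, hσ, one_mul]
    rw [this]
    nlinarith [sq_nonneg (p * fx + q * fy)]
  have hmain : E * (2 * (D * wx - B * wy) - (wx * wx + wy * wy) * fx) * (σ * q) +
      E * (2 * (A * wy - B * wx) - (wx * wx + wy * wy) * fy) * -(σ * p) =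
      E * m ^ 2 * (-(2 * σ * (k1 * q + k2 * -p)) - σ * (q * fx - p * fy)) := by
    rw [hG]
    have : p * (p * A + q * B) + q * (p * B + q * D) = -(m * (k1 * q + k2 * -p)) := by
      rw [hwx, hwy] at ht2
      linarith
    rw [hwx, hwy]
    linear_combination 2 * σ * m * E * this
  rw [hmain, hG]
  have habsσ : |σ| = 1 := by
    rw [← sq_abs] at hσ
    nlinarith [abs_nonneg σ]
  have h2 : |2 * σ * (k1 * q + k2 * -p)| ≤ 2 * κ := by
    rw [abs_mul, abs_mul, abs_two, habsσ, mul_one]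
    linarith
  have h3 : -(2 * κ + Φ) ≤ -(2 * σ * (k1 * q + k2 * -p)) - σ * (q * fx - p * fy) := by
    linarith [(abs_le.1 h2).2, (abs_le.1 hfN).2]
  have h4 : 0 ≤ E * m ^ 2 := by positivity
  have := mul_le_mul_of_nonneg_left h3 h4
  linarith

theorem carleman_step (S : StarDomain Ω γ L c σ) {κ Φ M : ℝ}
    (hκ : ∀ s, ‖deriv (deriv γ) s‖ ≤ κ) {w φ : ℂ → ℝ} (hw : Smooth w) (hφ : Smooth φ)
    (hw0 : ∀ z ∈ frontier Ω, w z = 0) (hΦ0 : 0 ≤ Φ) (hΦ : ∀ z ∈ frontier Ω, gsq φ z ≤ Φ ^ 2)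
    (hM : ∀ z ∈ frontier Ω, Real.exp (φ z) ≤ M) :
    ∫ z in Ω, Real.exp (φ z) * lapR φ z * gsq w z ≤ (∫ z in Ω, Real.exp (φ z) * lapR w z ^ 2) +
      (2 * κ + Φ) * M * ∫ s in (0 : ℝ)..L, gsq w (γ s) := by
  have hκ0 : 0 ≤ κ := (norm_nonneg _).trans (hκ 0)
  have hE := smooth_exp hφ
  have hP : Smooth fun z => Real.exp (φ z) * (2 * (pd Complex.I (pd Complex.I w) z * pd 1 w z -
        pd 1 (pd Complex.I w) z * pd Complex.I w z) - gsq w z * pd 1 φ z) :=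
    hE.mul ((contDiff_const.mul ((((hw.pd _).pd _).mul (hw.pd _)).sub
      (((hw.pd _).pd _).mul (hw.pd _)))).sub (hw.gsq.mul (hφ.pd _)))
  have hQ : Smooth fun z => Real.exp (φ z) * (2 * (pd 1 (pd 1 w) z * pd Complex.I w z -
        pd 1 (pd Complex.I w) z * pd 1 w z) - gsq w z * pd Complex.I φ z) :=
    hE.mul ((contDiff_const.mul ((((hw.pd _).pd _).mul (hw.pd _)).sub
      (((hw.pd _).pd _).mul (hw.pd _)))).sub (hw.gsq.mul (hφ.pd _)))
  have hdiv := S.integral_div hP hQ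
  have hi1 : IntegrableOn (fun z => Real.exp (φ z) * lapR w z ^ 2) Ω :=
    S.integrableOn (hE.continuous.mul ((smooth_lapR hw).continuous.pow 2))
  have hi2 : IntegrableOn (fun z => Real.exp (φ z) * lapR φ z * gsq w z) Ω :=
    S.integrableOn ((hE.continuous.mul (smooth_lapR hφ).continuous).mul hw.gsq.continuous)
  have h1 := setIntegral_mono (S.integrableOn ((hP.pd 1).continuous.add (hQ.pd Complex.I).continuous))
    (hi1.sub hi2) (fun z => div_carleman hw hφ z)
  have h1' : ∫ z in Ω, (Real.exp (φ z) * lapR w z ^ 2 - Real.exp (φ z) * lapR φ z * gsq w z) =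
    (∫ z in Ω, Real.exp (φ z) * lapR w z ^ 2) - ∫ z in Ω, Real.exp (φ z) * lapR φ z * gsq w z :=
    integral_sub hi1 hi2
  have hcN := S.continuous_normalC
  have hcγ := S.param.smooth.continuous
  have hq : ∀ s, -((2 * κ + Φ) * M) * gsq w (γ s) ≤
      -((2 * κ + Φ) * (Real.exp (φ (γ s)) * gsq w (γ s))) := fun s => by
    have := mul_le_mul_of_nonneg_right (hM _ (S.mem_frontier s)) (gsq_nonneg w (γ s))
    have := mul_le_mul_of_nonneg_left this (show 0 ≤ 2 * κ + Φ by positivity)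
    linarith
  have h2 := intervalIntegral.integral_mono_on S.param.Lpos.le
    ((S.curve_intervalIntegrable hw.gsq.continuous).const_mul (-((2 * κ + Φ) * M)))
    ((((hP.continuous.comp hcγ).mul (Complex.continuous_re.comp hcN)).add
        ((hQ.continuous.comp hcγ).mul (Complex.continuous_im.comp hcN))).intervalIntegrable _ _)
    (fun s _ => (hq s).trans
      (S.carleman_boundary hκ hw hw0 s hΦ0 (hΦ _ (S.mem_frontier s))))
  rw [intervalIntegral.integral_const_mul] at h2
  replace h2 := h2.trans hdiv.symm.le
  have h3 := (h2.trans h1).trans h1'.le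
  linarith

theorem hardy_step (S : StarDomain Ω γ L c σ) {w φ : ℂ → ℝ} (hw : Smooth w) (hφ : Smooth φ)
    (hw0 : ∀ z ∈ frontier Ω, w z = 0) :
    ∫ z in Ω, Real.exp (φ z) * lapR φ z * w z ^ 2 ≤ ∫ z in Ω, Real.exp (φ z) * gsq w z := by
  have hE := smooth_exp hφ
  have hA : Smooth fun z => Real.exp (φ z) * (w z * w z * pd 1 φ z) :=
    hE.mul ((hw.mul hw).mul (hφ.pd _))
  have hB : Smooth fun z => Real.exp (φ z) * (w z * w z * pd Complex.I φ z) :=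
    hE.mul ((hw.mul hw).mul (hφ.pd _))
  have hdiv := S.integral_div hA hB
  simp only [hw0 _ (S.mem_frontier _), mul_zero, zero_mul, add_zero,
    intervalIntegral.integral_zero] at hdiv
  have hi1 : IntegrableOn (fun z => Real.exp (φ z) * lapR φ z * w z ^ 2) Ω :=
    S.integrableOn ((hE.continuous.mul (smooth_lapR hφ).continuous).mul (hw.continuous.pow 2))
  have hi2 : IntegrableOn (fun z => Real.exp (φ z) * gsq w z) Ω :=
    S.integrableOn (hE.continuous.mul hw.gsq.continuous)
  have h1 := setIntegral_mono (hi1.sub hi2)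
    (S.integrableOn ((hA.pd 1).continuous.add (hB.pd Complex.I).continuous))
    (fun z => div_hardy hw hφ z)
  have h1' : ∫ z in Ω, (Real.exp (φ z) * lapR φ z * w z ^ 2 - Real.exp (φ z) * gsq w z) =
    (∫ z in Ω, Real.exp (φ z) * lapR φ z * w z ^ 2) - ∫ z in Ω, Real.exp (φ z) * gsq w z :=
    integral_sub hi1 hi2
  have h2 := h1'.symm.le.trans (h1.trans hdiv.le)
  linarith

end StarDomain

theorem exists_weight (τ N : ℝ) {a : ℝ} (ha : 0 < a) : ∃ F : ℝ → ℝ, ContDiff ℝ (⊤ : ℕ∞) F ∧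
    ∀ t, a < t → F t = τ / t - N * Real.log t ∧ deriv F t = -τ / t ^ 2 - N / t ∧
      deriv (deriv F) t = 2 * τ / t ^ 3 + N / t ^ 2 := by
  set χ : ℝ → ℝ := fun t => Real.smoothTransition (2 * t / a - 1) * t +
    (1 - Real.smoothTransition (2 * t / a - 1)) * a with hχ
  have hS : ContDiff ℝ (⊤ : ℕ∞) fun t : ℝ => Real.smoothTransition (2 * t / a - 1) :=
    Real.smoothTransition.contDiff.comp (by fun_prop)
  have hχs : ContDiff ℝ (⊤ : ℕ∞) χ :=
    (hS.mul contDiff_id).add ((contDiff_const.sub hS).mul contDiff_const)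
  have hχpos : ∀ t, 0 < χ t := by
    intro t
    by_cases ht : t ≤ a / 2
    · have : Real.smoothTransition (2 * t / a - 1) = 0 := by
        apply Real.smoothTransition.zero_of_nonpos
        have : 2 * t / a ≤ 1 := by rw [div_le_one ha]; linarith
        linarith
      simp only [hχ, this]
      linarith
    · push Not at ht
      have h1 := Real.smoothTransition.nonneg (2 * t / a - 1)
      have h2 := Real.smoothTransition.le_one (2 * t / a - 1)
      simp only [hχ]
      nlinarith
  have hχt : ∀ t, a ≤ t → χ t = t := by
    intro t ht
    have : Real.smoothTransition (2 * t / a - 1) = 1 := by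
      apply Real.smoothTransition.one_of_one_le
      have : 2 ≤ 2 * t / a := by rw [le_div_iff₀ ha]; linarith
      linarith
    simp [hχ, this]
  have h1 : ∀ t, a < t → HasDerivAt (fun t => τ / t - N * Real.log t) (-τ / t ^ 2 - N / t) t := by
    intro t ht
    have ht0 : t ≠ 0 := by linarith
    have := ((hasDerivAt_inv ht0).const_mul τ).sub ((Real.hasDerivAt_log ht0).const_mul N)
    simp only [div_eq_mul_inv]
    exact this.congr_deriv (by field_simp)
  have h2 : ∀ t, a < t → HasDerivAt (fun t => -τ / t ^ 2 - N / t) (2 * τ / t ^ 3 + N / t ^ 2) t := by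
    intro t ht
    have ht0 : t ≠ 0 := by linarith
    have := (((hasDerivAt_pow 2 t).inv (by positivity)).const_mul (-τ)).sub
      ((hasDerivAt_inv ht0).const_mul N)
    simp only [div_eq_mul_inv]
    refine this.congr_deriv ?_
    field_simp
    push_cast
    ring
  refine ⟨fun t => τ / χ t - N * Real.log (χ t), (contDiff_const.div hχs fun t => (hχpos t).ne').sub
    (contDiff_const.mul (hχs.log fun t => (hχpos t).ne')), fun t ht => ?_⟩
  have hev : ∀ t, a < t → (fun t => τ / χ t - N * Real.log (χ t)) =ᶠ[𝓝 t]
      fun t => τ / t - N * Real.log t := by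
    intro t ht
    filter_upwards [lt_mem_nhds ht] with y hy
    rw [hχt y hy.le]
  have hd : ∀ t, a < t → deriv (fun t => τ / χ t - N * Real.log (χ t)) t = -τ / t ^ 2 - N / t :=
    fun t ht => (hev t ht).deriv_eq.trans (h1 t ht).deriv
  refine ⟨by simp only [hχt t ht.le], hd t ht, ?_⟩
  have hev2 : deriv (fun t => τ / χ t - N * Real.log (χ t)) =ᶠ[𝓝 t] fun t => -τ / t ^ 2 - N / t := by
    filter_upwards [lt_mem_nhds ht] with y hy using hd y hy
  exact hev2.deriv_eq.trans (h2 t ht).deriv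

theorem smooth_weight {F : ℝ → ℝ} (hF : ContDiff ℝ (⊤ : ℕ∞) F) (q : ℂ) :
    Smooth fun z => F (sqDist q z) := hF.comp (smooth_sqDist q)

theorem gsq_sqDist (q z : ℂ) : gsq (sqDist q) z = 4 * sqDist q z := by
  simp only [gsq, pd_sqDist, sqDist]
  simp
  ring

theorem gsq_comp {F : ℝ → ℝ} (hF : ContDiff ℝ (⊤ : ℕ∞) F) {f : ℂ → ℝ} (hf : Smooth f) (z : ℂ) :
    gsq (fun z => F (f z)) z = deriv F (f z) ^ 2 * gsq f z := by
  simp only [gsq, pd_comp hf hF]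
  ring

theorem lapR_comp {F : ℝ → ℝ} (hF : ContDiff ℝ (⊤ : ℕ∞) F) {f : ℂ → ℝ} (hf : Smooth f) (z : ℂ) :
    lapR (fun z => F (f z)) z = deriv (deriv F) (f z) * gsq f z + deriv F (f z) * lapR f z := by
  have hF' : ContDiff ℝ (⊤ : ℕ∞) (deriv F) := (contDiff_infty_iff_deriv.1 hF).2
  have hc : Smooth fun z => deriv F (f z) := hF'.comp hf
  simp only [lapR_eq_pd, gsq, pd_comp hf hF]
  rw [pd_mul hc (hf.pd 1), pd_mul hc (hf.pd Complex.I), pd_comp hf hF', pd_comp hf hF']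
  ring

theorem exp_weight (τ : ℝ) (N : ℕ) {t : ℝ} (ht : 0 < t) :
    Real.exp (τ / t - N * Real.log t) = Real.exp (τ / t) * (t ^ N)⁻¹ := by
  rw [Real.exp_sub, ← Real.log_pow, Real.exp_log (by positivity), div_eq_mul_inv]

/-- Carleman inequality with the weight `exp (τ / |z - q|²)`, `q` outside the closure. -/
theorem StarDomain.carleman {Ω : Set ℂ} {γ : ℝ → ℂ} {L c σ : ℝ} (S : StarDomain Ω γ L c σ) {κ : ℝ}
    (hκ : ∀ s, ‖deriv (deriv γ) s‖ ≤ κ) {w : ℂ → ℝ} (hw : Smooth w)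
    (hw0 : ∀ z ∈ frontier Ω, w z = 0) {q : ℂ} {m τ : ℝ} (hm : 0 < m) (hτ : 0 < τ)
    (hq : ∀ z ∈ closure Ω, m ^ 2 ≤ sqDist q z) :
    16 * τ ^ 2 * ∫ z in Ω, Real.exp (τ / sqDist q z) * (sqDist q z ^ 6)⁻¹ * w z ^ 2 ≤
      (∫ z in Ω, Real.exp (τ / sqDist q z) * (sqDist q z ^ 2)⁻¹ * lapR w z ^ 2) +
      (2 * κ + 2 * (τ / m ^ 3 + 2 / m)) * (Real.exp (τ / m ^ 2) * (m ^ 4)⁻¹) *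
        ∫ s in (0 : ℝ)..L, gsq w (γ s) := by
  have ha : 0 < m ^ 2 / 2 := by positivity
  have hqa : ∀ z ∈ closure Ω, m ^ 2 / 2 < sqDist q z := fun z hz => by
    have := hq z hz
    linarith
  have hq0 : ∀ z ∈ closure Ω, 0 < sqDist q z := fun z hz => ha.trans (hqa z hz)
  have hlap : ∀ (N : ℕ) (F : ℝ → ℝ), ContDiff ℝ (⊤ : ℕ∞) F → (∀ t, m ^ 2 / 2 < t →
      F t = τ / t - N * Real.log t ∧ deriv F t = -τ / t ^ 2 - N / t ∧
      deriv (deriv F) t = 2 * τ / t ^ 3 + N / t ^ 2) → ∀ z ∈ closure Ω,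
      lapR (fun z => F (sqDist q z)) z = 4 * τ * (sqDist q z ^ 2)⁻¹ ∧
      gsq (fun z => F (sqDist q z)) z = (τ / sqDist q z ^ 2 + N / sqDist q z) ^ 2 *
        (4 * sqDist q z) ∧
      Real.exp (F (sqDist q z)) = Real.exp (τ / sqDist q z) * (sqDist q z ^ N)⁻¹ := by
    intro N F hF h z hz
    obtain ⟨h1, h2, h3⟩ := h _ (hqa z hz)
    have h0 := hq0 z hz
    refine ⟨?_, ?_, ?_⟩
    · rw [lapR_comp hF (smooth_sqDist q), gsq_sqDist, lapR_sqDist, h2, h3]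
      field_simp
      ring
    · rw [gsq_comp hF (smooth_sqDist q), gsq_sqDist, h2]
      ring
    · rw [h1, exp_weight _ _ h0]
  obtain ⟨F, hF, hF'⟩ := exists_weight τ (2 : ℕ) ha
  obtain ⟨H, hH, hH'⟩ := exists_weight τ (4 : ℕ) ha
  have hFz := hlap 2 F hF hF'
  have hHz := hlap 4 H hH hH'
  have hms := S.isOpen.measurableSet
  have hB : ∀ z ∈ frontier Ω, gsq (fun z => F (sqDist q z)) z ≤ (2 * (τ / m ^ 3 + 2 / m)) ^ 2 := by
    intro z hz
    have hzc := frontier_subset_closure hz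
    rw [(hFz z hzc).2.1, sqDist_eq]
    have hr := hq z hzc
    rw [sqDist_eq] at hr
    have hr' : m ≤ ‖z - q‖ := (pow_le_pow_iff_left₀ hm.le (norm_nonneg _) two_ne_zero).1 hr
    set r := ‖z - q‖
    have hr0 : 0 < r := hm.trans_le hr'
    have : (τ / (r ^ 2) ^ 2 + (2 : ℕ) / r ^ 2) ^ 2 * (4 * r ^ 2) = (2 * (τ / r ^ 3 + 2 / r)) ^ 2 := by
      push_cast
      field_simp
      ring
    rw [this]
    gcongr
  have hM : ∀ z ∈ frontier Ω, Real.exp (F (sqDist q z)) ≤ Real.exp (τ / m ^ 2) * (m ^ 4)⁻¹ := by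
    intro z hz
    have hzc := frontier_subset_closure hz
    rw [(hFz z hzc).2.2]
    have hr := hq z hzc
    have : m ^ 4 = (m ^ 2) ^ 2 := by ring
    rw [this]
    gcongr
  have h1 := S.carleman_step hκ hw (smooth_weight hF q) hw0 (by positivity) hB hM
  have h2 := S.hardy_step hw (smooth_weight hH q) hw0
  have e1 : ∫ z in Ω, Real.exp (F (sqDist q z)) * lapR (fun z => F (sqDist q z)) z * gsq w z =
      4 * τ * ∫ z in Ω, Real.exp (H (sqDist q z)) * gsq w z := by
    rw [← integral_const_mul]
    refine setIntegral_congr_fun hms fun z hz => ?_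
    have hzc := subset_closure hz
    have h0 := hq0 z hzc
    simp only [(hFz z hzc).1, (hFz z hzc).2.2, (hHz z hzc).2.2]
    field_simp
  have e2 : ∫ z in Ω, Real.exp (H (sqDist q z)) * lapR (fun z => H (sqDist q z)) z * w z ^ 2 =
      4 * τ * ∫ z in Ω, Real.exp (τ / sqDist q z) * (sqDist q z ^ 6)⁻¹ * w z ^ 2 := by
    rw [← integral_const_mul]
    refine setIntegral_congr_fun hms fun z hz => ?_
    have hzc := subset_closure hz
    have h0 := hq0 z hzc
    simp only [(hHz z hzc).1, (hHz z hzc).2.2]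
    field_simp
  have e3 : ∫ z in Ω, Real.exp (F (sqDist q z)) * lapR w z ^ 2 =
      ∫ z in Ω, Real.exp (τ / sqDist q z) * (sqDist q z ^ 2)⁻¹ * lapR w z ^ 2 := by
    refine setIntegral_congr_fun hms fun z hz => ?_
    simp only [(hFz z (subset_closure hz)).2.2]
  rw [e1, e3] at h1
  rw [e2] at h2
  have h3 := mul_le_mul_of_nonneg_left h2 (show 0 ≤ 4 * τ by positivity)
  calc _ = 4 * τ * (4 * τ * ∫ z in Ω, Real.exp (τ / sqDist q z) * (sqDist q z ^ 6)⁻¹ * w z ^ 2) := by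
        ring
    _ ≤ _ := h3.trans h1

theorem exists_lipschitz_bound {F : Type*} [NormedAddCommGroup F] [NormedSpace ℝ F] {f : ℂ → F}
    (hf : ContDiff ℝ (⊤ : ℕ∞) f) (M : ℝ) :
    ∃ Λ, 0 ≤ Λ ∧ ∀ a ∈ closedBall (0 : ℂ) M, ∀ b ∈ closedBall (0 : ℂ) M,
      ‖f a - f b‖ ≤ Λ * ‖a - b‖ := by
  obtain ⟨C, hC⟩ := (isCompact_closedBall (0 : ℂ) M).exists_bound_of_continuousOn
    (hf.continuous_fderiv (by simp)).continuousOn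
  refine ⟨max C 0, le_max_right _ _, fun a ha b hb => ?_⟩
  exact (convex_closedBall (0 : ℂ) M).norm_image_sub_le_of_norm_fderiv_le (𝕜 := ℝ)
    (fun z _ => hf.differentiable (by simp) z) (fun z hz => (hC z hz).trans (le_max_left _ _)) hb ha

/-- The squared distance `|u - g|²`. -/
def gap (u g : ℂ → ℂ) (z : ℂ) : ℝ := ((u z).re - (g z).re) ^ 2 + ((u z).im - (g z).im) ^ 2

theorem gap_eq (u g : ℂ → ℂ) (z : ℂ) : gap u g z = ‖u z - g z‖ ^ 2 := by
  rw [← dot_self, dot, gap]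
  simp only [Complex.sub_re, Complex.sub_im]
  ring

theorem gap_nonneg (u g : ℂ → ℂ) (z : ℂ) : 0 ≤ gap u g z := by
  rw [gap_eq]
  positivity

/-- The sum of the squares of the Laplacians of the components of `u - g`. -/
def lapSq (u g : ℂ → ℂ) (z : ℂ) : ℝ :=
  lapR (fun z => (u z).re - (g z).re) z ^ 2 + lapR (fun z => (u z).im - (g z).im) z ^ 2

theorem PotentialHyp.pd_eq_zero {Γ : Set ℂ} {W : ℂ → ℝ} {R₀ : ℝ} (hW : PotentialHyp Γ W R₀) {y : ℂ}
    (hy : y ∈ Γ) (e : ℂ) : pd e W y = 0 := by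
  have h0 : W y = 0 := by
    rw [← hW.zeros] at hy
    exact hy
  have : IsLocalMin W y := Filter.Eventually.of_forall fun z => by
    rw [h0]
    exact hW.nonneg z
  rw [pd, this.fderiv_eq_zero]
  rfl

theorem exists_lapSq_bound {Γ Ω : Set ℂ} {W : ℂ → ℝ} {R₀ : ℝ} {g : ℂ → ℂ}
    (hΩo : IsOpen Ω) (hΩb : IsBounded Ω) (hW : PotentialHyp Γ W R₀) (hR : 0 ≤ R₀)
    (hg : ContDiff ℝ (⊤ : ℕ∞) g) (hgΓ : ∀ z ∈ frontier Ω, g z ∈ Γ) :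
    ∃ A, 0 < A ∧ ∀ (ε : ℝ) (u : ℂ → ℂ), 0 < ε → ε ≤ 1 → SolvesGL W Ω ε u →
      (∀ z ∈ frontier Ω, u z = g z) → ∀ p ∈ frontier Ω, ∀ z ∈ Ω,
      lapSq u g z ≤ A * (ε ^ 4)⁻¹ ∧
      lapSq u g z ≤ A * ((ε ^ 4)⁻¹ * (gap u g z + sqDist ((1 + (ε : ℂ)) * p) z) + (ε ^ 2)⁻¹) := by
  obtain ⟨M, hM⟩ := hΩb.closure.subset_closedBall (0 : ℂ)
  have hcomp : IsCompact (closure Ω) := hΩb.isCompact_closure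
  obtain ⟨Λ₁, hΛ₁0, hΛ₁⟩ := exists_lipschitz_bound (Smooth.pd hW.smooth 1) R₀
  obtain ⟨Λ₂, hΛ₂0, hΛ₂⟩ := exists_lipschitz_bound (Smooth.pd hW.smooth Complex.I) R₀
  obtain ⟨C, hC0, hC⟩ := exists_lipschitz_bound hg M
  obtain ⟨G₁, hG₁⟩ := hcomp.exists_bound_of_continuousOn
    (smooth_lapR (smooth_re_comp hg)).continuous.continuousOn
  obtain ⟨G₂, hG₂⟩ := hcomp.exists_bound_of_continuousOn
    (smooth_lapR (smooth_im_comp hg)).continuous.continuousOn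
  set Λ : ℝ := Λ₁ + Λ₂ with hΛ
  refine ⟨1 + 4 * Λ ^ 2 * (2 * R₀) ^ 2 + 8 * Λ ^ 2 + 16 * Λ ^ 2 * C ^ 2 + 16 * Λ ^ 2 * C ^ 2 * M ^ 2
    + 2 * G₁ ^ 2 + 2 * G₂ ^ 2, by positivity, fun ε u hε hε1 hu hug p hp z hz => ?_⟩
  have huΓ : ∀ z ∈ frontier Ω, u z ∈ Γ := fun z hz => by rw [hug z hz]; exact hgΓ z hz
  have hzc := subset_closure hz
  have hpc := frontier_subset_closure hp
  have hur : u z ∈ closedBall (0 : ℂ) R₀ := by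
    rw [mem_closedBall_zero_iff]
    exact norm_le_of_solvesGL hW hR hΩo hΩb hu huΓ hzc
  have hgr : g p ∈ closedBall (0 : ℂ) R₀ := by
    rw [mem_closedBall_zero_iff]
    exact (hW.R0_large _ (hgΓ p hp)).le
  have key : ∀ (e : ℂ) (Λ' : ℝ), 0 ≤ Λ' → Λ' ≤ Λ → (∀ a ∈ closedBall (0 : ℂ) R₀,
      ∀ b ∈ closedBall (0 : ℂ) R₀, ‖pd e W a - pd e W b‖ ≤ Λ' * ‖a - b‖) →
      pd e W (u z) ^ 2 ≤ Λ ^ 2 * ‖u z - g p‖ ^ 2 := by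
    intro e Λ' h0 h1 h2
    have := h2 _ hur _ hgr
    rw [hW.pd_eq_zero (hgΓ p hp), sub_zero, Real.norm_eq_abs] at this
    rw [← mul_pow, ← sq_abs]
    exact pow_le_pow_left₀ (abs_nonneg _)
      (this.trans (mul_le_mul_of_nonneg_right h1 (norm_nonneg _))) 2
  have k1 := key 1 Λ₁ hΛ₁0 (by linarith) hΛ₁
  have k2 := key Complex.I Λ₂ hΛ₂0 (by linarith) hΛ₂
  have hgap : ‖u z - g p‖ ^ 2 ≤ 2 * gap u g z + 2 * C ^ 2 * ‖z - p‖ ^ 2 := by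
    have h1 : ‖u z - g p‖ ≤ ‖u z - g z‖ + C * ‖z - p‖ := by
      have := norm_add_le (u z - g z) (g z - g p)
      rw [sub_add_sub_cancel] at this
      exact this.trans (add_le_add_right (hC z (hM hzc) p (hM hpc)) _)
    rw [gap_eq]
    have := pow_le_pow_left₀ (norm_nonneg _) h1 2
    nlinarith [sq_nonneg (‖u z - g z‖ - C * ‖z - p‖)]
  have hzp : ‖z - p‖ ^ 2 ≤ 2 * sqDist ((1 + (ε : ℂ)) * p) z + 2 * M ^ 2 * ε ^ 2 := by
    have hpM : ‖p‖ ≤ M := mem_closedBall_zero_iff.1 (hM hpc)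
    have h1 : ‖z - p‖ ≤ ‖z - (1 + (ε : ℂ)) * p‖ + ε * M := by
      have := norm_add_le (z - (1 + (ε : ℂ)) * p) ((ε : ℂ) * p)
      rw [norm_mul, Complex.norm_real, Real.norm_of_nonneg hε.le,
        show z - (1 + (ε : ℂ)) * p + (ε : ℂ) * p = z - p by ring] at this
      exact this.trans (by gcongr)
    rw [sqDist_eq]
    have := pow_le_pow_left₀ (norm_nonneg _) h1 2
    nlinarith [sq_nonneg (‖z - (1 + (ε : ℂ)) * p‖ - ε * M)]
  have h2R : ‖u z - g p‖ ^ 2 ≤ (2 * R₀) ^ 2 := by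
    refine pow_le_pow_left₀ (norm_nonneg _) ((norm_sub_le _ _).trans ?_) 2
    rw [mem_closedBall_zero_iff] at hur hgr
    linarith
  have hE : ∀ a b : ℝ, ((ε ^ 2)⁻¹ * a - b) ^ 2 ≤ 2 * (ε ^ 4)⁻¹ * a ^ 2 + 2 * b ^ 2 := fun a b => by
    have : (ε ^ 4)⁻¹ = (ε ^ 2)⁻¹ ^ 2 := by rw [← inv_pow]; ring
    rw [this]
    nlinarith [sq_nonneg ((ε ^ 2)⁻¹ * a + b)]
  have g1 : lapR (fun z => (g z).re) z ^ 2 ≤ G₁ ^ 2 := by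
    rw [← sq_abs]
    exact pow_le_pow_left₀ (abs_nonneg _) (hG₁ z hzc) 2
  have g2 : lapR (fun z => (g z).im) z ^ 2 ≤ G₂ ^ 2 := by
    rw [← sq_abs]
    exact pow_le_pow_left₀ (abs_nonneg _) (hG₂ z hzc) 2
  have hi4 : 0 < (ε ^ 4)⁻¹ := by positivity
  have hi2 : 1 ≤ (ε ^ 2)⁻¹ := (one_le_inv₀ (by positivity)).2 (pow_le_one₀ hε.le hε1)
  have hi24 : (ε ^ 2)⁻¹ ≤ (ε ^ 4)⁻¹ := by
    have : (ε ^ 4)⁻¹ = (ε ^ 2)⁻¹ * (ε ^ 2)⁻¹ := by rw [← mul_inv]; ring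
    rw [this]
    nlinarith
  have main : lapSq u g z ≤ 4 * (ε ^ 4)⁻¹ * (Λ ^ 2 * ‖u z - g p‖ ^ 2) + 2 * G₁ ^ 2 + 2 * G₂ ^ 2 := by
    rw [lapSq, lapR_sub (smooth_re_comp hu.1) (smooth_re_comp hg),
      lapR_sub (smooth_im_comp hu.1) (smooth_im_comp hg), hu.lapR_re hz, hu.lapR_im hz]
    have e1 := hE (pd 1 W (u z)) (lapR (fun z => (g z).re) z)
    have e2 := hE (pd Complex.I W (u z)) (lapR (fun z => (g z).im) z)
    have := mul_le_mul_of_nonneg_left k1 hi4.le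
    have := mul_le_mul_of_nonneg_left k2 hi4.le
    linarith
  have hgap0 := gap_nonneg u g z
  have hs0 : 0 ≤ sqDist ((1 + (ε : ℂ)) * p) z := by rw [sqDist_eq]; positivity
  refine ⟨main.trans ?_, main.trans ?_⟩
  · have h1 := mul_le_mul_of_nonneg_left h2R (show 0 ≤ 4 * (ε ^ 4)⁻¹ * Λ ^ 2 by positivity)
    have h2 : 2 * G₁ ^ 2 + 2 * G₂ ^ 2 ≤ (2 * G₁ ^ 2 + 2 * G₂ ^ 2) * (ε ^ 4)⁻¹ :=
      le_mul_of_one_le_right (by positivity) (hi2.trans hi24)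
    have h3 : 0 ≤ (1 + 8 * Λ ^ 2 + 16 * Λ ^ 2 * C ^ 2 + 16 * Λ ^ 2 * C ^ 2 * M ^ 2) * (ε ^ 4)⁻¹ := by
      positivity
    linarith
  · set P := gap u g z
    set s := sqDist ((1 + (ε : ℂ)) * p) z
    have h0 : ‖u z - g p‖ ^ 2 ≤ 2 * P + 2 * C ^ 2 * (2 * s + 2 * M ^ 2 * ε ^ 2) :=
      hgap.trans (by gcongr)
    have h1 := mul_le_mul_of_nonneg_left h0 (show 0 ≤ 4 * (ε ^ 4)⁻¹ * Λ ^ 2 by positivity)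
    have h2 : 2 * G₁ ^ 2 + 2 * G₂ ^ 2 ≤ (2 * G₁ ^ 2 + 2 * G₂ ^ 2) * (ε ^ 2)⁻¹ :=
      le_mul_of_one_le_right (by positivity) hi2
    have e1 : (ε ^ 4)⁻¹ * ε ^ 2 = (ε ^ 2)⁻¹ := by field_simp
    have h3 : 4 * (ε ^ 4)⁻¹ * Λ ^ 2 * (2 * P + 2 * C ^ 2 * (2 * s + 2 * M ^ 2 * ε ^ 2)) =
        8 * Λ ^ 2 * ((ε ^ 4)⁻¹ * P) + 16 * Λ ^ 2 * C ^ 2 * ((ε ^ 4)⁻¹ * s) +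
          16 * Λ ^ 2 * C ^ 2 * M ^ 2 * (ε ^ 2)⁻¹ := by
      rw [← e1]
      ring
    have hP : 0 ≤ (ε ^ 4)⁻¹ * P := by positivity
    have hs : 0 ≤ (ε ^ 4)⁻¹ * s := by positivity
    have hi : 0 ≤ (ε ^ 2)⁻¹ := by positivity
    have t1 : 0 ≤ (1 + 4 * Λ ^ 2 * (2 * R₀) ^ 2 + 16 * Λ ^ 2 * C ^ 2 + 16 * Λ ^ 2 * C ^ 2 * M ^ 2
      + 2 * G₁ ^ 2 + 2 * G₂ ^ 2) * ((ε ^ 4)⁻¹ * P) := by positivity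
    have t2 : 0 ≤ (1 + 4 * Λ ^ 2 * (2 * R₀) ^ 2 + 8 * Λ ^ 2 + 16 * Λ ^ 2 * C ^ 2 * M ^ 2
      + 2 * G₁ ^ 2 + 2 * G₂ ^ 2) * ((ε ^ 4)⁻¹ * s) := by positivity
    have t3 : 0 ≤ (1 + 4 * Λ ^ 2 * (2 * R₀) ^ 2 + 8 * Λ ^ 2 + 16 * Λ ^ 2 * C ^ 2) * (ε ^ 2)⁻¹ := by
      positivity
    linarith

theorem integrable_inv_one_add_norm_pow : Integrable fun z : ℂ => ((1 + ‖z‖) ^ 4)⁻¹ := by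
  have h := integrable_one_add_norm (μ := (volume : Measure ℂ)) (r := 4)
    (by rw [Complex.finrank_real_complex]; norm_num)
  refine h.congr (Eventually.of_forall fun z => ?_)
  simp only
  rw [Real.rpow_neg (by positivity), show (4 : ℝ) = (4 : ℕ) by norm_num, Real.rpow_natCast]

theorem integral_inv_scaled (q : ℂ) {ε : ℝ} (hε : 0 < ε) :
    ∫ z : ℂ, ((1 + ‖ε⁻¹ • (z - q)‖) ^ 4)⁻¹ = ε ^ 2 * ∫ z : ℂ, ((1 + ‖z‖) ^ 4)⁻¹ := by
  rw [integral_sub_right_eq_self (fun z : ℂ => ((1 + ‖ε⁻¹ • z‖) ^ 4)⁻¹) q,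
    Measure.integral_comp_inv_smul volume (fun z : ℂ => ((1 + ‖z‖) ^ 4)⁻¹),
    Complex.finrank_real_complex, abs_of_nonneg (by positivity), smul_eq_mul]

theorem integrable_inv_scaled (q : ℂ) {ε : ℝ} (hε : 0 < ε) :
    Integrable fun z : ℂ => ((1 + ‖ε⁻¹ • (z - q)‖) ^ 4)⁻¹ :=
  (integrable_inv_one_add_norm_pow.comp_smul (inv_ne_zero hε.ne')).comp_sub_right q

namespace StarDomain

variable {Ω : Set ℂ} {γ : ℝ → ℂ} {L c σ : ℝ}

theorem sqDist_ge (S : StarDomain Ω γ L c σ) {ε : ℝ} (hε : 0 < ε) {p : ℂ} (hp : p ∈ frontier Ω)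
    {z : ℂ} (hz : z ∈ closure Ω) : (c * ε) ^ 2 ≤ sqDist ((1 + (ε : ℂ)) * p) z := by
  rw [sqDist_eq]
  have := S.cpos
  exact pow_le_pow_left₀ (by positivity) (S.exterior_dist hp hε hz) 2

theorem integrableOn_of_continuousOn (S : StarDomain Ω γ L c σ) {f : ℂ → ℝ}
    (hf : ContinuousOn f (closure Ω)) : IntegrableOn f Ω :=
  (hf.integrableOn_compact S.isCompact_closure).mono_set subset_closure

theorem continuousOn_sqDist_inv_pow (S : StarDomain Ω γ L c σ) {ε : ℝ} (hε : 0 < ε) {p : ℂ}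
    (hp : p ∈ frontier Ω) (n : ℕ) :
    ContinuousOn (fun z => (sqDist ((1 + (ε : ℂ)) * p) z ^ n)⁻¹) (closure Ω) := by
  refine ((smooth_sqDist _).continuous.pow n).continuousOn.inv₀ fun z hz => ?_
  have := S.sqDist_ge hε hp hz
  have hc := S.cpos
  have : 0 < (c * ε) ^ 2 := by positivity
  exact pow_ne_zero _ (by linarith)

theorem continuousOn_exp_div_sqDist (S : StarDomain Ω γ L c σ) {ε : ℝ} (hε : 0 < ε) {p : ℂ}
    (hp : p ∈ frontier Ω) (τ : ℝ) :
    ContinuousOn (fun z => Real.exp (τ / sqDist ((1 + (ε : ℂ)) * p) z)) (closure Ω) := by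
  have := S.continuousOn_sqDist_inv_pow hε hp 1
  simp only [pow_one] at this
  simp only [div_eq_mul_inv]
  exact Real.continuous_exp.comp_continuousOn (continuousOn_const.mul this)

theorem exists_integral_inv_sq_le (S : StarDomain Ω γ L c σ) :
    ∃ J, 0 ≤ J ∧ ∀ ε : ℝ, 0 < ε → ∀ p ∈ frontier Ω,
      ∫ z in Ω, (sqDist ((1 + (ε : ℂ)) * p) z ^ 2)⁻¹ ≤ J * (ε ^ 2)⁻¹ := by
  have hc := S.cpos
  set I := ∫ z : ℂ, ((1 + ‖z‖) ^ 4)⁻¹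
  have hI : 0 ≤ I := integral_nonneg fun z => by positivity
  refine ⟨((1 + c) / c) ^ 4 * I, by positivity, fun ε hε p hp => ?_⟩
  set q := (1 + (ε : ℂ)) * p with hq
  have hint := (integrable_inv_scaled q hε).const_mul (((1 + c) / c) ^ 4 * (ε ^ 4)⁻¹)
  calc ∫ z in Ω, (sqDist q z ^ 2)⁻¹
      ≤ ∫ z in Ω, ((1 + c) / c) ^ 4 * (ε ^ 4)⁻¹ * ((1 + ‖ε⁻¹ • (z - q)‖) ^ 4)⁻¹ := by
        refine setIntegral_mono_on
          (S.integrableOn_of_continuousOn (S.continuousOn_sqDist_inv_pow hε hp 2))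
          hint.integrableOn S.isOpen.measurableSet fun z hz => ?_
        have h := S.exterior_dist hp hε (subset_closure hz)
        rw [← hq] at h
        have hpos : 0 < ‖z - q‖ := lt_of_lt_of_le (by positivity) h
        rw [norm_smul, norm_inv, Real.norm_of_nonneg hε.le, sqDist_eq]
        rw [show ((1 + c) / c) ^ 4 * (ε ^ 4)⁻¹ * ((1 + ε⁻¹ * ‖z - q‖) ^ 4)⁻¹ =
          ((c / (1 + c) * (ε + ‖z - q‖)) ^ 4)⁻¹ by field_simp]
        rw [← pow_mul]
        refine inv_anti₀ (by positivity) (pow_le_pow_left₀ (by positivity) ?_ 4)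
        rw [div_mul_eq_mul_div, div_le_iff₀ (by positivity)]
        linarith
    _ ≤ ∫ z, ((1 + c) / c) ^ 4 * (ε ^ 4)⁻¹ * ((1 + ‖ε⁻¹ • (z - q)‖) ^ 4)⁻¹ :=
        setIntegral_le_integral hint (Eventually.of_forall fun z => by
          simp only [Pi.zero_apply]; positivity)
    _ = ((1 + c) / c) ^ 4 * I * (ε ^ 2)⁻¹ := by
        rw [integral_const_mul, integral_inv_scaled q hε]
        have : (ε ^ 2)⁻¹ = (ε ^ 4)⁻¹ * ε ^ 2 := by field_simp
        rw [this]
        ring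

theorem exists_curvature_bound (S : StarDomain Ω γ L c σ) :
    ∃ κ, ∀ s, ‖deriv (deriv γ) s‖ ≤ κ := by
  have hcont : Continuous (deriv (deriv γ)) := S.contDiff_deriv.continuous_deriv (by simp)
  have hper : Function.Periodic (deriv (deriv γ)) L := fun s => by
    have h : (fun t => deriv γ (t + L)) = deriv γ := funext S.periodic_deriv
    rw [← deriv_comp_add_const, h]
  obtain ⟨κ, hκ⟩ := isCompact_Icc.exists_bound_of_continuousOn (s := Set.Icc (0 : ℝ) L)
    hcont.continuousOn
  refine ⟨κ, fun s => ?_⟩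
  obtain ⟨t, ht, hst⟩ := hper.exists_mem_Ico₀ S.param.Lpos s
  rw [hst]
  exact hκ t ⟨ht.1, ht.2.le⟩

end StarDomain

theorem absorb_pointwise {A c ρ lam ε s D P : ℝ} (hA : 0 < A) (hc : 0 < c) (hρ : 0 < ρ)
    (hl : 0 < lam) (hε : 0 < ε) (hs : (c * ε) ^ 2 ≤ s) (hP : 0 ≤ P)
    (hAl : A * ρ ^ 8 ≤ 8 * lam ^ 2) (hD1 : D ≤ A * (ε ^ 4)⁻¹)
    (hD2 : D ≤ A * ((ε ^ 4)⁻¹ * (P + s) + (ε ^ 2)⁻¹)) :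
    Real.exp (lam * ε ^ 2 / s) * (s ^ 2)⁻¹ * D ≤
      8 * (lam * ε ^ 2) ^ 2 * (Real.exp (lam * ε ^ 2 / s) * (s ^ 6)⁻¹ * P) +
      (A * (ρ ^ 2 + 1) * Real.exp (lam / c ^ 2) * (ε ^ 2)⁻¹ +
        A * Real.exp (lam / ρ ^ 2) * (ε ^ 4)⁻¹) * (s ^ 2)⁻¹ := by
  have hs0 : 0 < s := lt_of_lt_of_le (by positivity) hs
  set E := Real.exp (lam * ε ^ 2 / s) with hE
  have hE0 : 0 < E := Real.exp_pos _
  have hEc : E ≤ Real.exp (lam / c ^ 2) := by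
    rw [hE, Real.exp_le_exp, div_le_div_iff₀ hs0 (by positivity)]
    nlinarith
  rcases le_total s (ρ ^ 2 * ε ^ 2) with h | h
  · have h1 : D ≤ A * (ε ^ 4)⁻¹ * P + A * (ρ ^ 2 + 1) * (ε ^ 2)⁻¹ := by
      have : (ε ^ 4)⁻¹ * s ≤ ρ ^ 2 * (ε ^ 2)⁻¹ := by
        rw [inv_mul_le_iff₀ (by positivity)]
        refine h.trans (le_of_eq ?_)
        field_simp
      nlinarith
    have h2 : A * (ε ^ 4)⁻¹ * (s ^ 2)⁻¹ ≤ 8 * (lam * ε ^ 2) ^ 2 * (s ^ 6)⁻¹ := by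
      have e : 8 * (lam * ε ^ 2) ^ 2 * (s ^ 6)⁻¹ - A * (ε ^ 4)⁻¹ * (s ^ 2)⁻¹ =
          (8 * lam ^ 2 * ε ^ 8 - A * s ^ 4) * ((ε ^ 4)⁻¹ * (s ^ 6)⁻¹) := by
        field_simp
      have h3 : A * s ^ 4 ≤ 8 * lam ^ 2 * ε ^ 8 := by
        calc A * s ^ 4 ≤ A * (ρ ^ 2 * ε ^ 2) ^ 4 := by gcongr
          _ = A * ρ ^ 8 * ε ^ 8 := by ring
          _ ≤ _ := by gcongr
      have : 0 ≤ (8 * lam ^ 2 * ε ^ 8 - A * s ^ 4) * ((ε ^ 4)⁻¹ * (s ^ 6)⁻¹) :=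
        mul_nonneg (by linarith) (by positivity)
      linarith
    calc E * (s ^ 2)⁻¹ * D
        ≤ E * (s ^ 2)⁻¹ * (A * (ε ^ 4)⁻¹ * P + A * (ρ ^ 2 + 1) * (ε ^ 2)⁻¹) := by gcongr
      _ = E * P * (A * (ε ^ 4)⁻¹ * (s ^ 2)⁻¹) + A * (ρ ^ 2 + 1) * E * (ε ^ 2)⁻¹ * (s ^ 2)⁻¹ := by
          ring
      _ ≤ E * P * (8 * (lam * ε ^ 2) ^ 2 * (s ^ 6)⁻¹) +
          A * (ρ ^ 2 + 1) * Real.exp (lam / c ^ 2) * (ε ^ 2)⁻¹ * (s ^ 2)⁻¹ := by gcongr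
      _ ≤ _ := by
          have : 0 ≤ A * Real.exp (lam / ρ ^ 2) * (ε ^ 4)⁻¹ * (s ^ 2)⁻¹ := by positivity
          linarith
  · have hEr : E ≤ Real.exp (lam / ρ ^ 2) := by
      rw [hE, Real.exp_le_exp, div_le_div_iff₀ hs0 (by positivity)]
      nlinarith
    calc E * (s ^ 2)⁻¹ * D ≤ Real.exp (lam / ρ ^ 2) * (s ^ 2)⁻¹ * (A * (ε ^ 4)⁻¹) := by
          refine (mul_le_mul_of_nonneg_left hD1 (by positivity)).trans ?_
          gcongr
      _ ≤ _ := by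
          have h1 : 0 ≤ 8 * (lam * ε ^ 2) ^ 2 * (E * (s ^ 6)⁻¹ * P) := by positivity
          have h2 : 0 ≤ A * (ρ ^ 2 + 1) * Real.exp (lam / c ^ 2) * (ε ^ 2)⁻¹ * (s ^ 2)⁻¹ := by
            positivity
          linarith

theorem continuous_gap {u g : ℂ → ℂ} (hu : Continuous u) (hg : Continuous g) :
    Continuous (gap u g) := by
  unfold gap
  fun_prop

theorem StarDomain.carleman_absorbed {Ω : Set ℂ} {γ : ℝ → ℂ} {L c σ : ℝ}
    (S : StarDomain Ω γ L c σ) {κ A C J ρ lam ε : ℝ} {p : ℂ} {u g : ℂ → ℂ}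
    (hκ : ∀ s, ‖deriv (deriv γ) s‖ ≤ κ) (hA : 0 < A) (hρ : 0 < ρ) (hl : 0 < lam) (hε : 0 < ε)
    (hp : p ∈ frontier Ω) (hu : ContDiff ℝ (⊤ : ℕ∞) u) (hg : ContDiff ℝ (⊤ : ℕ∞) g)
    (hug : ∀ z ∈ frontier Ω, u z = g z)
    (hA1 : ∀ z ∈ Ω, lapSq u g z ≤ A * (ε ^ 4)⁻¹)
    (hA2 : ∀ z ∈ Ω, lapSq u g z ≤
      A * ((ε ^ 4)⁻¹ * (gap u g z + sqDist ((1 + (ε : ℂ)) * p) z) + (ε ^ 2)⁻¹))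
    (hC1 : ∫ s in (0 : ℝ)..L, gsq (fun z => (u z).re - (g z).re) (γ s) ≤ C)
    (hC2 : ∫ s in (0 : ℝ)..L, gsq (fun z => (u z).im - (g z).im) (γ s) ≤ C)
    (hJ : ∫ z in Ω, (sqDist ((1 + (ε : ℂ)) * p) z ^ 2)⁻¹ ≤ J * (ε ^ 2)⁻¹)
    (hAl : A * ρ ^ 8 ≤ 8 * lam ^ 2) :
    8 * (lam * ε ^ 2) ^ 2 * (Real.exp (lam / ρ ^ 2) * (ρ ^ 12 * ε ^ 12)⁻¹) *
        ∫ z in Ω ∩ closedBall ((1 + (ε : ℂ)) * p) (ρ * ε), gap u g z ≤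
      (A * (ρ ^ 2 + 1) * Real.exp (lam / c ^ 2) * (ε ^ 2)⁻¹ +
        A * Real.exp (lam / ρ ^ 2) * (ε ^ 4)⁻¹) * (J * (ε ^ 2)⁻¹) +
      2 * ((2 * κ + 2 * (lam * ε ^ 2 / (c * ε) ^ 3 + 2 / (c * ε))) *
        (Real.exp (lam * ε ^ 2 / (c * ε) ^ 2) * ((c * ε) ^ 4)⁻¹) * C) := by
  have hc := S.cpos
  have hκ0 : 0 ≤ κ := (norm_nonneg _).trans (hκ 0)
  have hms := S.isOpen.measurableSet
  set q := (1 + (ε : ℂ)) * p with hq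
  set τ := lam * ε ^ 2 with hτ
  have hτ0 : 0 < τ := by positivity
  set B := (2 * κ + 2 * (τ / (c * ε) ^ 3 + 2 / (c * ε))) *
        (Real.exp (τ / (c * ε) ^ 2) * ((c * ε) ^ 4)⁻¹) with hB
  have hB0 : 0 ≤ B := by positivity
  have hqd : ∀ z ∈ closure Ω, (c * ε) ^ 2 ≤ sqDist q z := fun z hz => S.sqDist_ge hε hp hz
  have hw1 : Smooth fun z => (u z).re - (g z).re := (smooth_re_comp hu).sub (smooth_re_comp hg)
  have hw2 : Smooth fun z => (u z).im - (g z).im := (smooth_im_comp hu).sub (smooth_im_comp hg)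
  have c1 := S.carleman hκ hw1 (fun z hz => by simp [hug z hz]) (by positivity) hτ0 hqd
  have c2 := S.carleman hκ hw2 (fun z hz => by simp [hug z hz]) (by positivity) hτ0 hqd
  have hEn : ∀ n, ContinuousOn (fun z => Real.exp (τ / sqDist q z) * (sqDist q z ^ n)⁻¹)
      (closure Ω) := fun n => (S.continuousOn_exp_div_sqDist hε hp τ).mul
    (S.continuousOn_sqDist_inv_pow hε hp n)
  have i6 : ∀ f : ℂ → ℝ, Continuous f →
      IntegrableOn (fun z => Real.exp (τ / sqDist q z) * (sqDist q z ^ 6)⁻¹ * f z) Ω :=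
    fun f hf => S.integrableOn_of_continuousOn ((hEn 6).mul hf.continuousOn)
  have i2 : ∀ f : ℂ → ℝ, Continuous f →
      IntegrableOn (fun z => Real.exp (τ / sqDist q z) * (sqDist q z ^ 2)⁻¹ * f z) Ω :=
    fun f hf => S.integrableOn_of_continuousOn ((hEn 2).mul hf.continuousOn)
  have hgapc := continuous_gap hu.continuous hg.continuous
  have hgc1 : Continuous fun z => ((u z).re - (g z).re) ^ 2 := hw1.continuous.pow 2
  have hgc2 : Continuous fun z => ((u z).im - (g z).im) ^ 2 := hw2.continuous.pow 2
  have hlc1 : Continuous fun z => lapR (fun z => (u z).re - (g z).re) z ^ 2 :=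
    (smooth_lapR hw1).continuous.pow 2
  have hlc2 : Continuous fun z => lapR (fun z => (u z).im - (g z).im) z ^ 2 :=
    (smooth_lapR hw2).continuous.pow 2
  have e6 : ∫ z in Ω, Real.exp (τ / sqDist q z) * (sqDist q z ^ 6)⁻¹ * gap u g z =
      (∫ z in Ω, Real.exp (τ / sqDist q z) * (sqDist q z ^ 6)⁻¹ * ((u z).re - (g z).re) ^ 2) +
      ∫ z in Ω, Real.exp (τ / sqDist q z) * (sqDist q z ^ 6)⁻¹ * ((u z).im - (g z).im) ^ 2 := by
    rw [← integral_add (i6 _ hgc1) (i6 _ hgc2)]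
    simp only [gap, mul_add]
  have e2 : ∫ z in Ω, Real.exp (τ / sqDist q z) * (sqDist q z ^ 2)⁻¹ * lapSq u g z =
      (∫ z in Ω, Real.exp (τ / sqDist q z) * (sqDist q z ^ 2)⁻¹ *
        lapR (fun z => (u z).re - (g z).re) z ^ 2) +
      ∫ z in Ω, Real.exp (τ / sqDist q z) * (sqDist q z ^ 2)⁻¹ *
        lapR (fun z => (u z).im - (g z).im) z ^ 2 := by
    rw [← integral_add (i2 _ hlc1) (i2 _ hlc2)]
    simp only [lapSq, mul_add]
  set K := A * (ρ ^ 2 + 1) * Real.exp (lam / c ^ 2) * (ε ^ 2)⁻¹ +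
        A * Real.exp (lam / ρ ^ 2) * (ε ^ 4)⁻¹ with hK
  have hK0 : 0 ≤ K := by positivity
  have ij : IntegrableOn (fun z => (sqDist q z ^ 2)⁻¹) Ω :=
    S.integrableOn_of_continuousOn (S.continuousOn_sqDist_inv_pow hε hp 2)
  have habs : ∫ z in Ω, Real.exp (τ / sqDist q z) * (sqDist q z ^ 2)⁻¹ * lapSq u g z ≤
      8 * τ ^ 2 * (∫ z in Ω, Real.exp (τ / sqDist q z) * (sqDist q z ^ 6)⁻¹ * gap u g z) +
        K * ∫ z in Ω, (sqDist q z ^ 2)⁻¹ := by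
    rw [← integral_const_mul, ← integral_const_mul,
      ← integral_add ((i6 _ hgapc).const_mul _) (ij.const_mul _)]
    refine setIntegral_mono_on (i2 _ (hlc1.add hlc2))
      (((i6 _ hgapc).const_mul _).add (ij.const_mul _)) hms fun z hz => ?_
    exact absorb_pointwise hA hc hρ hl hε (hqd z (subset_closure hz)) (gap_nonneg u g z) hAl
      (hA1 z hz) (hA2 z hz)
  have hlow : Real.exp (lam / ρ ^ 2) * (ρ ^ 12 * ε ^ 12)⁻¹ *
      (∫ z in Ω ∩ closedBall q (ρ * ε), gap u g z) ≤
      ∫ z in Ω, Real.exp (τ / sqDist q z) * (sqDist q z ^ 6)⁻¹ * gap u g z := by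
    rw [← integral_const_mul]
    refine le_trans (setIntegral_mono_on
      (((S.integrableOn hgapc).mono_set inter_subset_left).const_mul _)
      ((i6 _ hgapc).mono_set inter_subset_left) (hms.inter measurableSet_closedBall)
      fun z hz => ?_) (setIntegral_mono_set (i6 _ hgapc) ?_ inter_subset_left.eventuallyLE)
    · have h1 := hqd z (subset_closure hz.1)
      have hs0 : 0 < sqDist q z := lt_of_lt_of_le (by positivity) h1
      have h2 : sqDist q z ≤ ρ ^ 2 * ε ^ 2 := by
        rw [sqDist_eq, ← mul_pow]
        have := mem_closedBall.1 hz.2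
        rw [dist_eq_norm] at this
        exact pow_le_pow_left₀ (norm_nonneg _) this 2
      have h3 : lam / ρ ^ 2 ≤ τ / sqDist q z := by
        rw [div_le_div_iff₀ (by positivity) hs0, hτ]
        nlinarith
      have h4 : (ρ ^ 12 * ε ^ 12)⁻¹ ≤ (sqDist q z ^ 6)⁻¹ := by
        refine inv_anti₀ (by positivity) ?_
        calc sqDist q z ^ 6 ≤ (ρ ^ 2 * ε ^ 2) ^ 6 := by gcongr
          _ = _ := by ring
      have := gap_nonneg u g z
      gcongr
    · filter_upwards [ae_restrict_mem hms] with z hz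
      have hs0 : 0 < sqDist q z := lt_of_lt_of_le (by positivity) (hqd z (subset_closure hz))
      have := gap_nonneg u g z
      simp only [Pi.zero_apply]
      positivity
  have hb1 := mul_le_mul_of_nonneg_left hC1 hB0
  have hb2 := mul_le_mul_of_nonneg_left hC2 hB0
  have hj := mul_le_mul_of_nonneg_left hJ hK0
  have hl' := mul_le_mul_of_nonneg_left hlow (show 0 ≤ 8 * τ ^ 2 by positivity)
  rw [e2, e6] at habs
  rw [e6] at hl'
  linarith

theorem StarDomain.exists_small_mass {Ω : Set ℂ} {γ : ℝ → ℂ} {L c σ : ℝ}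
    (S : StarDomain Ω γ L c σ) {Γ : Set ℂ} {W : ℂ → ℝ} {R₀ : ℝ} {g : ℂ → ℂ}
    (hW : PotentialHyp Γ W R₀) (hR : 0 ≤ R₀) (hg : ContDiff ℝ (⊤ : ℕ∞) g)
    (hgΓ : ∀ z ∈ frontier Ω, g z ∈ Γ) {ρ η : ℝ} (hρ : 0 < ρ) (hη : 0 < η) :
    ∃ ε₀, 0 < ε₀ ∧ ∀ (ε : ℝ) (u : ℂ → ℂ), 0 < ε → ε < ε₀ → SolvesGL W Ω ε u →
      (∀ z ∈ frontier Ω, u z = g z) → ∀ p ∈ frontier Ω,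
      ∫ z in Ω ∩ closedBall ((1 + (ε : ℂ)) * p) (ρ * ε), gap u g z ≤ η * ε ^ 2 := by
  have hc := S.cpos
  obtain ⟨κ, hκ⟩ := S.exists_curvature_bound
  have hκ0 : 0 ≤ κ := (norm_nonneg _).trans (hκ 0)
  obtain ⟨A, hA, hAb⟩ := exists_lapSq_bound S.isOpen S.bounded hW hR hg hgΓ
  obtain ⟨C, hC0, hC⟩ := S.exists_boundary_bound hW hg hgΓ
  obtain ⟨J, hJ0, hJ⟩ := S.exists_integral_inv_sq_le
  set lam : ℝ := 1 + A * ρ ^ 8 + ρ ^ 12 * (A * J + 1) / η with hlam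
  have hl1 : 1 ≤ lam := by
    have : 0 ≤ A * ρ ^ 8 + ρ ^ 12 * (A * J + 1) / η := by positivity
    linarith
  have hl0 : 0 < lam := by linarith
  have hlsq : lam ≤ lam ^ 2 := by nlinarith
  have hAl : A * ρ ^ 8 ≤ 8 * lam ^ 2 := by
    have : 0 ≤ ρ ^ 12 * (A * J + 1) / η := by positivity
    nlinarith
  have hηl : A * J + 1 ≤ 8 * lam ^ 2 * (ρ ^ 12)⁻¹ * η := by
    have h1 : ρ ^ 12 * (A * J + 1) / η ≤ 8 * lam ^ 2 := by
      have : 0 ≤ A * ρ ^ 8 := by positivity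
      nlinarith
    rw [div_le_iff₀ hη] at h1
    rw [show 8 * lam ^ 2 * (ρ ^ 12)⁻¹ * η = (ρ ^ 12)⁻¹ * (8 * lam ^ 2 * η) by ring,
      le_inv_mul_iff₀ (by positivity)]
    exact h1
  set er := Real.exp (lam / ρ ^ 2) with her
  have her1 : 1 ≤ er := Real.one_le_exp (by positivity)
  set ec := Real.exp (lam / c ^ 2) with hec
  have hec0 : 0 < ec := Real.exp_pos _
  set B₁ := (2 * κ + 2 * (lam / c ^ 3 + 2 / c)) * (ec * (c ^ 4)⁻¹) with hB₁
  have hB0 : 0 ≤ B₁ := by positivity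
  set Q := A * (ρ ^ 2 + 1) * ec * J + 2 * (B₁ * C) with hQ
  have hQ0 : 0 ≤ Q := by positivity
  refine ⟨min 1 (1 / (Q + 1)), lt_min one_pos (by positivity), fun ε u hε hε0 hu hug p hp => ?_⟩
  have hε1 : ε ≤ 1 := (hε0.le).trans (min_le_left _ _)
  have hεQ : ε * Q ≤ 1 := by
    have := hε0.le.trans (min_le_right _ _)
    rw [le_div_iff₀ (by positivity)] at this
    nlinarith
  have h := S.carleman_absorbed hκ hA hρ hl0 hε hp hu.1 hg hug
    (fun z hz => (hAb ε u hε hε1 hu hug p hp z hz).1)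
    (fun z hz => (hAb ε u hε hε1 hu hug p hp z hz).2) (hC ε u hu hug).1 (hC ε u hu hug).2
    (hJ ε hε p hp) hAl
  set X := ∫ z in Ω ∩ closedBall ((1 + (ε : ℂ)) * p) (ρ * ε), gap u g z
  have hB : (2 * κ + 2 * (lam * ε ^ 2 / (c * ε) ^ 3 + 2 / (c * ε))) *
        (Real.exp (lam * ε ^ 2 / (c * ε) ^ 2) * ((c * ε) ^ 4)⁻¹) ≤ B₁ * (ε ^ 5)⁻¹ := by
    have e1 : lam * ε ^ 2 / (c * ε) ^ 2 = lam / c ^ 2 := by field_simp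
    have e2 : 2 * (lam * ε ^ 2 / (c * ε) ^ 3 + 2 / (c * ε)) = 2 * (lam / c ^ 3 + 2 / c) * ε⁻¹ := by
      field_simp
    have e3 : 2 * κ ≤ 2 * κ * ε⁻¹ :=
      le_mul_of_one_le_right (by positivity) ((one_le_inv₀ hε).2 hε1)
    rw [e1, e2]
    calc _ ≤ (2 * κ * ε⁻¹ + 2 * (lam / c ^ 3 + 2 / c) * ε⁻¹) * (ec * ((c * ε) ^ 4)⁻¹) := by gcongr
      _ = B₁ * (ε ^ 5)⁻¹ := by
        rw [hB₁, mul_pow, mul_inv, show (ε ^ 5)⁻¹ = ε⁻¹ * (ε ^ 4)⁻¹ by rw [← mul_inv]; ring]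
        ring
  have h2 : 8 * (lam * ε ^ 2) ^ 2 * (er * (ρ ^ 12 * ε ^ 12)⁻¹) * X ≤
      (A * (ρ ^ 2 + 1) * ec * (ε ^ 2)⁻¹ + A * er * (ε ^ 4)⁻¹) * (J * (ε ^ 2)⁻¹) +
        2 * (B₁ * (ε ^ 5)⁻¹ * C) := by
    refine h.trans ?_
    gcongr
  have h3 := mul_le_mul_of_nonneg_right h2 (show 0 ≤ ε ^ 8 by positivity)
  have l3 : 8 * (lam * ε ^ 2) ^ 2 * (er * (ρ ^ 12 * ε ^ 12)⁻¹) * X * ε ^ 8 =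
      8 * lam ^ 2 * (ρ ^ 12)⁻¹ * er * X := by field_simp
  have r3 : ((A * (ρ ^ 2 + 1) * ec * (ε ^ 2)⁻¹ + A * er * (ε ^ 4)⁻¹) * (J * (ε ^ 2)⁻¹) +
        2 * (B₁ * (ε ^ 5)⁻¹ * C)) * ε ^ 8 =
      ε ^ 2 * (A * er * J + ε * (ε * (A * (ρ ^ 2 + 1) * ec * J) + 2 * (B₁ * C))) := by
    field_simp
    ring
  rw [l3, r3] at h3
  have h4 : ε * (A * (ρ ^ 2 + 1) * ec * J) + 2 * (B₁ * C) ≤ Q := by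
    have : ε * (A * (ρ ^ 2 + 1) * ec * J) ≤ A * (ρ ^ 2 + 1) * ec * J :=
      mul_le_of_le_one_left (by positivity) hε1
    linarith
  have h5 : A * er * J + ε * (ε * (A * (ρ ^ 2 + 1) * ec * J) + 2 * (B₁ * C)) ≤
      8 * lam ^ 2 * (ρ ^ 12)⁻¹ * er * η := by
    have h6 := mul_le_mul_of_nonneg_left h4 hε.le
    have h7 := mul_le_mul_of_nonneg_left hηl (zero_le_one.trans her1)
    linarith
  have h6 := mul_le_mul_of_nonneg_left h5 (show 0 ≤ ε ^ 2 by positivity)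
  have ha : 0 < 8 * lam ^ 2 * (ρ ^ 12)⁻¹ * er := by positivity
  refine le_of_mul_le_mul_left ?_ ha
  linarith

theorem sqDist_nonneg (q z : ℂ) : 0 ≤ sqDist q z := by
  rw [sqDist_eq]
  positivity

/-- A potential whose Laplacian is an approximate identity concentrated at `x` at scale `√a`. -/
def corePot (a : ℝ) (x z : ℂ) : ℝ := Real.log (sqDist x z + a) - a / (sqDist x z + a)

theorem corePot_spec {a : ℝ} (ha : 0 < a) (x : ℂ) : Smooth (corePot a x) ∧
    ∀ z, lapR (corePot a x) z = 8 * a ^ 2 / (sqDist x z + a) ^ 3 := by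
  obtain ⟨F, hF, hFt⟩ := exists_weight (-a) (-1) (half_pos ha)
  have hs : Smooth fun z => sqDist x z + a := (smooth_sqDist x).add contDiff_const
  have hpos : ∀ z, a / 2 < sqDist x z + a := fun z => by
    have := sqDist_nonneg x z
    linarith
  have heq : corePot a x = fun z => F (sqDist x z + a) := funext fun z => by
    rw [(hFt _ (hpos z)).1, corePot]
    ring
  have hpd : ∀ e, pd e (fun z => sqDist x z + a) = pd e (sqDist x) := fun e => by
    rw [pd_add (smooth_sqDist x) contDiff_const, pd_const]
    simp
  refine ⟨heq ▸ hF.comp hs, fun z => ?_⟩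
  have hg : gsq (fun z => sqDist x z + a) z = 4 * sqDist x z := by
    rw [← gsq_sqDist, gsq, gsq, hpd, hpd]
  have hl : lapR (fun z => sqDist x z + a) z = 4 := by
    rw [← lapR_sqDist x z, lapR_eq_pd, lapR_eq_pd, hpd, hpd]
  rw [heq, lapR_comp hF hs, hg, hl, (hFt _ (hpos z)).2.1, (hFt _ (hpos z)).2.2]
  have : sqDist x z + a ≠ 0 := by
    have := hpos z
    linarith
  field_simp
  ring

theorem corePot_sub_bounds {a : ℝ} (ha : 0 < a) (x z : ℂ) :
    0 ≤ corePot (2 * a) x z - corePot a x z ∧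
      corePot (2 * a) x z - corePot a x z ≤ 2 * (a ^ 2 / (sqDist x z + a) ^ 2) := by
  have hs := sqDist_nonneg x z
  simp only [corePot]
  set s := sqDist x z
  have h1 : 0 < s + a := by linarith
  have h2 : 0 < s + 2 * a := by linarith
  have hlog : Real.log (s + 2 * a) - Real.log (s + a) = Real.log ((s + 2 * a) / (s + a)) :=
    (Real.log_div h2.ne' h1.ne').symm
  have hup := Real.log_le_sub_one_of_pos (div_pos h2 h1)
  have hlo := Real.one_sub_inv_le_log_of_pos (div_pos h2 h1)
  have e1 : (s + 2 * a) / (s + a) - 1 = a / (s + a) := by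
    field_simp
    ring
  have e2 : 1 - ((s + 2 * a) / (s + a))⁻¹ = a / (s + 2 * a) := by
    field_simp
    ring
  rw [e1] at hup
  rw [e2] at hlo
  have e3 : 2 * a / (s + 2 * a) = 2 * (a / (s + 2 * a)) := by ring
  have e4 : a / (s + 2 * a) ≤ a / (s + a) := by gcongr; linarith
  have e5 : a / (s + a) - a / (s + 2 * a) ≤ a ^ 2 / (s + a) ^ 2 := by
    rw [div_sub_div _ _ h1.ne' h2.ne', div_le_div_iff₀ (by positivity) (by positivity)]
    have : 0 ≤ a ^ 2 * (s + a) * a := by positivity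
    nlinarith
  constructor <;> linarith

theorem sq_div_le_scaled {b : ℝ} (hb : 0 < b) (x z : ℂ) :
    (b ^ 2) ^ 2 / (sqDist x z + b ^ 2) ^ 2 ≤ 4 * ((1 + ‖b⁻¹ • (z - x)‖) ^ 4)⁻¹ := by
  rw [norm_smul, norm_inv, Real.norm_of_nonneg hb.le, sqDist_eq]
  set n := ‖z - x‖
  have hn : 0 ≤ n := norm_nonneg _
  have e : 4 * ((1 + b⁻¹ * n) ^ 4)⁻¹ = (b ^ 2) ^ 2 / ((b + n) ^ 2 / 2) ^ 2 := by
    have : 1 + b⁻¹ * n = (b + n) / b := by field_simp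
    rw [this]
    field_simp
    norm_num
  rw [e]
  gcongr
  nlinarith [sq_nonneg (b - n)]

theorem integrable_sq_div {a : ℝ} (ha : 0 < a) (x : ℂ) :
    Integrable (fun z => a ^ 2 / (sqDist x z + a) ^ 2) ∧
    ∫ z, a ^ 2 / (sqDist x z + a) ^ 2 ≤ 4 * a * ∫ z : ℂ, ((1 + ‖z‖) ^ 4)⁻¹ := by
  obtain ⟨b, hb, rfl⟩ : ∃ b : ℝ, 0 < b ∧ b ^ 2 = a :=
    ⟨Real.sqrt a, Real.sqrt_pos.2 ha, Real.sq_sqrt ha.le⟩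
  have hint := (integrable_inv_scaled x hb).const_mul 4
  have hcont : Continuous fun z => (b ^ 2) ^ 2 / (sqDist x z + b ^ 2) ^ 2 :=
    continuous_const.div (((smooth_sqDist x).continuous.add continuous_const).pow 2) fun z => by
      have := sqDist_nonneg x z
      positivity
  have hi : Integrable fun z => (b ^ 2) ^ 2 / (sqDist x z + b ^ 2) ^ 2 := by
    refine hint.mono' hcont.aestronglyMeasurable (Eventually.of_forall fun z => ?_)
    rw [Real.norm_of_nonneg (by positivity)]
    exact sq_div_le_scaled hb x z
  refine ⟨hi, (integral_mono hi hint fun z => sq_div_le_scaled hb x z).trans (le_of_eq ?_)⟩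
  rw [integral_const_mul, integral_inv_scaled x hb]
  ring

namespace StarDomain

variable {Ω : Set ℂ} {γ : ℝ → ℂ} {L c σ : ℝ}

theorem integral_mul_lapR (S : StarDomain Ω γ L c σ) {h Φ : ℂ → ℝ} (hh : Smooth h) (hΦ : Smooth Φ)
    (h0 : ∀ z ∈ frontier Ω, h z = 0) (hd : ∀ z ∈ frontier Ω, ∀ e, pd e h z = 0) :
    ∫ z in Ω, h z * lapR Φ z = ∫ z in Ω, Φ z * lapR h z := by
  have hP : ∀ e, Smooth fun z => h z * pd e Φ z - Φ z * pd e h z := fun e =>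
    (hh.mul (hΦ.pd e)).sub (hΦ.mul (hh.pd e))
  have hdiv := S.integral_div (hP 1) (hP Complex.I)
  have hpt : ∀ z, pd 1 (fun z => h z * pd 1 Φ z - Φ z * pd 1 h z) z +
      pd Complex.I (fun z => h z * pd Complex.I Φ z - Φ z * pd Complex.I h z) z =
      h z * lapR Φ z - Φ z * lapR h z := by
    intro z
    simp only [pd_sub (hh.mul (hΦ.pd _)) (hΦ.mul (hh.pd _)), pd_mul hh (hΦ.pd _),
      pd_mul hΦ (hh.pd _), lapR_eq_pd]
    ring
  simp only [hpt] at hdiv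
  rw [integral_sub (S.integrableOn (hh.mul (smooth_lapR hΦ)).continuous)
    (S.integrableOn (hΦ.mul (smooth_lapR hh)).continuous)] at hdiv
  have hz : ∀ s, ((h (γ s) * pd 1 Φ (γ s) - Φ (γ s) * pd 1 h (γ s)) * (normalC σ γ s).re +
      (h (γ s) * pd Complex.I Φ (γ s) - Φ (γ s) * pd Complex.I h (γ s)) *
        (normalC σ γ s).im) = 0 := fun s => by
    rw [h0 _ (S.mem_frontier s), hd _ (S.mem_frontier s), hd _ (S.mem_frontier s)]
    ring
  simp only [hz, intervalIntegral.integral_zero] at hdiv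
  linarith

theorem core_doubling (S : StarDomain Ω γ L c σ) {h : ℂ → ℝ} {A a : ℝ} (hh : Smooth h)
    (h0 : ∀ z ∈ frontier Ω, h z = 0) (hd : ∀ z ∈ frontier Ω, ∀ e, pd e h z = 0) (hA0 : 0 ≤ A)
    (hA : ∀ z ∈ Ω, -A ≤ lapR h z) (ha : 0 < a) (x : ℂ) :
    ∫ z in Ω, h z * lapR (corePot a x) z ≤ (∫ z in Ω, h z * lapR (corePot (2 * a) x) z) +
      8 * A * a * ∫ z : ℂ, ((1 + ‖z‖) ^ 4)⁻¹ := by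
  have s1 := (corePot_spec ha x).1
  have s2 := (corePot_spec (show 0 < 2 * a by positivity) x).1
  have i1 := S.integrableOn (s1.mul (smooth_lapR hh)).continuous
  have i2 := S.integrableOn (s2.mul (smooth_lapR hh)).continuous
  obtain ⟨hi, hI⟩ := integrable_sq_div ha x
  have hi' := hi.const_mul (2 * A)
  rw [S.integral_mul_lapR hh s1 h0 hd, S.integral_mul_lapR hh s2 h0 hd]
  have h1 : (∫ z in Ω, corePot a x z * lapR h z) - ∫ z in Ω, corePot (2 * a) x z * lapR h z ≤
      ∫ z in Ω, 2 * A * (a ^ 2 / (sqDist x z + a) ^ 2) := by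
    rw [← integral_sub i1 i2]
    refine setIntegral_mono_on (i1.sub i2) hi'.integrableOn S.isOpen.measurableSet fun z hz => ?_
    obtain ⟨b1, b2⟩ := corePot_sub_bounds ha x z
    have := hA z hz
    nlinarith
  have h2 : ∫ z in Ω, 2 * A * (a ^ 2 / (sqDist x z + a) ^ 2) ≤
      ∫ z, 2 * A * (a ^ 2 / (sqDist x z + a) ^ 2) :=
    setIntegral_le_integral hi' (Eventually.of_forall fun z => by
      simp only [Pi.zero_apply]; positivity)
  rw [integral_const_mul (2 * A) (μ := volume)] at h2
  have h3 := mul_le_mul_of_nonneg_left hI (show 0 ≤ 2 * A by positivity)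
  linarith

theorem core_iterate (S : StarDomain Ω γ L c σ) {h : ℂ → ℝ} {A a : ℝ} (hh : Smooth h)
    (h0 : ∀ z ∈ frontier Ω, h z = 0) (hd : ∀ z ∈ frontier Ω, ∀ e, pd e h z = 0) (hA0 : 0 ≤ A)
    (hA : ∀ z ∈ Ω, -A ≤ lapR h z) (ha : 0 < a) (x : ℂ) (n : ℕ) :
    (∫ z in Ω, h z * lapR (corePot (a / 2 ^ n) x) z) +
        8 * A * (a / 2 ^ n) * (∫ z : ℂ, ((1 + ‖z‖) ^ 4)⁻¹) ≤
      (∫ z in Ω, h z * lapR (corePot a x) z) + 8 * A * a * ∫ z : ℂ, ((1 + ‖z‖) ^ 4)⁻¹ := by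
  induction n with
  | zero => simp
  | succ n ih =>
    have := S.core_doubling hh h0 hd hA0 hA (a := a / 2 ^ (n + 1)) (by positivity) x
    have e : 2 * (a / 2 ^ (n + 1)) = a / 2 ^ n := by
      rw [pow_succ]
      field_simp
    rw [e] at this
    have e' : 8 * A * (a / 2 ^ n) * (∫ z : ℂ, ((1 + ‖z‖) ^ 4)⁻¹) =
        2 * (8 * A * (a / 2 ^ (n + 1)) * (∫ z : ℂ, ((1 + ‖z‖) ^ 4)⁻¹)) := by
      rw [← e]
      ring
    linarith

theorem core_lower (S : StarDomain Ω γ L c σ) {h : ℂ → ℝ} (hh : Smooth h) (hn : ∀ z, 0 ≤ h z)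
    {x : ℂ} {b : ℝ} (hb : 0 < b) (hball : closedBall x b ⊆ Ω)
    (hx : ∀ z ∈ closedBall x b, h x / 2 ≤ h z) :
    Real.pi / 2 * h x ≤ ∫ z in Ω, h z * lapR (corePot (b ^ 2) x) z := by
  have hb2 : 0 < b ^ 2 := by positivity
  obtain ⟨s1, l1⟩ := corePot_spec hb2 x
  have hi := S.integrableOn (hh.mul (smooth_lapR s1)).continuous
  have hnn : ∀ z, 0 ≤ h z * lapR (corePot (b ^ 2) x) z := fun z => by
    rw [l1]
    have := hn z
    have := sqDist_nonneg x z
    positivity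
  have h1 : ∫ z in closedBall x b, h z * lapR (corePot (b ^ 2) x) z ≤
      ∫ z in Ω, h z * lapR (corePot (b ^ 2) x) z :=
    setIntegral_mono_set hi (Eventually.of_forall hnn) hball.eventuallyLE
  refine le_trans ?_ h1
  have h2 : ∫ z in closedBall x b, h x / 2 * (b ^ 2)⁻¹ ≤
      ∫ z in closedBall x b, h z * lapR (corePot (b ^ 2) x) z := by
    refine setIntegral_mono_on (integrableOn_const (measure_closedBall_lt_top.ne))
      (hi.mono_set hball) measurableSet_closedBall fun z hz => ?_
    rw [l1]
    have hs0 := sqDist_nonneg x z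
    have hs : sqDist x z ≤ b ^ 2 := by
      rw [sqDist_eq, ← dist_eq_norm]
      exact pow_le_pow_left₀ dist_nonneg (mem_closedBall.1 hz) 2
    have hk : (b ^ 2)⁻¹ ≤ 8 * (b ^ 2) ^ 2 / (sqDist x z + b ^ 2) ^ 3 := by
      rw [show (b ^ 2)⁻¹ = 8 * (b ^ 2) ^ 2 / (b ^ 2 + b ^ 2) ^ 3 by field_simp; norm_num]
      gcongr
    have := hx z hz
    have := hn x
    have := hn z
    gcongr
  refine le_trans (le_of_eq ?_) h2
  rw [setIntegral_const, Measure.real, Complex.volume_closedBall]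
  simp [ENNReal.toReal_ofReal hb.le]
  field_simp

theorem core_upper (S : StarDomain Ω γ L c σ) {h : ℂ → ℝ} (hh : Smooth h) (hn : ∀ z, 0 ≤ h z)
    {x : ℂ} {a r H : ℝ} (ha : 0 < a) (hr : 0 < r) (hH : ∀ z ∈ Ω, h z ≤ H) (hH0 : 0 ≤ H) :
    ∫ z in Ω, h z * lapR (corePot a x) z ≤ 8 / a * (∫ z in Ω ∩ closedBall x r, h z) +
      32 * H * a / r ^ 2 * ∫ z : ℂ, ((1 + ‖z‖) ^ 4)⁻¹ := by
  obtain ⟨s1, l1⟩ := corePot_spec ha x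
  obtain ⟨hi, hI⟩ := integrable_sq_div ha x
  have hms := S.isOpen.measurableSet
  have i1 := S.integrableOn (hh.mul (smooth_lapR s1)).continuous
  have ih := S.integrableOn hh.continuous
  have hi' := hi.const_mul (8 * H / r ^ 2)
  have iind : IntegrableOn ((closedBall x r).indicator h) Ω :=
    ih.indicator measurableSet_closedBall
  have h1 : ∫ z in Ω, h z * lapR (corePot a x) z ≤
      ∫ z in Ω, (8 / a * (closedBall x r).indicator h z +
        8 * H / r ^ 2 * (a ^ 2 / (sqDist x z + a) ^ 2)) := by
    refine setIntegral_mono_on i1 ((iind.const_mul _).add hi'.integrableOn) hms fun z hz => ?_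
    rw [l1]
    have hs0 := sqDist_nonneg x z
    have hz0 := hn z
    by_cases hzr : z ∈ closedBall x r
    · rw [indicator_of_mem hzr]
      have : 8 * a ^ 2 / (sqDist x z + a) ^ 3 ≤ 8 / a := by
        rw [show 8 / a = 8 * a ^ 2 / (0 + a) ^ 3 by field_simp; ring]
        gcongr
      have h2 := mul_le_mul_of_nonneg_left this hz0
      have : 0 ≤ 8 * H / r ^ 2 * (a ^ 2 / (sqDist x z + a) ^ 2) := by positivity
      linarith
    · rw [indicator_of_notMem hzr, mul_zero, zero_add]
      have hs : r ^ 2 ≤ sqDist x z + a := by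
        rw [sqDist_eq, ← dist_eq_norm]
        rw [mem_closedBall, not_le] at hzr
        have := pow_le_pow_left₀ hr.le hzr.le 2
        linarith
      calc h z * (8 * a ^ 2 / (sqDist x z + a) ^ 3)
          = 8 * h z / (sqDist x z + a) * (a ^ 2 / (sqDist x z + a) ^ 2) := by
            field_simp
        _ ≤ 8 * H / r ^ 2 * (a ^ 2 / (sqDist x z + a) ^ 2) := by
            have := hH z hz
            gcongr
  rw [integral_add (iind.const_mul _) hi'.integrableOn, integral_const_mul,
    setIntegral_indicator measurableSet_closedBall] at h1
  have h2 : ∫ z in Ω, 8 * H / r ^ 2 * (a ^ 2 / (sqDist x z + a) ^ 2) ≤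
      ∫ z, 8 * H / r ^ 2 * (a ^ 2 / (sqDist x z + a) ^ 2) :=
    setIntegral_le_integral hi' (Eventually.of_forall fun z => by
      simp only [Pi.zero_apply]; positivity)
  rw [integral_const_mul (8 * H / r ^ 2) (μ := volume)] at h2
  have h3 := mul_le_mul_of_nonneg_left hI (show 0 ≤ 8 * H / r ^ 2 by positivity)
  have e : 8 * H / r ^ 2 * (4 * a * ∫ z : ℂ, ((1 + ‖z‖) ^ 4)⁻¹) =
      32 * H * a / r ^ 2 * ∫ z : ℂ, ((1 + ‖z‖) ^ 4)⁻¹ := by ring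
  linarith

theorem mean_value_bound (S : StarDomain Ω γ L c σ) {h : ℂ → ℝ} {A a r H : ℝ} (hh : Smooth h)
    (hn : ∀ z, 0 ≤ h z) (h0 : ∀ z ∈ frontier Ω, h z = 0)
    (hd : ∀ z ∈ frontier Ω, ∀ e, pd e h z = 0) (hA0 : 0 ≤ A) (hA : ∀ z ∈ Ω, -A ≤ lapR h z)
    (ha : 0 < a) (hr : 0 < r) (hH : ∀ z ∈ Ω, h z ≤ H) (hH0 : 0 ≤ H) {x : ℂ} (hx : x ∈ Ω) :
    Real.pi / 2 * h x ≤ 8 / a * (∫ z in Ω ∩ closedBall x r, h z) +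
      (32 * H * a / r ^ 2 + 8 * A * a) * ∫ z : ℂ, ((1 + ‖z‖) ^ 4)⁻¹ := by
  have hup := S.core_upper hh hn (x := x) ha hr hH hH0
  have hI : 0 ≤ ∫ z : ℂ, ((1 + ‖z‖) ^ 4)⁻¹ := integral_nonneg fun z => by positivity
  rcases (hn x).eq_or_lt with hx0 | hx0
  · rw [← hx0, mul_zero]
    have : 0 ≤ ∫ z in Ω ∩ closedBall x r, h z := integral_nonneg fun z => hn z
    positivity
  have hnear : ∀ᶠ z in 𝓝 x, z ∈ Ω ∧ h x / 2 < h z :=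
    (IsOpen.eventually_mem S.isOpen hx).and (hh.continuous.continuousAt.eventually_const_lt (by linarith))
  obtain ⟨d, hd0, hdb⟩ := Metric.eventually_nhds_iff_ball.1 hnear
  obtain ⟨n, hn'⟩ := ((tendsto_const_nhds (x := a)).div_atTop
    (tendsto_pow_atTop_atTop_of_one_lt (one_lt_two (α := ℝ)))).eventually_lt_const
      (show 0 < d ^ 2 by positivity) |>.exists
  set b := Real.sqrt (a / 2 ^ n) with hb
  have hb2 : b ^ 2 = a / 2 ^ n := Real.sq_sqrt (by positivity)
  have hb0 : 0 < b := Real.sqrt_pos.2 (by positivity)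
  have hbd : b < d := by
    rw [← hb2] at hn'
    exact lt_of_pow_lt_pow_left₀ 2 hd0.le hn'
  have hsub : ∀ z ∈ closedBall x b, z ∈ Ω ∧ h x / 2 < h z := fun z hz =>
    hdb z (closedBall_subset_ball hbd hz)
  have hlow := S.core_lower hh hn hb0 (fun z hz => (hsub z hz).1) fun z hz => (hsub z hz).2.le
  rw [hb2] at hlow
  have hit := S.core_iterate hh h0 hd hA0 hA ha x n
  have : 0 ≤ 8 * A * (a / 2 ^ n) * (∫ z : ℂ, ((1 + ‖z‖) ^ 4)⁻¹) := by positivity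
  linarith

end StarDomain

theorem smooth_gap {u g : ℂ → ℂ} (hu : ContDiff ℝ (⊤ : ℕ∞) u) (hg : ContDiff ℝ (⊤ : ℕ∞) g) :
    Smooth (gap u g) :=
  (((smooth_re_comp hu).sub (smooth_re_comp hg)).pow 2).add
    (((smooth_im_comp hu).sub (smooth_im_comp hg)).pow 2)

theorem gap_eq_mul (u g : ℂ → ℂ) : gap u g = fun z =>
    ((u z).re - (g z).re) * ((u z).re - (g z).re) +
      ((u z).im - (g z).im) * ((u z).im - (g z).im) := by
  funext z
  rw [gap]
  ring

theorem pd_gap_eq_zero {u g : ℂ → ℂ} (hu : ContDiff ℝ (⊤ : ℕ∞) u) (hg : ContDiff ℝ (⊤ : ℕ∞) g)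
    {z : ℂ} (h : u z = g z) (e : ℂ) : pd e (gap u g) z = 0 := by
  have h1 : Smooth fun z => (u z).re - (g z).re := (smooth_re_comp hu).sub (smooth_re_comp hg)
  have h2 : Smooth fun z => (u z).im - (g z).im := (smooth_im_comp hu).sub (smooth_im_comp hg)
  rw [gap_eq_mul, pd_add (h1.mul h1) (h2.mul h2), pd_mul h1 h1, pd_mul h2 h2]
  simp [h]

theorem lapR_gap_ge {u g : ℂ → ℂ} (hu : ContDiff ℝ (⊤ : ℕ∞) u) (hg : ContDiff ℝ (⊤ : ℕ∞) g)
    {ε : ℝ} (hε : 0 < ε) (z : ℂ) :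
    -((ε ^ 2)⁻¹ * gap u g z + ε ^ 2 * lapSq u g z) ≤ lapR (gap u g) z := by
  have h1 : Smooth fun z => (u z).re - (g z).re := (smooth_re_comp hu).sub (smooth_re_comp hg)
  have h2 : Smooth fun z => (u z).im - (g z).im := (smooth_im_comp hu).sub (smooth_im_comp hg)
  have key : ∀ a b : ℝ, -((ε ^ 2)⁻¹ * a ^ 2 + ε ^ 2 * b ^ 2) ≤ 2 * (a * b) := fun a b => by
    have e : (ε ^ 2)⁻¹ * a ^ 2 + ε ^ 2 * b ^ 2 + 2 * (a * b) = (ε⁻¹ * a + ε * b) ^ 2 := by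
      field_simp
      ring
    nlinarith [sq_nonneg (ε⁻¹ * a + ε * b)]
  have k1 := key ((u z).re - (g z).re) (lapR (fun z => (u z).re - (g z).re) z)
  have k2 := key ((u z).im - (g z).im) (lapR (fun z => (u z).im - (g z).im) z)
  have n1 := gsq_nonneg (fun z => (u z).re - (g z).re) z
  have n2 := gsq_nonneg (fun z => (u z).im - (g z).im) z
  have e : lapR (gap u g) z =
      2 * (((u z).re - (g z).re) * lapR (fun z => (u z).re - (g z).re) z) +
      2 * (((u z).im - (g z).im) * lapR (fun z => (u z).im - (g z).im) z) +
      2 * gsq (fun z => (u z).re - (g z).re) z + 2 * gsq (fun z => (u z).im - (g z).im) z := by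
    rw [gap_eq_mul, lapR_add (h1.mul h1) (h2.mul h2), lapR_mul h1 h1, lapR_mul h2 h2, gsq, gsq]
    ring
  rw [e, gap, lapSq]
  linarith

theorem StarDomain.eventually_far {Ω : Set ℂ} {γ : ℝ → ℂ} {L c σ : ℝ}
    (S : StarDomain Ω γ L c σ) {Γ : Set ℂ} {W : ℂ → ℝ} {R₀ : ℝ} {g : ℂ → ℂ}
    (hW : PotentialHyp Γ W R₀) (hR : 0 ≤ R₀) (hg : ContDiff ℝ (⊤ : ℕ∞) g)
    (hgΓ : ∀ z ∈ frontier Ω, g z ∈ Γ) {K δ : ℝ} (hK : 0 ≤ K) (hδ : 0 < δ) :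
    ∃ ε₀, 0 < ε₀ ∧ ∀ (ε : ℝ) (u : ℂ → ℂ), 0 < ε → ε < ε₀ → SolvesGL W Ω ε u →
      (∀ z ∈ frontier Ω, u z = g z) → ∀ x ∈ Ω, ∀ p ∈ frontier Ω, ‖x - p‖ ≤ K * ε →
      Metric.infDist (u x) Γ ≤ δ := by
  obtain ⟨M, hM⟩ := S.bounded.closure.subset_closedBall (0 : ℂ)
  obtain ⟨C, hC0, hC⟩ := exists_lipschitz_bound hg M
  obtain ⟨G, hG⟩ := S.isCompact_closure.exists_bound_of_continuousOn hg.continuous.continuousOn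
  obtain ⟨A, hA, hAb⟩ := exists_lapSq_bound S.isOpen S.bounded hW hR hg hgΓ
  have hM0 : 0 ≤ M := by
    have := hM (subset_closure S.zero_mem)
    rw [mem_closedBall_zero_iff, norm_zero] at this
    exact this
  set H := (R₀ + G) ^ 2 with hH
  have hH0 : 0 ≤ H := by positivity
  set I := ∫ z : ℂ, ((1 + ‖z‖) ^ 4)⁻¹ with hI
  have hI0 : 0 ≤ I := integral_nonneg fun z => by positivity
  set k := δ ^ 2 / 8 / ((40 * H + 8 * A) * I + 1) with hk
  have hk0 : 0 < k := by positivity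
  set η := k * δ ^ 2 / 64 with hη
  have hη0 : 0 < η := by positivity
  have hρ : 0 < 1 + K + M := by positivity
  obtain ⟨ε₁, hε₁, hmass⟩ := S.exists_small_mass hW hR hg hgΓ hρ hη0
  refine ⟨min ε₁ (min 1 (δ / (2 * (C * K + 1)))),
    lt_min hε₁ (lt_min one_pos (by positivity)), fun ε u hε hεlt hu hug x hx p hp hxp => ?_⟩
  have hε1 : ε ≤ 1 := hεlt.le.trans ((min_le_right _ _).trans (min_le_left _ _))
  have hεδ : C * (K * ε) ≤ δ / 2 := by
    have := hεlt.le.trans ((min_le_right _ _).trans (min_le_right _ _))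
    rw [le_div_iff₀ (by positivity)] at this
    nlinarith
  have huΓ : ∀ z ∈ frontier Ω, u z ∈ Γ := fun z hz => by rw [hug z hz]; exact hgΓ z hz
  have hgapH : ∀ z ∈ Ω, gap u g z ≤ H := fun z hz => by
    have hzc := subset_closure hz
    rw [gap_eq]
    exact pow_le_pow_left₀ (norm_nonneg _) ((norm_sub_le _ _).trans (add_le_add
      (norm_le_of_solvesGL hW hR S.isOpen S.bounded hu huΓ hzc) (hG z hzc))) 2
  have hlap : ∀ z ∈ Ω, -((H + A) * (ε ^ 2)⁻¹) ≤ lapR (gap u g) z := fun z hz => by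
    refine le_trans ?_ (lapR_gap_ge hu.1 hg hε z)
    have h1 := mul_le_mul_of_nonneg_left (hgapH z hz) (show 0 ≤ (ε ^ 2)⁻¹ by positivity)
    have h2 := mul_le_mul_of_nonneg_left (hAb ε u hε hε1 hu hug p hp z hz).1
      (show 0 ≤ ε ^ 2 by positivity)
    have e : ε ^ 2 * (A * (ε ^ 4)⁻¹) = A * (ε ^ 2)⁻¹ := by field_simp
    linarith
  have hmv := S.mean_value_bound (smooth_gap hu.1 hg) (gap_nonneg u g)
    (fun z hz => by simp [gap, hug z hz]) (fun z hz e => pd_gap_eq_zero hu.1 hg (hug z hz) e)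
    (by positivity) hlap (show 0 < k * ε ^ 2 by positivity) hε hgapH hH0 hx
  have hsub : Ω ∩ closedBall x ε ⊆ Ω ∩ closedBall ((1 + (ε : ℂ)) * p) ((1 + K + M) * ε) := by
    refine inter_subset_inter_right _ (closedBall_subset_closedBall' ?_)
    have hpM : ‖p‖ ≤ M := mem_closedBall_zero_iff.1 (hM (frontier_subset_closure hp))
    have h1 : dist x ((1 + (ε : ℂ)) * p) ≤ K * ε + ε * M := by
      rw [dist_eq_norm, show x - (1 + (ε : ℂ)) * p = (x - p) - (ε : ℂ) * p by ring]
      refine (norm_sub_le _ _).trans (add_le_add hxp ?_)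
      rw [norm_mul, Complex.norm_real, Real.norm_of_nonneg hε.le]
      gcongr
    linarith
  have hle : ∫ z in Ω ∩ closedBall x ε, gap u g z ≤ η * ε ^ 2 :=
    (setIntegral_mono_set ((S.integrableOn (smooth_gap hu.1 hg).continuous).mono_set
      inter_subset_left) (Eventually.of_forall (gap_nonneg u g)) hsub.eventuallyLE).trans
      (hmass ε u hε (hεlt.trans_le (min_le_left _ _)) hu hug p hp)
  have h1 : 8 / (k * ε ^ 2) * (∫ z in Ω ∩ closedBall x ε, gap u g z) ≤ δ ^ 2 / 8 := by
    calc _ ≤ 8 / (k * ε ^ 2) * (η * ε ^ 2) := by gcongr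
      _ = δ ^ 2 / 8 := by
        rw [hη]
        field_simp
        norm_num
  have h2 : (32 * H * (k * ε ^ 2) / ε ^ 2 + 8 * ((H + A) * (ε ^ 2)⁻¹) * (k * ε ^ 2)) * I ≤
      δ ^ 2 / 8 := by
    have e : (32 * H * (k * ε ^ 2) / ε ^ 2 + 8 * ((H + A) * (ε ^ 2)⁻¹) * (k * ε ^ 2)) * I =
        k * ((40 * H + 8 * A) * I) := by
      field_simp
      ring
    have : k * ((40 * H + 8 * A) * I + 1) = δ ^ 2 / 8 := by
      rw [hk]
      field_simp
    rw [e]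
    linarith
  have hgx : gap u g x ≤ (δ / 2) ^ 2 := by
    have hpi := Real.pi_gt_three
    have := gap_nonneg u g x
    nlinarith
  rw [gap_eq] at hgx
  have hux : ‖u x - g x‖ ≤ δ / 2 := le_of_sq_le_sq hgx (by positivity)
  have hgxp : ‖g x - g p‖ ≤ δ / 2 :=
    (hC x (hM (subset_closure hx)) p (hM (frontier_subset_closure hp))).trans
      ((mul_le_mul_of_nonneg_left hxp hC0).trans hεδ)
  refine (Metric.infDist_le_dist_of_mem (hgΓ p hp)).trans ?_
  rw [dist_eq_norm, ← sub_add_sub_cancel (u x) (g x) (g p)]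
  exact (norm_add_le _ _).trans (by linarith)

/-- Lemma 5.2: for solutions on a smooth bounded strictly star-shaped
domain with smooth `Γ`-valued boundary datum, if `x_ε ∈ Ω` satisfies
`dist(u_ε(x_ε),Γ) > δ₂` for every `ε` (with `0 < δ₂ ≤ δ₁`), then
`dist(x_ε,∂Ω)/ε → ∞` as `ε → 0`. -/
theorem bad_points_far_from_boundary
    (Γ : Set ℂ) (τ : ℝ → ℂ) (W : ℂ → ℝ) (R₀ : ℝ)
    (hΓ : ArcParam Γ τ) (hW : PotentialHyp Γ W R₀)
    (Ω : Set ℂ) (hΩo : IsOpen Ω) (hΩb : Bornology.IsBounded Ω) (h0 : (0 : ℂ) ∈ Ω)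
    (γ : ℝ → ℂ) (L : ℝ) (hγ : BoundaryParam Ω γ L)
    (nv : ℝ → ℂ) (hn : OutwardNormal Ω γ nv)
    (c : ℝ) (hc : 0 < c)
    (hstar : ∀ s, c ≤ (γ s).re * (nv s).re + (γ s).im * (nv s).im)
    (g : ℂ → ℂ) (hg : ContDiff ℝ (⊤ : ℕ∞) g) (hgΓ : ∀ x ∈ frontier Ω, g x ∈ Γ)
    (u : ℝ → ℂ → ℂ)
    (hu : ∀ ε > (0 : ℝ), SolvesGL W Ω ε (u ε) ∧ ∀ x ∈ frontier Ω, u ε x = g x)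
    (δ₁ m : ℝ) (hδ₁ : 0 < δ₁) (hm : 0 < m) (hmax : MaxPrinciple Γ τ W δ₁ m)
    (δ₂ : ℝ) (hδ₂ : 0 < δ₂) (hδ₂' : δ₂ ≤ δ₁)
    (x : ℝ → ℂ)
    (hx : ∀ ε > (0 : ℝ), x ε ∈ Ω ∧ δ₂ < Metric.infDist (u ε (x ε)) Γ) :
    Tendsto (fun ε => Metric.infDist (x ε) (frontier Ω) / ε) (𝓝[>] (0 : ℝ)) atTop := by
  obtain ⟨σ, S⟩ := exists_starDomain hΩo hΩb hc h0 hγ hn hstar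
  have hR : 0 ≤ R₀ := (norm_nonneg _).trans (hW.R0_large _ (hgΓ _ (S.mem_frontier 0))).le
  refine tendsto_atTop.2 fun b => ?_
  obtain ⟨ε₀, hε₀, hfar⟩ := S.eventually_far hW hR hg hgΓ (abs_nonneg b) hδ₂
  filter_upwards [Ioo_mem_nhdsGT hε₀] with ε hε
  by_contra! hlt
  obtain ⟨p, hp, hpd⟩ := (isClosed_frontier (s := Ω)).exists_infDist_eq_dist
    ⟨γ 0, S.mem_frontier 0⟩ (x ε)
  have hnear : ‖x ε - p‖ ≤ |b| * ε := by
    rw [← dist_eq_norm, ← hpd]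
    exact ((div_lt_iff₀ hε.1).1 hlt).le.trans
      (mul_le_mul_of_nonneg_right (le_abs_self b) hε.1.le)
  exact absurd (hfar ε (u ε) hε.1 hε.2 (hu ε hε.1).1 (hu ε hε.1).2 (x ε) (hx ε hε.1).1 p hp hnear)
    (not_le.2 (hx ε hε.1).2)
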